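/- arXiv:0708.2900 — 18 statements merged into one kernel-verified Lean document; each statement's English description precedes it below -/
import Mathlib

section
/- Let E be a real normed vector space and let a, b, c be three pairwise distinct points of E. Then ‖c − a‖ ≤ ‖b − a‖ + ‖c − b‖, and equality holds if and only if the closed segment joining the unit vectors x = ‖b − a‖⁻¹ • (b − a) and y = ‖c − b‖⁻¹ • (c − b) is contained in the unit sphere {v : ‖v‖ = 1}. -/
/-- If `s ≥ t`, then equality in the triangle inequality for `u` and `v` passes to `s • u` and
`t • v`. -/
lemma norm_smul_add_smul_of_le {E : Type*} [SeminormedAddCommGroup E] [NormedSpace ℝ E] {u v : E}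
    (h : ‖u + v‖ = ‖u‖ + ‖v‖) {s t : ℝ} (ht : 0 ≤ t) (hts : t ≤ s) :
    ‖s • u + t • v‖ = s * ‖u‖ + t * ‖v‖ := by
  have hs : 0 ≤ s := ht.trans hts
  apply le_antisymm
  · simpa only [norm_smul_of_nonneg hs, norm_smul_of_nonneg ht] using norm_add_le (s • u) (t • v)
  · have key : s • u + t • v = s • (u + v) - (s - t) • v := by module
    have := norm_sub_norm_le (s • (u + v)) ((s - t) • v)
    rw [← key, norm_smul_of_nonneg hs, norm_smul_of_nonneg (sub_nonneg.2 hts), h] at this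
    linarith

/-- Equality in the triangle inequality for `u` and `v` passes to all nonnegative multiples. -/
lemma norm_smul_add_smul_of_nonneg {E : Type*} [SeminormedAddCommGroup E] [NormedSpace ℝ E]
    {u v : E} (h : ‖u + v‖ = ‖u‖ + ‖v‖) {s t : ℝ} (hs : 0 ≤ s) (ht : 0 ≤ t) :
    ‖s • u + t • v‖ = s * ‖u‖ + t * ‖v‖ := by
  rcases le_total t s with hts | hst
  · exact norm_smul_add_smul_of_le h ht hts
  · rw [add_comm, norm_smul_add_smul_of_le (by rw [add_comm, h, add_comm]) hs hst, add_comm]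

/-- Equality holds in the triangle inequality for nonzero `u` and `v` if and only if the segment
between their normalizations lies on the unit sphere. -/
lemma norm_add_eq_iff_segment_subset {E : Type*} [NormedAddCommGroup E] [NormedSpace ℝ E]
    {u v : E} (hu : u ≠ 0) (hv : v ≠ 0) :
    ‖u + v‖ = ‖u‖ + ‖v‖ ↔ segment ℝ (‖u‖⁻¹ • u) (‖v‖⁻¹ • v) ⊆ {w : E | ‖w‖ = 1} := by
  have hp : 0 < ‖u‖ := norm_pos_iff.2 hu
  have hq : 0 < ‖v‖ := norm_pos_iff.2 hv
  constructor
  · rintro h _ ⟨α, β, hα, hβ, hαβ, rfl⟩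
    rw [Set.mem_ofPred_eq, smul_smul, smul_smul,
      norm_smul_add_smul_of_nonneg h (by positivity) (by positivity)]
    field_simp
    exact hαβ
  · intro h
    have hmem : (‖u‖ + ‖v‖)⁻¹ • (u + v) ∈ segment ℝ (‖u‖⁻¹ • u) (‖v‖⁻¹ • v) := by
      refine ⟨‖u‖ / (‖u‖ + ‖v‖), ‖v‖ / (‖u‖ + ‖v‖), by positivity, by positivity,
        by field_simp, ?_⟩
      rw [smul_smul, smul_smul, smul_add]
      congr 2 <;> field_simp
    have h1 : ‖(‖u‖ + ‖v‖)⁻¹ • (u + v)‖ = 1 := h hmem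
    rw [norm_smul_of_nonneg (by positivity)] at h1
    field_simp at h1
    exact h1

theorem triangle_inequality_equality_iff_segment_on_sphere
    {E : Type*} [NormedAddCommGroup E] [NormedSpace ℝ E]
    (a b c : E) (hab : a ≠ b) (hbc : b ≠ c) (hac : a ≠ c) :
    ‖c - a‖ ≤ ‖b - a‖ + ‖c - b‖ ∧
      (‖c - a‖ = ‖b - a‖ + ‖c - b‖ ↔
        segment ℝ (‖b - a‖⁻¹ • (b - a)) (‖c - b‖⁻¹ • (c - b)) ⊆ {v : E | ‖v‖ = 1}) := by
  have hsum : c - a = (b - a) + (c - b) := by abel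
  rw [hsum]
  exact ⟨norm_add_le _ _,
    norm_add_eq_iff_segment_subset (sub_ne_zero.2 hab.symm) (sub_ne_zero.2 hbc.symm)⟩
end

section
/- Let E be a real normed vector space and let v ∈ E with ‖v‖ = 1. Then v is an extreme point of the closed unit ball of E if and only if for all pairwise distinct points a, b, c ∈ E with c − a = ‖c − a‖ • v, the equality ‖c − a‖ = ‖b − a‖ + ‖c − b‖ implies that a, b, c are collinear. -/
theorem extremePoint_iff_strict_triangle_inequality
    {E : Type*} [NormedAddCommGroup E] [NormedSpace ℝ E]
    (v : E) (hv : ‖v‖ = 1) :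
    v ∈ Set.extremePoints ℝ (Metric.closedBall (0 : E) 1) ↔
      ∀ a b c : E, a ≠ b → b ≠ c → a ≠ c → c - a = ‖c - a‖ • v →
        ‖c - a‖ = ‖b - a‖ + ‖c - b‖ → Collinear ℝ {a, b, c} := by
  rw [mem_extremePoints_iff_left]
  constructor
  · rintro ⟨-, hext⟩ a b c hab hbc - hdir htri
    have hr : 0 < ‖b - a‖ := norm_pos_iff.2 (sub_ne_zero.2 hab.symm)
    have hs : 0 < ‖c - b‖ := norm_pos_iff.2 (sub_ne_zero.2 hbc.symm)
    have hd : 0 < ‖c - a‖ := by linarith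
    have hunit : ‖b - a‖⁻¹ • (b - a) = v := by
      refine hext _ ?_ (‖c - b‖⁻¹ • (c - b)) ?_
        ⟨‖b - a‖ / ‖c - a‖, ‖c - b‖ / ‖c - a‖, by positivity, by positivity, ?_, ?_⟩
      · simp [norm_smul, hr.ne']
      · simp [norm_smul, hs.ne']
      · rw [← add_div, ← htri, div_self hd.ne']
      · have h₁ : ‖b - a‖ / ‖c - a‖ * ‖b - a‖⁻¹ = ‖c - a‖⁻¹ := by field_simp
        have h₂ : ‖c - b‖ / ‖c - a‖ * ‖c - b‖⁻¹ = ‖c - a‖⁻¹ := by field_simp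
        rw [smul_smul, smul_smul, h₁, h₂, ← smul_add, add_comm, sub_add_sub_cancel]
        exact (inv_smul_eq_iff₀ hd.ne').2 hdir
    rw [collinear_iff_of_mem (p₀ := a) (by simp)]
    refine ⟨v, ?_⟩
    rintro p (rfl | rfl | rfl)
    · exact ⟨0, by simp⟩
    · refine ⟨‖p - a‖, ?_⟩
      rw [vadd_eq_add, ← sub_eq_iff_eq_add]
      exact (inv_smul_eq_iff₀ hr.ne').1 hunit
    · exact ⟨‖p - a‖, by rw [vadd_eq_add, ← sub_eq_iff_eq_add]; exact hdir⟩
  · intro h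
    refine ⟨by simp [hv], ?_⟩
    rintro x hx y hy ⟨p, q, hp, hq, hpq, hxy⟩
    rw [mem_closedBall_zero_iff] at hx hy
    have hpx : ‖p • x‖ = p * ‖x‖ := by rw [norm_smul, Real.norm_of_nonneg hp.le]
    have hqy : ‖q • y‖ = q * ‖y‖ := by rw [norm_smul, Real.norm_of_nonneg hq.le]
    have hle : 1 ≤ p * ‖x‖ + q * ‖y‖ := by
      rw [← hv, ← hxy, ← hpx, ← hqy]
      exact norm_add_le _ _
    have hpx' : ‖p • x‖ = p := by
      rw [hpx]; nlinarith [mul_le_mul_of_nonneg_left hx hp.le, mul_le_mul_of_nonneg_left hy hq.le]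
    have hqy' : ‖q • y‖ = q := by
      rw [hqy]; nlinarith [mul_le_mul_of_nonneg_left hx hp.le, mul_le_mul_of_nonneg_left hy hq.le]
    have hsub : v - p • x = q • y := by rw [← hxy, add_sub_cancel_left]
    have hv0 : v ≠ 0 := by rintro rfl; simp at hv
    have hcol : Collinear ℝ {0, p • x, v} := by
      refine h 0 (p • x) v ?_ ?_ hv0.symm (by simp [hv]) ?_
      · intro h0
        rw [← h0, norm_zero] at hpx'
        exact hp.ne hpx'
      · intro h0
        rw [h0, sub_self] at hsub
        rw [← hsub, norm_zero] at hqy'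
        exact hq.ne hqy'
      · rw [sub_zero, sub_zero, hsub, hv, hpx', hqy', hpq]
    rw [collinear_iff_of_mem (p₀ := (0 : E)) (by simp)] at hcol
    obtain ⟨w, hw⟩ := hcol
    obtain ⟨r, hr⟩ := hw (p • x) (by simp)
    obtain ⟨s, hs⟩ := hw v (by simp)
    rw [vadd_eq_add, add_zero] at hr hs
    have hs0 : s ≠ 0 := by rintro rfl; exact hv0 (by simpa using hs)
    obtain ⟨t, ht⟩ : ∃ t : ℝ, p • x = t • v :=
      ⟨r / s, by rw [hr, hs, smul_smul, div_mul_cancel₀ _ hs0]⟩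
    have hqt : q • y = (1 - t) • v := by rw [← hsub, ht, sub_smul, one_smul]
    have habs : |t| = p := by rw [← hpx', ht, norm_smul, hv, mul_one, Real.norm_eq_abs]
    have habs' : |1 - t| = q := by rw [← hqy', hqt, norm_smul, hv, mul_one, Real.norm_eq_abs]
    have htp : t = p := by
      linarith [le_abs_self t, le_abs_self (1 - t)]
    rw [htp] at ht
    exact smul_right_injective E hp.ne' ht
end

section
/- Let E be a real normed vector space, let x, y, z ∈ E with y ≠ z, and let w = (1−λ)•y + λ•z for some 0 < λ < 1. Then ‖x − w‖ ≤ max(‖x − y‖, ‖x − z‖). Equality holds if and only if ‖x − w‖ = ‖x − y‖ = ‖x − z‖; and in the case of equality one has ‖x − v‖ = ‖x − w‖ for every v in the closed segment from y to z, and ‖x − p‖ ≥ ‖x − w‖ for every point p on the affine line through y and z. -/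
/-- If a convex function on `ℝ` attains, at a point strictly between `a` and `b`, a value that
bounds its values at `a` and `b`, then that value is its global minimum. -/
theorem ConvexOn.le_of_endpoints_le {f : ℝ → ℝ} (hf : ConvexOn ℝ Set.univ f) {a b c : ℝ}
    (hac : a < c) (hcb : c < b) (ha : f a ≤ f c) (hb : f b ≤ f c) (t : ℝ) : f c ≤ f t := by
  rcases lt_trichotomy t c with h | rfl | h
  · exact hf.le_left_of_right_le (Set.mem_univ t) (Set.mem_univ b)
      (by rw [openSegment_eq_Ioo (h.trans hcb)]; exact ⟨h, hcb⟩) hb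
  · exact le_rfl
  · exact hf.le_right_of_left_le (Set.mem_univ a) (Set.mem_univ t)
      (by rw [openSegment_eq_Ioo (hac.trans h)]; exact ⟨hac, h⟩) ha

/-- The distance from a fixed point is convex along a parametrized line. -/
theorem convexOn_norm_sub_line {E : Type*} [NormedAddCommGroup E] [NormedSpace ℝ E] (x y d : E) :
    ConvexOn ℝ Set.univ fun t : ℝ => ‖x - (y + t • d)‖ := by
  refine ⟨convex_univ, fun s _ t _ a b ha hb hab => ?_⟩
  have key : x - (y + (a • s + b • t) • d) =
      a • (x - (y + s • d)) + b • (x - (y + t • d)) := by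
    obtain rfl : b = 1 - a := by linarith
    simp only [smul_eq_mul]
    module
  calc ‖x - (y + (a • s + b • t) • d)‖
      ≤ ‖a • (x - (y + s • d))‖ + ‖b • (x - (y + t • d))‖ := key ▸ norm_add_le _ _
    _ = a • ‖x - (y + s • d)‖ + b • ‖x - (y + t • d)‖ := by
      rw [norm_smul_of_nonneg ha, norm_smul_of_nonneg hb, smul_eq_mul, smul_eq_mul]

theorem norm_max_ineq_on_segment
    {E : Type*} [NormedAddCommGroup E] [NormedSpace ℝ E]
    (x y z w : E) (hyz : y ≠ z) (lam : ℝ) (h0 : 0 < lam) (h1 : lam < 1)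
    (hw : w = (1 - lam) • y + lam • z) :
    ‖x - w‖ ≤ max ‖x - y‖ ‖x - z‖ ∧
      (‖x - w‖ = max ‖x - y‖ ‖x - z‖ ↔ ‖x - w‖ = ‖x - y‖ ∧ ‖x - w‖ = ‖x - z‖) ∧
      (‖x - w‖ = max ‖x - y‖ ‖x - z‖ →
        (∀ v ∈ segment ℝ y z, ‖x - v‖ = ‖x - w‖) ∧
        (∀ t : ℝ, ‖x - w‖ ≤ ‖x - (y + t • (z - y))‖)) := by
  obtain rfl : w = y + lam • (z - y) := by rw [hw]; module
  have hf := convexOn_norm_sub_line x y (z - y)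
  have hle : ∀ t ∈ Set.Icc (0 : ℝ) 1,
      ‖x - (y + t • (z - y))‖ ≤ max ‖x - y‖ ‖x - z‖ := fun t ht => by
    simpa using hf.le_max_of_mem_Icc (Set.mem_univ 0) (Set.mem_univ 1) ht
  have hmin (h : ‖x - (y + lam • (z - y))‖ = max ‖x - y‖ ‖x - z‖) (t : ℝ) :
      ‖x - (y + lam • (z - y))‖ ≤ ‖x - (y + t • (z - y))‖ :=
    hf.le_of_endpoints_le h0 h1 (by simp [h]) (by simp [h]) t
  refine ⟨hle lam ⟨h0.le, h1.le⟩, ⟨fun h => ⟨?_, ?_⟩, fun h => ?_⟩, fun h => ⟨?_, hmin h⟩⟩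
  · exact le_antisymm (by simpa using hmin h 0) (h ▸ le_max_left _ _)
  · exact le_antisymm (by simpa using hmin h 1) (h ▸ le_max_right _ _)
  · rw [← h.1, ← h.2, max_self]
  · rw [segment_eq_image']
    rintro _ ⟨t, ht, rfl⟩
    exact le_antisymm ((hle t ht).trans h.ge) (hmin h t)
end

section
/- Let E be a real normed vector space and let x, y ∈ E be nonzero vectors with ‖x‖ ≤ 1 and ‖y‖ ≤ 1. If ‖x − y‖ ≥ 1, then ‖ ‖x‖⁻¹ • x − ‖y‖⁻¹ • y ‖ ≥ 1. -/
/-- The one-sided case, where `x` is the shorter of the two vectors. -/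
theorem one_le_norm_normalized_sub_of_norm_le
    {E : Type*} [NormedAddCommGroup E] [NormedSpace ℝ E]
    {x y : E} (hx : x ≠ 0) (hy : y ≠ 0) (hle : ‖x‖ ≤ ‖y‖) (hy1 : ‖y‖ ≤ 1)
    (hxy : 1 ≤ ‖x - y‖) :
    1 ≤ ‖‖x‖⁻¹ • x - ‖y‖⁻¹ • y‖ := by
  have hx0 : 0 < ‖x‖ := norm_pos_iff.2 hx
  have hy0 : ‖y‖ ≠ 0 := norm_ne_zero_iff.2 hy
  have hdecomp : x - y =
      ‖x‖ • (‖x‖⁻¹ • x - ‖y‖⁻¹ • y) - (‖y‖ - ‖x‖) • (‖y‖⁻¹ • y) := by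
    rw [smul_sub, sub_smul, smul_inv_smul₀ hx0.ne', smul_inv_smul₀ hy0]
    abel
  have hunit : ‖‖y‖⁻¹ • y‖ = 1 := by
    rw [norm_smul, norm_inv, norm_norm, inv_mul_cancel₀ hy0]
  have hbound : ‖x - y‖ ≤ ‖x‖ * ‖‖x‖⁻¹ • x - ‖y‖⁻¹ • y‖ + (‖y‖ - ‖x‖) := by
    calc ‖x - y‖
        = ‖‖x‖ • (‖x‖⁻¹ • x - ‖y‖⁻¹ • y) - (‖y‖ - ‖x‖) • (‖y‖⁻¹ • y)‖ :=
          congrArg norm hdecomp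
      _ ≤ ‖‖x‖ • (‖x‖⁻¹ • x - ‖y‖⁻¹ • y)‖ + ‖(‖y‖ - ‖x‖) • (‖y‖⁻¹ • y)‖ :=
          norm_sub_le _ _
      _ = ‖x‖ * ‖‖x‖⁻¹ • x - ‖y‖⁻¹ • y‖ + (‖y‖ - ‖x‖) := by
          rw [norm_smul, norm_smul (‖y‖ - ‖x‖), hunit, norm_norm,
            Real.norm_of_nonneg (sub_nonneg.2 hle), mul_one]
  exact le_of_mul_le_mul_left (by linarith) hx0

theorem norm_normalized_sub_ge_one
    {E : Type*} [NormedAddCommGroup E] [NormedSpace ℝ E]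
    (x y : E) (hx : x ≠ 0) (hy : y ≠ 0) (hx1 : ‖x‖ ≤ 1) (hy1 : ‖y‖ ≤ 1)
    (hxy : 1 ≤ ‖x - y‖) :
    1 ≤ ‖‖x‖⁻¹ • x - ‖y‖⁻¹ • y‖ := by
  rcases le_total ‖x‖ ‖y‖ with hle | hle
  · exact one_le_norm_normalized_sub_of_norm_le hx hy hle hy1 hxy
  · rw [norm_sub_rev] at hxy ⊢
    exact one_le_norm_normalized_sub_of_norm_le hy hx hle hx1 hxy
end

section
/- Let E be a two-dimensional real normed vector space. Then every vector v ∈ E with ‖v‖ < 2 can be written as the sum of two unit vectors: there exist x, y ∈ E with ‖x‖ = ‖y‖ = 1 and v = x + y. -/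
/-- In a nontrivial real normed space every vector is its norm times some unit vector. -/
theorem exists_norm_eq_one_and_eq_norm_smul {E : Type*} [NormedAddCommGroup E] [NormedSpace ℝ E]
    [Nontrivial E] (v : E) : ∃ u : E, ‖u‖ = 1 ∧ v = ‖v‖ • u := by
  rcases eq_or_ne v 0 with rfl | hv
  · obtain ⟨u, hu⟩ := exists_norm_eq E (zero_le_one (α := ℝ))
    exact ⟨u, hu, by simp⟩
  · have h : ‖v‖ ≠ 0 := norm_ne_zero_iff.mpr hv
    exact ⟨‖v‖⁻¹ • v, by simp [norm_smul, h], by simp [smul_smul, h]⟩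

theorem sum_of_two_unit_vectors
    {E : Type*} [NormedAddCommGroup E] [NormedSpace ℝ E]
    (hdim : Module.finrank ℝ E = 2)
    (v : E) (hv : ‖v‖ < 2) :
    ∃ x y : E, ‖x‖ = 1 ∧ ‖y‖ = 1 ∧ v = x + y := by
  have hrank : 1 < Module.rank ℝ E := by
    rw [(Module.rank_eq_ofNat_iff_finrank_eq_ofNat 2).mpr hdim]
    exact Cardinal.one_lt_two
  have : Nontrivial E := Module.nontrivial_of_finrank_pos (R := ℝ) (by omega)
  obtain ⟨u, hu, hvu⟩ := exists_norm_eq_one_and_eq_norm_smul v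
  have h₁ : ‖v - u‖ ≤ 1 := by
    have h : v - u = (‖v‖ - 1) • u := by rw [sub_smul, one_smul, ← hvu]
    rw [h, norm_smul, hu, mul_one, Real.norm_eq_abs, abs_le]
    constructor <;> linarith [norm_nonneg v]
  have h₂ : 1 ≤ ‖v - -u‖ := by
    have h : v - -u = (‖v‖ + 1) • u := by rw [add_smul, one_smul, ← hvu, sub_neg_eq_add]
    rw [h, norm_smul, hu, mul_one, Real.norm_eq_abs]
    exact le_abs.mpr (Or.inl (by linarith [norm_nonneg v]))
  obtain ⟨x, hx, hxv⟩ := (isPreconnected_sphere hrank (0 : E) 1).intermediate_value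
    (a := u) (b := -u) (by simpa using hu) (by simpa using hu)
    (f := fun x => ‖v - x‖) (by fun_prop) ⟨h₁, h₂⟩
  exact ⟨x, v - x, by simpa using hx, hxv, by abel⟩
end

section
/- Let E be a two-dimensional real normed vector space. Then E is strictly convex if and only if any two distinct circles intersect in at most two points; that is, if and only if for all centres c₁, c₂ ∈ E and radii r₁, r₂ > 0 with (c₁, r₁) ≠ (c₂, r₂), any three points lying in the intersection of the sphere of centre c₁ and radius r₁ with the sphere of centre c₂ and radius r₂ include two equal points. -/
section StrictConvexPlane

variable {E : Type*} [NormedAddCommGroup E] [NormedSpace ℝ E]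

/-- In a strictly convex space, a unit vector that is a convex combination of vectors in the unit
ball equals every unit vector occurring in it with positive weight. -/
theorem eq_of_add_smul_eq_smul_add [StrictConvexSpace ℝ E] {x y w : E} {μ ν : ℝ}
    (hμ : 0 < μ) (hx : ‖x‖ = 1) (hw : ‖w‖ = 1) (hy : ‖y‖ ≤ ν)
    (h : (μ + ν) • w = μ • x + y) : x = w := by
  have hν : 0 ≤ ν := (norm_nonneg y).trans hy
  refine eq_of_norm_eq_of_norm_add_eq (hx.trans hw.symm) (le_antisymm (norm_add_le _ _) ?_)
  have hsum : (2 * μ + ν) • w = μ • (x + w) + y := by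
    linear_combination (norm := module) h
  have hle : 2 * μ + ν ≤ μ * ‖x + w‖ + ν := by
    calc 2 * μ + ν = ‖(2 * μ + ν) • w‖ := by
          rw [norm_smul, hw, Real.norm_of_nonneg (by positivity), mul_one]
      _ = ‖μ • (x + w) + y‖ := by rw [hsum]
      _ ≤ ‖μ • (x + w)‖ + ‖y‖ := norm_add_le _ _
      _ ≤ μ * ‖x + w‖ + ν := by
          rw [norm_smul, Real.norm_of_nonneg hμ.le]
          gcongr
  rw [hx, hw]
  nlinarith

theorem not_collinear_of_norm_sub_eq [StrictConvexSpace ℝ E] {c p q s : E} {r : ℝ}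
    (hp : ‖p - c‖ = r) (hq : ‖q - c‖ = r) (hs : ‖s - c‖ = r)
    (hpq : p ≠ q) (hps : p ≠ s) (hqs : q ≠ s) : ¬ Collinear ℝ {p, q, s} := by
  rw [← dist_eq_norm] at hp hq hs
  intro h
  rcases h.wbtw_or_wbtw_or_wbtw with hw | hw | hw
  · simpa [hp, hq, hs] using Sbtw.dist_lt_max_dist c ⟨hw, hpq.symm, hqs⟩
  · simpa [hp, hq, hs] using Sbtw.dist_lt_max_dist c ⟨hw, hqs.symm, hps.symm⟩
  · simpa [hp, hq, hs] using Sbtw.dist_lt_max_dist c ⟨hw, hps, hpq⟩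

/-- Three points of a plane that are not collinear span it: every vector is a linear combination
of them with prescribed total weight. -/
theorem exists_smul_add_eq_of_not_collinear (hdim : Module.finrank ℝ E = 2) {p q s : E}
    (h : ¬ Collinear ℝ {p, q, s}) (t : E) (m : ℝ) :
    ∃ a b c : ℝ, a + b + c = m ∧ a • p + b • q + c • s = t := by
  have hli : LinearIndependent ℝ ![q - p, s - p] := by
    rw [LinearIndependent.pair_iff]
    intro x y hxy
    by_contra hne
    apply h
    rw [collinear_iff_of_mem (p₀ := p) (by simp)]
    by_cases hx : x = 0
    · have hy : y ≠ 0 := fun hy => hne ⟨hx, hy⟩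
      have hs : s - p = 0 := by simpa [hx, hy] using hxy
      refine ⟨q - p, ?_⟩
      simp only [Set.mem_insert_iff, Set.mem_singleton_iff, forall_eq_or_imp, forall_eq, vadd_eq_add]
      exact ⟨⟨0, by simp⟩, ⟨1, by simp⟩, ⟨0, by simpa using sub_eq_zero.1 hs⟩⟩
    · refine ⟨s - p, ?_⟩
      simp only [Set.mem_insert_iff, Set.mem_singleton_iff, forall_eq_or_imp, forall_eq, vadd_eq_add]
      refine ⟨⟨0, by simp⟩, ⟨-(x⁻¹ * y), ?_⟩, ⟨1, by simp⟩⟩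
      have : q - p = -(x⁻¹ * y) • (s - p) := by
        have := congrArg (x⁻¹ • ·) hxy
        simp only [smul_add, smul_smul, inv_mul_cancel₀ hx, one_smul, smul_zero] at this
        rw [neg_smul]
        exact eq_neg_of_add_eq_zero_left this
      rw [← this, sub_add_cancel]
  have hspan := hli.span_eq_top_of_card_eq_finrank (by simp [hdim])
  have hmem : t - m • p ∈ Submodule.span ℝ (Set.range ![q - p, s - p]) := hspan ▸ Submodule.mem_top
  rw [Matrix.range_cons_cons_empty, Submodule.mem_span_pair] at hmem
  obtain ⟨b, c, hbc⟩ := hmem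
  refine ⟨m - b - c, b, c, by ring, ?_⟩
  linear_combination (norm := module) hbc

/-- Rigidity of homothetic triangles inscribed in the unit circle, when two of the weights
expressing the translation vector are nonnegative. -/
theorem homothety_eq_id_of_two_nonneg [StrictConvexSpace ℝ E] {u₁ u₂ u₃ v₁ v₂ v₃ t : E}
    {l a₁ a₂ a₃ : ℝ} (hl : 0 < l) (hu₁ : ‖u₁‖ = 1) (hu₂ : ‖u₂‖ = 1)
    (hv₁ : ‖v₁‖ = 1) (hv₂ : ‖v₂‖ = 1) (hv₃ : ‖v₃‖ = 1)
    (h₁ : v₁ = l • u₁ + t) (h₂ : v₂ = l • u₂ + t) (h₃ : v₃ = l • u₃ + t)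
    (h₁₂ : u₁ ≠ u₂) (h₁₃ : u₁ ≠ u₃) (hsum : a₁ + a₂ + a₃ = 1 - l)
    (ht : a₁ • u₁ + a₂ • u₂ + a₃ • u₃ = t) (ha₂ : 0 ≤ a₂) (ha₃ : 0 ≤ a₃) :
    l = 1 ∧ t = 0 := by
  have hinj : ∀ {x y : E}, l • x + t = l • y + t → x = y := fun h =>
    smul_right_injective E hl.ne' (add_right_cancel h)
  have hv₁₂ : v₂ ≠ v₁ := fun h => h₁₂ (hinj (h₁ ▸ h₂ ▸ h.symm))
  have hv₁₃ : v₃ ≠ v₁ := fun h => h₁₃ (hinj (h₁ ▸ h₃ ▸ h.symm))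
  have ha₁ : a₁ = 1 - l - a₂ - a₃ := by linarith
  have htv : a₁ • v₁ + a₂ • v₂ + a₃ • v₃ = t := by
    rw [h₁, h₂, h₃, ha₁]
    rw [ha₁] at ht
    linear_combination (norm := module) l • ht
  have hcomb : (l + a₂ + a₃) • v₁ = l • u₁ + a₂ • v₂ + a₃ • v₃ := by
    rw [ha₁] at htv
    linear_combination (norm := module) h₁ - htv
  have hbound : ∀ {x : E} {a : ℝ}, ‖x‖ = 1 → 0 ≤ a → ‖l • u₁ + a • x‖ ≤ l + a := by
    intro x a hx ha
    refine (norm_add_le _ _).trans_eq ?_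
    rw [norm_smul, norm_smul, hu₁, hx, Real.norm_of_nonneg hl.le, Real.norm_of_nonneg ha,
      mul_one, mul_one]
  have ha₂' : a₂ = 0 := by
    by_contra hne
    refine hv₁₂ (eq_of_add_smul_eq_smul_add (ha₂.lt_of_ne' hne) hv₂ hv₁ (hbound hv₃ ha₃) ?_)
    linear_combination (norm := module) hcomb
  have ha₃' : a₃ = 0 := by
    by_contra hne
    refine hv₁₃ (eq_of_add_smul_eq_smul_add (ha₃.lt_of_ne' hne) hv₃ hv₁ (hbound hv₂ ha₂) ?_)
    linear_combination (norm := module) hcomb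
  subst ha₂' ha₃'
  have hvu : v₁ = u₁ := smul_right_injective E hl.ne' (by simpa using hcomb)
  have ht' : t = (1 - l) • u₁ := by
    rw [← ht, ha₁]
    simp
  have hl1 : l = 1 := by
    rcases lt_trichotomy l 1 with hlt | heq | hgt
    · refine absurd (eq_of_add_smul_eq_smul_add (μ := 1 - l) (ν := l) (y := l • u₂)
        (by linarith) hv₁ hv₂ ?_ ?_).symm hv₁₂
      · rw [norm_smul, hu₂, Real.norm_of_nonneg hl.le, mul_one]
      · rw [h₂, ht', hvu]
        module
    · exact heq
    · refine absurd (eq_of_add_smul_eq_smul_add (μ := l - 1) (ν := 1) (y := v₂)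
        (by linarith) hu₁ hu₂ hv₂.le ?_) h₁₂
      rw [h₂, ht']
      module
  exact ⟨hl1, by simp [ht', hl1]⟩

/-- Two positively homothetic triangles inscribed in the unit circle of a strictly convex plane
coincide. -/
theorem homothety_eq_id_of_inscribed [StrictConvexSpace ℝ E] (hdim : Module.finrank ℝ E = 2)
    {u₁ u₂ u₃ v₁ v₂ v₃ t : E} {l : ℝ} (hl : 0 < l)
    (hu₁ : ‖u₁‖ = 1) (hu₂ : ‖u₂‖ = 1) (hu₃ : ‖u₃‖ = 1)
    (hv₁ : ‖v₁‖ = 1) (hv₂ : ‖v₂‖ = 1) (hv₃ : ‖v₃‖ = 1)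
    (h₁ : v₁ = l • u₁ + t) (h₂ : v₂ = l • u₂ + t) (h₃ : v₃ = l • u₃ + t)
    (h₁₂ : u₁ ≠ u₂) (h₁₃ : u₁ ≠ u₃) (h₂₃ : u₂ ≠ u₃) : l = 1 ∧ t = 0 := by
  obtain ⟨a₁, a₂, a₃, hsum, ht⟩ := exists_smul_add_eq_of_not_collinear hdim
    (not_collinear_of_norm_sub_eq (c := 0) (r := 1) (by simpa) (by simpa) (by simpa) h₁₂ h₁₃ h₂₃)
    t (1 - l)
  wlog hpos : (0 ≤ a₂ ∧ 0 ≤ a₃) ∨ (0 ≤ a₁ ∧ 0 ≤ a₃) ∨ (0 ≤ a₁ ∧ 0 ≤ a₂)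
    generalizing u₁ u₂ u₃ v₁ v₂ v₃ t l a₁ a₂ a₃
  · have hinv : ∀ {u v : E}, v = l • u + t → u = l⁻¹ • v + -(l⁻¹ • t) := by
      rintro u v rfl
      rw [smul_add, inv_smul_smul₀ hl.ne', add_neg_cancel_right]
    have hne : ∀ {u u' v v' : E}, v = l • u + t → v' = l • u' + t → u ≠ u' → v ≠ v' := by
      intro u u' v v' h h' huu' hvv'
      exact huu' ((hinv h).trans (hvv' ▸ (hinv h').symm))
    have hil : 0 < l⁻¹ := inv_pos.2 hl
    have ha₁ : a₁ = 1 - l - a₂ - a₃ := by linarith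
    obtain ⟨h, h'⟩ := this hil hv₁ hv₂ hv₃ hu₁ hu₂ hu₃ (hinv h₁) (hinv h₂) (hinv h₃)
      (hne h₁ h₂ h₁₂) (hne h₁ h₃ h₁₃) (hne h₂ h₃ h₂₃) (-(l⁻¹ * a₁)) (-(l⁻¹ * a₂)) (-(l⁻¹ * a₃))
      (by
        rw [ha₁]
        field_simp
        ring)
      (by
        have htv : a₁ • v₁ + a₂ • v₂ + a₃ • v₃ = t := by
          rw [h₁, h₂, h₃, ha₁]
          rw [ha₁] at ht
          linear_combination (norm := module) l • ht
        linear_combination (norm := module) (-l⁻¹) • htv)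
      (by
        have hneg : ∀ {a : ℝ}, a ≤ 0 → 0 ≤ -(l⁻¹ * a) := fun ha =>
          neg_nonneg.2 (mul_nonpos_of_nonneg_of_nonpos hil.le ha)
        rcases le_total 0 a₁ with k₁ | k₁ <;> rcases le_total 0 a₂ with k₂ | k₂ <;>
          rcases le_total 0 a₃ with k₃ | k₃ <;>
          have n₁ := @hneg a₁ <;> have n₂ := @hneg a₂ <;> have n₃ := @hneg a₃ <;>
          clear * - hpos k₁ k₂ k₃ n₁ n₂ n₃ <;> tauto)
    exact ⟨inv_eq_one.1 h, by simpa [hl.ne'] using h'⟩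
  rcases hpos with ⟨k, k'⟩ | ⟨k, k'⟩ | ⟨k, k'⟩
  · exact homothety_eq_id_of_two_nonneg hl hu₁ hu₂ hv₁ hv₂ hv₃ h₁ h₂ h₃ h₁₂ h₁₃ hsum ht k k'
  · exact homothety_eq_id_of_two_nonneg hl hu₂ hu₁ hv₂ hv₁ hv₃ h₂ h₁ h₃ h₁₂.symm h₂₃
      (a₁ := a₂) (a₂ := a₁) (a₃ := a₃) (by rw [← hsum]; ring) (by rw [← ht]; module) k k'
  · exact homothety_eq_id_of_two_nonneg hl hu₃ hu₁ hv₃ hv₁ hv₂ h₃ h₁ h₂ h₁₃.symm h₂₃.symm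
      (a₁ := a₃) (a₂ := a₁) (a₃ := a₂) (by rw [← hsum]; ring) (by rw [← ht]; module) k k'

/-- Two circles of a strictly convex plane that share three distinct points coincide. -/
theorem circle_eq_of_three_common_points [StrictConvexSpace ℝ E] (hdim : Module.finrank ℝ E = 2)
    {c₁ c₂ p q s : E} {r₁ r₂ : ℝ} (hr₁ : 0 < r₁) (hr₂ : 0 < r₂)
    (hp₁ : ‖p - c₁‖ = r₁) (hp₂ : ‖p - c₂‖ = r₂) (hq₁ : ‖q - c₁‖ = r₁) (hq₂ : ‖q - c₂‖ = r₂)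
    (hs₁ : ‖s - c₁‖ = r₁) (hs₂ : ‖s - c₂‖ = r₂) (hpq : p ≠ q) (hps : p ≠ s) (hqs : q ≠ s) :
    c₁ = c₂ ∧ r₁ = r₂ := by
  have hnorm : ∀ {x c : E} {r : ℝ}, 0 < r → ‖x - c‖ = r → ‖r⁻¹ • (x - c)‖ = 1 := by
    intro x c r hr h
    rw [norm_smul, h, norm_inv, Real.norm_of_nonneg hr.le, inv_mul_cancel₀ hr.ne']
  have heq : ∀ x : E, r₂⁻¹ • (x - c₂) = (r₁ / r₂) • r₁⁻¹ • (x - c₁) + r₂⁻¹ • (c₁ - c₂) := by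
    intro x
    rw [smul_smul, show r₁ / r₂ * r₁⁻¹ = r₂⁻¹ by field_simp]
    module
  have hne : ∀ {x y : E}, x ≠ y → r₁⁻¹ • (x - c₁) ≠ r₁⁻¹ • (y - c₁) := fun hxy h =>
    hxy (sub_left_injective (smul_right_injective E (inv_ne_zero hr₁.ne') h))
  obtain ⟨hl, ht⟩ := homothety_eq_id_of_inscribed hdim (div_pos hr₁ hr₂)
    (hnorm hr₁ hp₁) (hnorm hr₁ hq₁) (hnorm hr₁ hs₁) (hnorm hr₂ hp₂) (hnorm hr₂ hq₂)
    (hnorm hr₂ hs₂) (heq p) (heq q) (heq s) (hne hpq) (hne hps) (hne hqs)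
  exact ⟨by simpa [hr₂.ne', sub_eq_zero] using ht, (div_eq_one_iff_eq hr₂.ne').1 hl⟩

/-- If the midpoint of two unit vectors is a unit vector, so is every convex combination. -/
theorem norm_combo_eq_one_of_norm_add_eq_two {x y : E} (hx : ‖x‖ = 1) (hy : ‖y‖ = 1)
    (hxy : ‖x + y‖ = 2) {k : ℝ} (hk₀ : 0 ≤ k) (hk₁ : k ≤ 1) : ‖(1 - k) • x + k • y‖ = 1 := by
  have hle : ∀ {b : ℝ}, 0 ≤ b → b ≤ 1 → ‖(1 - b) • x + b • y‖ ≤ 1 := by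
    intro b hb₀ hb₁
    refine (norm_add_le _ _).trans_eq ?_
    rw [norm_smul, norm_smul, hx, hy, Real.norm_of_nonneg hb₀,
      Real.norm_of_nonneg (sub_nonneg.2 hb₁)]
    ring
  refine le_antisymm (hle hk₀ hk₁) ?_
  have hsplit : x + y = ((1 - k) • x + k • y) + ((1 - (1 - k)) • x + (1 - k) • y) := by module
  have := norm_add_le ((1 - k) • x + k • y) ((1 - (1 - k)) • x + (1 - k) • y)
  rw [← hsplit, hxy] at this
  linarith [hle (b := 1 - k) (by linarith) (by linarith)]

end StrictConvexPlane

theorem strictConvex_iff_circles_intersect_in_at_most_two_points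
    {E : Type*} [NormedAddCommGroup E] [NormedSpace ℝ E]
    (hdim : Module.finrank ℝ E = 2) :
    StrictConvexSpace ℝ E ↔
      ∀ (c₁ c₂ : E) (r₁ r₂ : ℝ), 0 < r₁ → 0 < r₂ → (c₁, r₁) ≠ (c₂, r₂) →
        ∀ p q s : E,
          ‖p - c₁‖ = r₁ → ‖p - c₂‖ = r₂ →
          ‖q - c₁‖ = r₁ → ‖q - c₂‖ = r₂ →
          ‖s - c₁‖ = r₁ → ‖s - c₂‖ = r₂ →
          p = q ∨ p = s ∨ q = s := by
  constructor
  · intro _ c₁ c₂ r₁ r₂ hr₁ hr₂ hne p q s hp₁ hp₂ hq₁ hq₂ hs₁ hs₂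
    by_contra! ⟨hpq, hps, hqs⟩
    obtain ⟨hc, hr⟩ := circle_eq_of_three_common_points hdim hr₁ hr₂ hp₁ hp₂ hq₁ hq₂ hs₁ hs₂
      hpq hps hqs
    exact hne (by rw [hc, hr])
  · intro h
    refine StrictConvexSpace.of_norm_add_ne_two fun x y hx hy hne hxy => ?_
    have hsub : y - x ≠ 0 := sub_ne_zero.2 hne.symm
    have hpt : ∀ {k : ℝ}, 0 ≤ k → k ≤ 1 → ‖x + k • (y - x)‖ = 1 := by
      intro k hk₀ hk₁
      rw [← norm_combo_eq_one_of_norm_add_eq_two hx hy hxy hk₀ hk₁]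
      congr 1
      module
    have hpt₁ : ∀ {k : ℝ}, 1 / 2 ≤ k → k ≤ 1 → ‖x + k • (y - x) - 0‖ = 1 := by
      intro k hk₀ hk₁
      rw [sub_zero]
      exact hpt (by linarith) hk₁
    have hpt₂ : ∀ {k : ℝ}, 1 / 2 ≤ k → k ≤ 1 → ‖x + k • (y - x) - (1 / 2 : ℝ) • (y - x)‖ = 1 := by
      intro k hk₀ hk₁
      rw [add_sub_assoc, ← sub_smul]
      exact hpt (by linarith) (by linarith)
    have hinj : ∀ {k m : ℝ}, x + k • (y - x) = x + m • (y - x) → k = m := fun hkm =>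
      smul_left_injective ℝ hsub (add_left_cancel hkm)
    have hcenters : ((0 : E), (1 : ℝ)) ≠ ((1 / 2 : ℝ) • (y - x), 1) := by
      intro heq
      exact smul_ne_zero one_half_pos.ne' hsub (congrArg Prod.fst heq).symm
    rcases h 0 ((1 / 2 : ℝ) • (y - x)) 1 1 one_pos one_pos hcenters
      (x + (1 / 2 : ℝ) • (y - x)) (x + (3 / 4 : ℝ) • (y - x)) (x + (1 : ℝ) • (y - x))
      (hpt₁ (by norm_num) (by norm_num)) (hpt₂ (by norm_num) (by norm_num))
      (hpt₁ (by norm_num) (by norm_num)) (hpt₂ (by norm_num) (by norm_num))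
      (hpt₁ (by norm_num) (by norm_num)) (hpt₂ (by norm_num) (by norm_num)) with hk | hk | hk <;>
    · have := hinj hk
      norm_num at this
end

section
/- Let E be a finite-dimensional real normed vector space. Then E is strictly convex if and only if for all distinct points x, y ∈ E, every affine line parallel to y − x meets the bisector B(x, y) = {z ∈ E : ‖z − x‖ = ‖z − y‖} in at most one point; equivalently, for every p ∈ E and all reals s, t, if both p + s•(y − x) and p + t•(y − x) belong to B(x, y), then s = t. -/
/-- In a strictly convex space, a nonzero step `d` along the line through `q` preserves the norm
from at most one starting parameter. -/
theorem not_lt_of_norm_add_smul_eq_norm_add_sub_one_smul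
    {E : Type*} [NormedAddCommGroup E] [NormedSpace ℝ E] [StrictConvexSpace ℝ E]
    {q d : E} (hd : d ≠ 0) {s t : ℝ}
    (hs : ‖q + s • d‖ = ‖q + (s - 1) • d‖) (ht : ‖q + t • d‖ = ‖q + (t - 1) • d‖) :
    ¬ s < t := by
  intro hst
  have hpos : 0 < t - s := sub_pos.2 hst
  have hlen : 0 < t - s + 1 := by linarith
  have hne : q + (s - 1) • d ≠ q + t • d := fun h => by
    have := smul_left_injective ℝ hd (add_left_cancel h)
    linarith
  have ha : 0 < (t - s) / (t - s + 1) := by positivity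
  have hb : 0 < 1 / (t - s + 1) := by positivity
  rcases le_total ‖q + t • d‖ ‖q + s • d‖ with h | h
  · have hlt := norm_combo_lt_of_ne hs.ge h hne ha hb (by field_simp)
    have heq : ((t - s) / (t - s + 1)) • (q + (s - 1) • d) + (1 / (t - s + 1)) • (q + t • d)
        = q + s • d := by
      match_scalars <;> field_simp
      ring
    rw [heq] at hlt
    exact lt_irrefl _ hlt
  · have hlt := norm_combo_lt_of_ne (hs ▸ h) le_rfl hne hb ha (by field_simp; ring)
    have heq : (1 / (t - s + 1)) • (q + (s - 1) • d) + ((t - s) / (t - s + 1)) • (q + t • d)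
        = q + (t - 1) • d := by
      match_scalars <;> field_simp <;> ring
    rw [heq, ht] at hlt
    exact lt_irrefl _ hlt

theorem strictConvex_iff_bisector_meets_parallel_lines_once
    {E : Type*} [NormedAddCommGroup E] [NormedSpace ℝ E] [FiniteDimensional ℝ E] :
    StrictConvexSpace ℝ E ↔
      ∀ x y : E, x ≠ y → ∀ p : E, ∀ s t : ℝ,
        ‖(p + s • (y - x)) - x‖ = ‖(p + s • (y - x)) - y‖ →
        ‖(p + t • (y - x)) - x‖ = ‖(p + t • (y - x)) - y‖ →
        s = t := by
  constructor
  · intro _ x y hxy p s t hs ht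
    have hd : y - x ≠ 0 := sub_ne_zero.2 hxy.symm
    have hx (r : ℝ) : (p + r • (y - x)) - x = (p - x) + r • (y - x) := by module
    have hy (r : ℝ) : (p + r • (y - x)) - y = (p - x) + (r - 1) • (y - x) := by module
    rw [hx, hy] at hs ht
    exact le_antisymm
      (not_lt.1 (not_lt_of_norm_add_smul_eq_norm_add_sub_one_smul hd ht hs))
      (not_lt.1 (not_lt_of_norm_add_smul_eq_norm_add_sub_one_smul hd hs ht))
  · refine fun h => StrictConvexSpace.of_norm_add_ne_two fun u v hu hv huv huv2 => ?_
    have hmid : ‖(1 / 2 : ℝ) • (u + v)‖ = 1 := by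
      rw [norm_smul, huv2]
      norm_num
    have hd : (0 : E) ≠ (1 / 2 : ℝ) • (v - u) :=
      (smul_ne_zero (by norm_num) (sub_ne_zero.2 huv.symm)).symm
    have h₁ : u + (1 : ℝ) • ((1 / 2 : ℝ) • (v - u) - 0) = (1 / 2 : ℝ) • (u + v) := by module
    have h₂ : u + (2 : ℝ) • ((1 / 2 : ℝ) • (v - u) - 0) = v := by module
    have h₃ : (1 / 2 : ℝ) • (u + v) - (1 / 2 : ℝ) • (v - u) = u := by module
    have h₄ : v - (1 / 2 : ℝ) • (v - u) = (1 / 2 : ℝ) • (u + v) := by module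
    have := h 0 ((1 / 2 : ℝ) • (v - u)) hd u 1 2
      (by rw [h₁, h₃, sub_zero, hmid, hu]) (by rw [h₂, h₄, sub_zero, hmid, hv])
    norm_num at this
end

section
/- Let E be a two-dimensional real normed vector space, and let a, b, c ∈ E be nonzero vectors with a ≠ c and ‖b‖ = ‖c‖, such that the ray from the origin through b lies between the rays through a and through c, in the sense that b = s•a + t•c for some reals s, t ≥ 0. Then ‖a − b‖ ≤ ‖a − c‖. Moreover, if E is strictly convex and b ≠ c, then ‖a − b‖ < ‖a − c‖. -/
theorem monotonicity_lemma
    {E : Type*} [NormedAddCommGroup E] [NormedSpace ℝ E]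
    (hdim : Module.finrank ℝ E = 2)
    (a b c : E) (ha : a ≠ 0) (hb : b ≠ 0) (hc : c ≠ 0) (hac : a ≠ c)
    (hnorm : ‖b‖ = ‖c‖)
    (hbetween : ∃ s t : ℝ, 0 ≤ s ∧ 0 ≤ t ∧ b = s • a + t • c) :
    ‖a - b‖ ≤ ‖a - c‖ ∧
      (StrictConvexSpace ℝ E → b ≠ c → ‖a - b‖ < ‖a - c‖) := by
  obtain ⟨s, t, hs, ht, hst⟩ := hbetween
  have hpos : 0 < s + t := by
    refine lt_of_le_of_ne (add_nonneg hs ht) fun h => hb ?_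
    have hs0 : s = 0 := by linarith
    have ht0 : t = 0 := by linarith
    simp [hst, hs0, ht0]
  -- `p` is the point where the ray through `b` meets the segment from `a` to `c`.
  set p : E := (s + t)⁻¹ • b with hp
  have hseg : p ∈ segment ℝ a c := by
    refine ⟨(s + t)⁻¹ * s, (s + t)⁻¹ * t, by positivity, by positivity, ?_, ?_⟩
    · rw [← mul_add, inv_mul_cancel₀ hpos.ne']
    · rw [hp, hst, smul_add, smul_smul, smul_smul]
  have hsum : ‖a - p‖ + ‖p - c‖ = ‖a - c‖ := by
    simpa only [dist_eq_norm] using dist_add_dist_of_mem_segment hseg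
  have hray : SameRay ℝ p b := SameRay.sameRay_nonneg_smul_left b (inv_nonneg.2 hpos.le)
  have hpb : ‖p - b‖ = |‖p‖ - ‖c‖| := by rw [hray.norm_sub, hnorm]
  have htri : ‖a - b‖ ≤ ‖a - p‖ + ‖p - b‖ := norm_sub_le_norm_sub_add_norm_sub a p b
  refine ⟨by linarith [abs_norm_sub_norm_le p c], fun _ hbc => ?_⟩
  have hnot : ¬SameRay ℝ p c := fun h => hbc <| by
    have hp0 : p ≠ 0 := smul_ne_zero (inv_ne_zero hpos.ne') hb
    exact (hray.symm.trans h fun h0 => absurd h0 hp0).eq_of_norm_eq hnorm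
  linarith [abs_lt_norm_sub_of_not_sameRay hnot]
end

section
/- Let E be a finite-dimensional real normed vector space. Then E is strictly convex if and only if E has no ramification point; that is, if and only if for all points a, b, c, x ∈ E with x ≠ a, the equalities ‖a − x‖ + ‖x − b‖ = ‖a − b‖ and ‖a − x‖ + ‖x − c‖ = ‖a − c‖ imply that the four points a, x, b, c are collinear. -/
theorem strictConvex_iff_no_ramification_point
    {E : Type*} [NormedAddCommGroup E] [NormedSpace ℝ E] [FiniteDimensional ℝ E] :
    StrictConvexSpace ℝ E ↔
      ∀ a b c x : E, x ≠ a →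
        ‖a - x‖ + ‖x - b‖ = ‖a - b‖ →
        ‖a - x‖ + ‖x - c‖ = ‖a - c‖ →
        Collinear ℝ {a, x, b, c} := by
  constructor
  · intro _ a b c x hxa hb hc
    have key : ∀ p : E, ‖a - x‖ + ‖x - p‖ = ‖a - p‖ → ∃ r : ℝ, p = r • (a - x) + x := by
      intro p hp
      have hray : SameRay ℝ (a - x) (x - p) := by
        rw [sameRay_iff_norm_add, sub_add_sub_cancel, hp]
      obtain ⟨r, -, hr⟩ := hray.exists_nonneg_left (sub_ne_zero.2 hxa.symm)
      exact ⟨-r, by rw [neg_smul, hr]; abel⟩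
    rw [collinear_iff_exists_forall_eq_smul_vadd]
    refine ⟨x, a - x, ?_⟩
    simp only [Set.mem_insert_iff, Set.mem_singleton_iff, forall_eq_or_imp, forall_eq, vadd_eq_add]
    exact ⟨⟨1, by simp⟩, ⟨0, by simp⟩, key b hb, key c hc⟩
  · intro h
    refine StrictConvexSpace.of_norm_add fun x y hx hy hxy => ?_
    have hx0 : x ≠ 0 := norm_ne_zero_iff.1 (by simp [hx])
    have hcol := h 0 (x + x) (x + y) x hx0
      (by rw [zero_sub, zero_sub, sub_add_cancel_left, norm_neg, norm_neg, ← two_smul ℝ x,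
            norm_smul, hx]
          norm_num)
      (by rw [zero_sub, zero_sub, sub_add_cancel_left, norm_neg, norm_neg, norm_neg, hx, hy, hxy]
          norm_num)
    have hline : x + y ∈ line[ℝ, (0 : E), x] :=
      hcol.mem_affineSpan_of_mem_of_ne (by simp) (by simp) (by simp) hx0.symm
    obtain ⟨r, hr⟩ : ∃ r : ℝ, r • x = x + y := by
      simpa using (vadd_left_mem_affineSpan_pair (k := ℝ) (p₁ := (0 : E))
        (p₂ := x) (v := x + y)).1 (by simpa using hline)
    have hnorm : |r| = 2 := by
      simpa [norm_smul, hx, hxy] using congrArg norm hr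
    have hyr : y = (r - 1) • x := by
      rw [sub_smul, one_smul, hr, add_sub_cancel_left]
    have habs : |r - 1| = 1 := by
      simpa [norm_smul, hx, hy] using (congrArg norm hyr).symm
    have hr1 : 0 ≤ r - 1 := by grind
    rw [hyr]
    exact SameRay.sameRay_nonneg_smul_right x hr1
end

section
/- Let E be a two-dimensional real normed vector space, let p, q ∈ E be distinct, and let f : E → ℝ be a nonzero continuous linear functional with f(p) = f(q) (so the level sets of f are the lines parallel to the line through p and q). Then there exists a point r ∈ E with f(r) > f(p) and ‖p − r‖ = ‖q − r‖ = ‖p − q‖ (an equilateral triangle on the segment [p, q] in the chosen half-plane). Moreover, this point r is unique if and only if every closed segment [x, y] contained in the unit sphere of E with y − x a scalar multiple of q − p satisfies ‖y − x‖ ≤ 1. -/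
section EquilateralTriangle

variable {E : Type*} [NormedAddCommGroup E] [NormedSpace ℝ E]

theorem exists_smul_eq_of_map_eq_zero (hdim : Module.finrank ℝ E = 2) {f : E →L[ℝ] ℝ}
    (hf : f ≠ 0) {u : E} (hu : u ≠ 0) (hfu : f u = 0) {z : E} (hz : f z = 0) :
    ∃ t : ℝ, z = t • u := by
  have : FiniteDimensional ℝ E := Module.finite_of_finrank_eq_succ hdim
  have hf' : (f : E →ₗ[ℝ] ℝ) ≠ 0 := fun h => hf (ContinuousLinearMap.coe_injective h)
  have hker := Module.Dual.finrank_ker_add_one_of_ne_zero (f := (f : E →ₗ[ℝ] ℝ)) hf'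
  have hone : Module.finrank ℝ (LinearMap.ker (f : E →ₗ[ℝ] ℝ)) = 1 := by omega
  obtain ⟨t, ht⟩ := (finrank_eq_one_iff_of_nonzero'
    (⟨u, hfu⟩ : LinearMap.ker (f : E →ₗ[ℝ] ℝ)) fun h => hu (congrArg Subtype.val h)).1 hone ⟨z, hz⟩
  exact ⟨t, (congrArg Subtype.val ht).symm⟩

theorem norm_add_smul_convex (c u : E) : ConvexOn ℝ Set.univ fun t : ℝ => ‖c + t • u‖ := by
  refine ⟨convex_univ, fun a _ b _ m n hm hn hmn => ?_⟩
  have h : c + (m • a + n • b) • u = m • (c + a • u) + n • (c + b • u) := by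
    obtain rfl : n = 1 - m := by linarith
    simp only [smul_eq_mul]
    module
  simp only [h]
  refine (norm_add_le _ _).trans_eq ?_
  rw [norm_smul, norm_smul, Real.norm_of_nonneg hm, Real.norm_of_nonneg hn]
  simp

/-- A convex function on the line that is at most `1` at the ends of an interval and equal to `1`
at an interior point is constantly `1` there. -/
theorem ConvexOn.eq_one_of_interior_eq_one {g : ℝ → ℝ} (hg : ConvexOn ℝ Set.univ g)
    {a m b t : ℝ} (ham : a < m) (hmb : m < b) (ha : g a ≤ 1) (hm : g m = 1) (hb : g b ≤ 1)
    (hat : a ≤ t) (htb : t ≤ b) : g t = 1 := by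
  have hle : g t ≤ 1 := by
    have := hg.le_max_of_mem_Icc (Set.mem_univ a) (Set.mem_univ b) ⟨hat, htb⟩
    exact this.trans (max_le ha hb)
  refine le_antisymm hle (not_lt.1 fun hlt => ?_)
  rcases lt_trichotomy t m with h | h | h
  · have := hg.lt_right_of_left_lt (Set.mem_univ t) (Set.mem_univ b) (z := m)
      (by rw [openSegment_eq_Ioo (h.trans hmb)]; exact ⟨h, hmb⟩) (by linarith)
    linarith
  · subst h; linarith
  · have := hg.lt_left_of_right_lt (Set.mem_univ a) (Set.mem_univ t) (z := m)
      (by rw [openSegment_eq_Ioo (ham.trans h)]; exact ⟨ham, h⟩) (by linarith)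
    linarith

theorem exists_apex {f : E →L[ℝ] ℝ} (hf : f ≠ 0) {u : E} (hu : ‖u‖ = 1) (hfu : f u = 0) :
    ∃ s : E, 0 < f s ∧ ‖s‖ = 1 ∧ ‖s - u‖ = 1 := by
  obtain ⟨v, hv⟩ : ∃ v, f v = 1 := by
    obtain ⟨w, hw⟩ := DFunLike.ne_iff.1 hf
    have hw' : f w ≠ 0 := by simpa using hw
    exact ⟨(f w)⁻¹ • w, by simp [hw']⟩
  have hu0 : u ≠ 0 := norm_ne_zero_iff.1 (by rw [hu]; exact one_ne_zero)
  let γ : ℝ → E := fun t => t • u + (1 - |t|) • v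
  have hfγ : ∀ t, f (γ t) = 1 - |t| := fun t => by simp [γ, hfu, hv]
  have hγ : ∀ t, γ t ≠ 0 := by
    intro t ht
    have h1 := hfγ t
    rw [ht, map_zero] at h1
    have h2 : t • u = 0 := by simpa [γ, ← h1] using ht
    obtain rfl : t = 0 := (smul_eq_zero.1 h2).resolve_right hu0
    simp at h1
  have hγc : Continuous γ := by fun_prop
  have hc : Continuous fun t => ‖‖γ t‖⁻¹ • γ t - u‖ :=
    (((hγc.norm.inv₀ fun t => norm_ne_zero_iff.2 (hγ t)).smul hγc).sub continuous_const).norm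
  have hright : ‖‖γ 1‖⁻¹ • γ 1 - u‖ = 0 := by simp [γ, hu]
  have hleft : ‖‖γ (-1)‖⁻¹ • γ (-1) - u‖ = 2 := by
    have : -u - u = (-2 : ℝ) • u := by module
    simp [γ, hu, this, norm_smul]
  obtain ⟨t, ⟨ht1, ht2⟩, ht⟩ := intermediate_value_Icc' (show (-1 : ℝ) ≤ 1 by norm_num)
    hc.continuousOn (show (1 : ℝ) ∈ Set.Icc _ _ by rw [hright, hleft]; norm_num)
  have hta : |t| < 1 := by
    refine abs_lt.2 ⟨lt_of_le_of_ne ht1 ?_, lt_of_le_of_ne ht2 ?_⟩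
    · rintro rfl
      simp only [hleft] at ht
      norm_num at ht
    · rintro rfl
      simp only [hright] at ht
      norm_num at ht
  have hpos : 0 < ‖γ t‖ := norm_pos_iff.2 (hγ t)
  refine ⟨‖γ t‖⁻¹ • γ t, ?_, ?_, ht⟩
  · rw [map_smul, hfγ, smul_eq_mul]
    exact mul_pos (inv_pos.2 hpos) (by linarith)
  · rw [norm_smul, norm_inv, norm_norm, inv_mul_cancel₀ hpos.ne']

theorem sub_le_one_of_interior {u : E}
    (H : ∀ (x : E) (l : ℝ), 0 ≤ l → (∀ t ∈ Set.Icc 0 l, ‖x + t • u‖ = 1) → l ≤ 1)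
    {c : E} {a m b : ℝ} (ham : a < m) (hmb : m < b) (ha : ‖c + a • u‖ ≤ 1)
    (hm : ‖c + m • u‖ = 1) (hb : ‖c + b • u‖ ≤ 1) : b - a ≤ 1 := by
  refine H (c + a • u) (b - a) (by linarith) fun t ht => ?_
  have := (norm_add_smul_convex c u).eq_one_of_interior_eq_one ham hmb ha hm hb
    (t := a + t) (by linarith [ht.1]) (by linarith [ht.2])
  rwa [add_smul, ← add_assoc] at this

theorem apex_unique (hdim : Module.finrank ℝ E = 2) {f : E →L[ℝ] ℝ} (hf : f ≠ 0) {u : E}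
    (hu : ‖u‖ = 1) (hfu : f u = 0)
    (H : ∀ (x : E) (l : ℝ), 0 ≤ l → (∀ t ∈ Set.Icc 0 l, ‖x + t • u‖ = 1) → l ≤ 1)
    {s₁ s₂ : E} (h₁ : 0 < f s₁) (n₁ : ‖s₁‖ = 1) (d₁ : ‖s₁ - u‖ = 1)
    (h₂ : 0 < f s₂) (n₂ : ‖s₂‖ = 1) (d₂ : ‖s₂ - u‖ = 1) : s₁ = s₂ := by
  wlog hle : f s₁ ≤ f s₂ generalizing s₁ s₂
  · exact (this h₂ n₂ d₂ h₁ n₁ d₁ (le_of_not_ge hle)).symm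
  have hu0 : u ≠ 0 := norm_ne_zero_iff.1 (by rw [hu]; exact one_ne_zero)
  set k := f s₁ / f s₂ with hk
  have hk0 : 0 < k := div_pos h₁ h₂
  have hk1 : k ≤ 1 := (div_le_one h₂).2 hle
  obtain ⟨t, ht⟩ := exists_smul_eq_of_map_eq_zero hdim hf hu0 hfu (z := s₁ - k • s₂) (by
    rw [map_sub, map_smul, smul_eq_mul, hk, div_mul_cancel₀ _ h₂.ne', sub_self])
  have hs₁ : k • s₂ + t • u = s₁ := by rw [← ht]; abel
  have hsub : k • s₂ + (t - 1) • u = s₁ - u := by rw [← hs₁]; module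
  have et : ‖k • s₂ + t • u‖ = 1 := by rw [hs₁, n₁]
  have et' : ‖k • s₂ + (t - 1) • u‖ = 1 := by rw [hsub, d₁]
  have eleft : ‖k • s₂ + (-1 : ℝ) • u‖ ≤ 1 := by
    have : k • s₂ + (-1 : ℝ) • u = k • (s₂ - u) + (-(1 - k)) • u := by module
    rw [this]
    refine (norm_add_le _ _).trans ?_
    rw [norm_smul, norm_smul, norm_neg, d₂, hu, Real.norm_of_nonneg hk0.le,
      Real.norm_of_nonneg (sub_nonneg.2 hk1)]
    linarith
  have eright : ‖k • s₂ + (1 - k) • u‖ ≤ 1 := by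
    refine (norm_add_le _ _).trans ?_
    rw [norm_smul, norm_smul, n₂, hu, Real.norm_of_nonneg hk0.le,
      Real.norm_of_nonneg (sub_nonneg.2 hk1)]
    linarith
  have htlow : 1 - k ≤ t := by
    by_contra! hlt
    linarith [sub_le_one_of_interior H (by linarith : t - 1 < t) hlt et'.le et eright]
  have htup : t ≤ 0 := by
    by_contra! hlt
    linarith [sub_le_one_of_interior H (by linarith : -1 < t - 1)
      (by linarith : t - 1 < t) eleft et' et.le]
  have hk_eq : k = 1 := by linarith
  have ht_eq : t = 0 := by linarith
  rw [← hs₁, hk_eq, ht_eq, one_smul, zero_smul, add_zero]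

theorem length_le_one_of_apex_unique (hdim : Module.finrank ℝ E = 2) {f : E →L[ℝ] ℝ}
    (hf : f ≠ 0) {u : E} (hu : ‖u‖ = 1) (hfu : f u = 0)
    (huniq : ∀ s₁ s₂ : E, 0 < f s₁ → ‖s₁‖ = 1 → ‖s₁ - u‖ = 1 →
      0 < f s₂ → ‖s₂‖ = 1 → ‖s₂ - u‖ = 1 → s₁ = s₂)
    (x : E) (l : ℝ) (hx : ∀ t ∈ Set.Icc 0 l, ‖x + t • u‖ = 1) : l ≤ 1 := by
  by_contra! hl
  have hu0 : u ≠ 0 := norm_ne_zero_iff.1 (by rw [hu]; exact one_ne_zero)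
  have key : ∀ z : E, 0 < f z → (∀ t ∈ Set.Icc 0 l, ‖z + t • u‖ = 1) → False := by
    intro z hz hzn
    have heq := huniq (z + (1 : ℝ) • u) (z + l • u) (by simp [hfu, hz])
      (hzn 1 ⟨by linarith, hl.le⟩)
      (by simpa using hzn 0 ⟨le_rfl, by linarith⟩) (by simp [hfu, hz])
      (hzn l ⟨by linarith, le_rfl⟩)
      (by
        have := hzn (l - 1) ⟨by linarith, by linarith⟩
        rwa [sub_smul, one_smul, ← add_sub_assoc] at this)
    exact hl.ne (smul_left_injective ℝ hu0 (add_left_cancel heq))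
  rcases lt_trichotomy (f x) 0 with h | h | h
  · refine key (-(x + l • u)) (by simpa [hfu] using h) fun t ht => ?_
    have := hx (l - t) ⟨by linarith [ht.2], by linarith [ht.1]⟩
    rw [← this, ← norm_neg]
    congr 1
    module
  · obtain ⟨c, rfl⟩ := exists_smul_eq_of_map_eq_zero hdim hf hu0 hfu h
    have hc : ∀ t ∈ Set.Icc 0 l, (c + t) ^ 2 = 1 := by
      intro t ht
      have := hx t ht
      rw [← add_smul, norm_smul, hu, mul_one, Real.norm_eq_abs] at this
      rw [← sq_abs, this, one_pow]
    have c₀ := hc 0 ⟨le_rfl, by linarith⟩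
    have c₁ := hc (1 / 2) ⟨by norm_num, by linarith⟩
    have c₂ := hc 1 ⟨by norm_num, hl.le⟩
    linarith
  · exact key x h hx

theorem apex_unique_iff (hdim : Module.finrank ℝ E = 2) {f : E →L[ℝ] ℝ} (hf : f ≠ 0) {u : E}
    (hu : ‖u‖ = 1) (hfu : f u = 0) :
    (∀ s₁ s₂ : E, 0 < f s₁ → ‖s₁‖ = 1 → ‖s₁ - u‖ = 1 →
      0 < f s₂ → ‖s₂‖ = 1 → ‖s₂ - u‖ = 1 → s₁ = s₂) ↔
    ∀ x y : E, segment ℝ x y ⊆ {v : E | ‖v‖ = 1} → (∃ μ : ℝ, y - x = μ • u) → ‖y - x‖ ≤ 1 := by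
  constructor
  · rintro huniq x y hxy ⟨μ, hμ⟩
    wlog hμ0 : 0 ≤ μ generalizing x y μ
    · rw [norm_sub_rev]
      exact this y x (by rwa [segment_symm]) (-μ) (by rw [neg_smul, ← hμ, neg_sub])
        (by linarith)
    rw [hμ, norm_smul, hu, mul_one, Real.norm_of_nonneg hμ0]
    refine length_le_one_of_apex_unique hdim hf hu hfu huniq x μ fun t ht => hxy ?_
    rw [segment_eq_image']
    rcases hμ0.eq_or_lt with rfl | hpos
    · obtain rfl : t = 0 := le_antisymm ht.2 ht.1
      exact ⟨0, by simp, by simp⟩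
    · refine ⟨t / μ, ⟨div_nonneg ht.1 hμ0, (div_le_one hpos).2 ht.2⟩, ?_⟩
      simp only [hμ, smul_smul, div_mul_cancel₀ _ hpos.ne']
  · intro H s₁ s₂ h₁ n₁ d₁ h₂ n₂ d₂
    refine apex_unique hdim hf hu hfu (fun x l hl hx => ?_) h₁ n₁ d₁ h₂ n₂ d₂
    have := H x (x + l • u) ?_ ⟨l, by simp⟩
    · simpa [norm_smul, hu, abs_of_nonneg hl] using this
    · rw [segment_eq_image']
      rintro _ ⟨θ, hθ, rfl⟩
      have := hx (θ * l) ⟨mul_nonneg hθ.1 hl, mul_le_of_le_one_left hl hθ.2⟩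
      simpa [smul_smul] using this

end EquilateralTriangle

theorem equilateral_triangle_existence_and_uniqueness
    {E : Type*} [NormedAddCommGroup E] [NormedSpace ℝ E]
    (hdim : Module.finrank ℝ E = 2)
    (p q : E) (hpq : p ≠ q) (f : E →L[ℝ] ℝ) (hf : f ≠ 0) (hfpq : f p = f q) :
    (∃ r : E, f p < f r ∧ ‖p - r‖ = ‖q - r‖ ∧ ‖q - r‖ = ‖p - q‖) ∧
      ((∃! r : E, f p < f r ∧ ‖p - r‖ = ‖q - r‖ ∧ ‖q - r‖ = ‖p - q‖) ↔
        ∀ x y : E, segment ℝ x y ⊆ {v : E | ‖v‖ = 1} →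
          (∃ μ : ℝ, y - x = μ • (q - p)) → ‖y - x‖ ≤ 1) := by
  have hd : 0 < ‖p - q‖ := norm_pos_iff.2 (sub_ne_zero.2 hpq)
  set d := ‖p - q‖ with hd_def
  obtain ⟨u, hu_def⟩ : ∃ u : E, u = d⁻¹ • (q - p) := ⟨_, rfl⟩
  have hdu : q - p = d • u := by rw [hu_def, smul_inv_smul₀ hd.ne']
  have hu : ‖u‖ = 1 := by
    rw [hu_def, norm_smul, norm_sub_rev, ← hd_def, norm_inv, Real.norm_of_nonneg hd.le,
      inv_mul_cancel₀ hd.ne']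
  have hfu : f u = 0 := by simp [hu_def, hfpq]
  have hiff : ∀ s : E, (f p < f (p + d • s) ∧ ‖p - (p + d • s)‖ = ‖q - (p + d • s)‖ ∧
      ‖q - (p + d • s)‖ = d) ↔ 0 < f s ∧ ‖s‖ = 1 ∧ ‖s - u‖ = 1 := by
    intro s
    have e₁ : ‖p - (p + d • s)‖ = d * ‖s‖ := by
      rw [sub_add_cancel_left, norm_neg, norm_smul, Real.norm_of_nonneg hd.le]
    have e₂ : ‖q - (p + d • s)‖ = d * ‖s - u‖ := by
      rw [← sub_sub, hdu, ← smul_sub, norm_smul, Real.norm_of_nonneg hd.le, norm_sub_rev]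
    rw [e₁, e₂, map_add, map_smul, smul_eq_mul, lt_add_iff_pos_right, mul_pos_iff_of_pos_left hd,
      mul_right_inj' hd.ne', mul_eq_left₀ hd.ne']
    constructor
    · rintro ⟨h, h', h''⟩
      exact ⟨h, h'.trans h'', h''⟩
    · rintro ⟨h, h', h''⟩
      exact ⟨h, h'.trans h''.symm, h''⟩
  have hsurj : ∀ r : E, ∃ s : E, r = p + d • s := fun r =>
    ⟨d⁻¹ • (r - p), by rw [smul_inv_smul₀ hd.ne', add_sub_cancel]⟩
  have hex : ∃ r : E, f p < f r ∧ ‖p - r‖ = ‖q - r‖ ∧ ‖q - r‖ = d := by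
    obtain ⟨s, hs⟩ := exists_apex hf hu hfu
    exact ⟨p + d • s, (hiff s).2 hs⟩
  refine ⟨hex, ?_⟩
  have hpar : ∀ v : E, (∃ μ : ℝ, v = μ • (q - p)) ↔ ∃ μ : ℝ, v = μ • u := by
    intro v
    constructor
    · rintro ⟨μ, rfl⟩
      exact ⟨μ * d, by rw [hdu, smul_smul]⟩
    · rintro ⟨μ, rfl⟩
      exact ⟨μ * d⁻¹, by rw [hu_def, smul_smul]⟩
  simp only [hpar]
  rw [← apex_unique_iff hdim hf hu hfu]
  constructor
  · intro huniq s₁ s₂ h₁ n₁ d₁ h₂ n₂ d₂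
    have := huniq.unique ((hiff s₁).2 ⟨h₁, n₁, d₁⟩) ((hiff s₂).2 ⟨h₂, n₂, d₂⟩)
    exact smul_right_injective E hd.ne' (add_left_cancel this)
  · intro huniq
    obtain ⟨r, hr⟩ := hex
    refine ⟨r, hr, fun r' hr' => ?_⟩
    obtain ⟨s, rfl⟩ := hsurj r
    obtain ⟨s', rfl⟩ := hsurj r'
    obtain ⟨h₁, n₁, d₁⟩ := (hiff s).1 hr
    obtain ⟨h₂, n₂, d₂⟩ := (hiff s').1 hr'
    rw [huniq s' s h₂ n₂ d₂ h₁ n₁ d₁]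
end

section
/- Let E be a two-dimensional real normed vector space. Then there exist x, y ∈ E with ‖x‖ = ‖y‖ = ‖x − y‖ = 1 and ‖x + y‖ ≤ √3, and there exist x, y ∈ E with ‖x‖ = ‖y‖ = ‖x − y‖ = 1 and ‖x + y‖ ≥ √3. -/
/-- The standard area form on `ℂ`. -/
def cross (u v : ℂ) : ℝ := u.re * v.im - u.im * v.re

/-- A norm on the plane `ℂ`, given as a seminorm, whose unit ball is strictly convex. -/
structure IsStrictNorm (p : Seminorm ℝ ℂ) : Prop where
  continuous : Continuous p
  pos : ∀ v, v ≠ 0 → 0 < p v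
  strict : ∀ u v, p u ≤ 1 → p v ≤ 1 → u ≠ v → ∀ s t : ℝ, 0 < s → 0 < t → s + t = 1 →
    p (s • u + t • v) < 1

theorem seminorm_combination_le (p : Seminorm ℝ ℂ) {s t : ℝ} (hs : 0 ≤ s) (ht : 0 ≤ t) (u v : ℂ) :
    p (s • u + t • v) ≤ s * p u + t * p v := by
  refine (map_add_le_add p _ _).trans ?_
  rw [map_smul_eq_mul, map_smul_eq_mul, Real.norm_of_nonneg hs, Real.norm_of_nonneg ht]

theorem eq_smul_add_smul {x y : ℂ} (h : cross x y ≠ 0) (v : ℂ) :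
    v = (cross v y / cross x y) • x + (cross x v / cross x y) • y := by
  apply Complex.ext <;>
    simp only [Complex.add_re, Complex.smul_re, Complex.add_im,
      Complex.smul_im, smul_eq_mul] <;> field_simp <;> simp only [cross] <;> ring

namespace IsStrictNorm

variable {p : Seminorm ℝ ℂ}

theorem not_smul_add_smul_unit (hp : IsStrictNorm p) {x y : ℂ} {a b : ℝ} (hx : p x = 1)
    (hy : p y = 1) (hyx : p (y - x) = 1) (hv : p (a • x + b • y) = 1) (hb : 1 ≤ b)
    (hab : 0 < a - 1 + b) : False := by
  have hb0 : 0 < b := by linarith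
  set c : ℝ := 1 + (a - 1) / b with hc
  have hc0 : 0 < c := by
    rw [hc]; have : 1 + (a - 1) / b = (a - 1 + b) / b := by field_simp; ring
    rw [this]; positivity
  have h1 : p (c • x + y) ≤ 1 := by
    have e : c • x + y = (1 / b) • (a • x + b • y) + (1 - 1 / b) • x := by
      apply Complex.ext <;>
        simp only [hc, Complex.add_re, Complex.smul_re, Complex.add_im,
          Complex.smul_im, smul_eq_mul] <;> field_simp <;> ring
    have hle : 1 / b ≤ 1 := by rw [div_le_one hb0]; exact hb
    rw [e]
    refine (seminorm_combination_le p (by positivity) (by linarith) _ _).trans ?_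
    rw [hv, hx]; linarith
  have hx0 : x ≠ 0 := by rintro rfl; simp at hx
  have hne : y - x ≠ c • x + y := by
    intro h
    have : (1 + c) • x = 0 := by
      have h' : (1 + c) • x = (c • x + y) - (y - x) := by rw [add_smul, one_smul]; ring
      rw [h', h, sub_self]
    rcases smul_eq_zero.1 this with h | h
    · linarith
    · exact hx0 h
  have := hp.strict _ _ hyx.le h1 hne (c / (1 + c)) (1 / (1 + c)) (by positivity) (by positivity)
    (by field_simp; ring)
  have e : (c / (1 + c)) • (y - x) + (1 / (1 + c)) • (c • x + y) = y := by
    apply Complex.ext <;>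
      simp only [Complex.add_re, Complex.sub_re, Complex.smul_re, Complex.add_im,
        Complex.sub_im, Complex.smul_im, smul_eq_mul] <;> field_simp <;> ring
  rw [e, hy] at this
  exact lt_irrefl _ this

theorem not_smul_add_smul_vertex (hp : IsStrictNorm p) {x y : ℂ} {a b : ℝ} (hx : p x = 1)
    (hy : p y = 1) (hyx : p (y - x) = 1) (hv : p (a • x + b • y) = 1)
    (hvx : p (a • x + b • y - x) = 1) (hb : 1 < b) : False := by
  by_cases hab : 0 < a - 1 + b
  · exact hp.not_smul_add_smul_unit hx hy hyx hv hb.le hab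
  have ha : 0 < 1 - a := by linarith
  have e : y - x = (1 / (1 - a)) • (a • x + b • y - x) + (1 - b / (1 - a)) • y := by
    apply Complex.ext <;>
      simp only [Complex.add_re, Complex.sub_re, Complex.smul_re, Complex.add_im,
        Complex.sub_im, Complex.smul_im, smul_eq_mul] <;> field_simp <;> ring
  have h1 : b / (1 - a) ≤ 1 := by rw [div_le_one ha]; linarith
  have h2 := seminorm_combination_le p (s := 1 / (1 - a)) (t := 1 - b / (1 - a)) (by positivity)
    (by linarith) (a • x + b • y - x) y
  rw [← e, hyx, hvx, hy] at h2
  have h3 : 1 / (1 - a) < b / (1 - a) := by gcongr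
  linarith

/-- On each side of the line through `0` and `x` there is at most one apex of a unit
equilateral triangle with base `0`, `x`. -/
theorem apex_unique (hp : IsStrictNorm p) {x y z : ℂ} (hx : p x = 1)
    (hy : p y = 1) (hyx : p (y - x) = 1) (hxy : 0 < cross x y)
    (hz : p z = 1) (hzx : p (z - x) = 1) (hxz : 0 < cross x z) : y = z := by
  have ez := eq_smul_add_smul hxy.ne' z
  have ey := eq_smul_add_smul hxz.ne' y
  have hzy : cross z y = - cross y z := by simp only [cross]; ring
  rcases lt_trichotomy (cross x y) (cross x z) with h | h | h
  · rw [ez] at hz hzx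
    exact (hp.not_smul_add_smul_vertex hx hy hyx hz hzx (by rwa [one_lt_div hxy])).elim
  · have h1 : cross x z / cross x y = 1 := by rw [h, div_self hxz.ne']
    have h2 : cross x y / cross x z = 1 := by rw [h, div_self hxz.ne']
    rcases lt_trichotomy (cross z y) 0 with h0 | h0 | h0
    · rw [ey] at hy
      refine (hp.not_smul_add_smul_unit hx hz hzx hy h2.ge ?_).elim
      rw [h2]
      have : 0 < cross y z / cross x z := div_pos (by linarith) hxz
      linarith
    · rw [ez, h1, h0]; simp
    · rw [ez] at hz
      refine (hp.not_smul_add_smul_unit hx hy hyx hz h1.ge ?_).elim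
      rw [h1]
      have : 0 < cross z y / cross x y := div_pos h0 hxy
      linarith
  · rw [ey] at hy hyx
    exact (hp.not_smul_add_smul_vertex hx hz hzx hy hyx (by rwa [one_lt_div hxz])).elim

end IsStrictNorm

theorem cross_median_nonneg (p : Seminorm ℝ ℂ) {x y x' y' : ℂ} (hx : p x = 1) (hy : p y = 1)
    (hyx : p (y - x) = 1) (hxy : 0 < cross x y) (hx' : p x' = 1) (hy' : p y' = 1)
    (h₁ : 0 ≤ cross x x') (h₂ : 0 ≤ cross x' y) (h₃ : 0 ≤ cross y y')
    (h₄ : 0 ≤ cross y' (y - x)) : 0 ≤ cross (x + y) (x' + y') := by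
  have ex := eq_smul_add_smul hxy.ne' x'
  have ey := eq_smul_add_smul hxy.ne' y'
  set A := cross x' y / cross x y with hA
  set B := cross x x' / cross x y with hB
  set s := cross y' y / cross x y with hs
  set u := cross x y' / cross x y with hu
  have hA0 : 0 ≤ A := by positivity
  have hB0 : 0 ≤ B := by positivity
  have hs0 : 0 ≤ -s := by
    have : -s = cross y y' / cross x y := by
      rw [hs, ← neg_div]; congr 1; simp only [cross]; ring
    rw [this]; positivity
  have hsu : 0 ≤ s + u := by
    have : s + u = cross y' (y - x) / cross x y := by
      rw [hs, hu, ← add_div]; congr 1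
      simp only [cross, Complex.sub_re, Complex.sub_im]; ring
    rw [this]; positivity
  have hu1 : 1 ≤ u := by
    have e : y' = (-s) • (y - x) + (s + u) • y := by
      rw [ey]; module
    have := seminorm_combination_le p hs0 hsu (y - x) y
    rw [← e, hy', hyx, hy] at this
    linarith
  have hA1 : A ≤ 1 := by
    have e : (A + B) • x = (1 : ℝ) • x' + B • (x - y) := by
      rw [ex]; module
    have := seminorm_combination_le p zero_le_one hB0 x' (x - y)
    rw [← e, hx', map_sub_rev, hyx, map_smul_eq_mul, hx,
      Real.norm_of_nonneg (by positivity)] at this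
    linarith
  have : cross (x + y) (x' + y') = (B + u - A - s) * cross x y := by
    rw [ex, ey]
    simp only [cross, Complex.add_re, Complex.add_im, Complex.smul_re, Complex.smul_im, smul_eq_mul]
    ring
  rw [this]
  exact mul_nonneg (by linarith) hxy.le

theorem continuous_of_unique_root {f : ℝ → ℝ} {h : ℝ × ℝ → ℝ} {a b c : ℝ} (hh : Continuous h)
    (hf : ∀ t, f t ∈ Set.Icc a b ∧ h (t, f t) = c)
    (huniq : ∀ t s, s ∈ Set.Icc a b → h (t, s) = c → s = f t) : Continuous f := by
  refine continuous_iff_isClosed.2 fun C hC => ?_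
  have : Set.preimage f C =
      Set.image Prod.fst {q : ℝ × Set.Icc a b | (q.2 : ℝ) ∈ C ∧ h (q.1, q.2) = c} := by
    ext t
    constructor
    · exact fun ht => ⟨(t, ⟨f t, (hf t).1⟩), ⟨ht, (hf t).2⟩, rfl⟩
    · rintro ⟨⟨t', s⟩, ⟨hs, hts⟩, rfl⟩
      have hst : (s : ℝ) = f t' := huniq _ _ s.2 hts
      rwa [Set.mem_preimage, ← hst]
  rw [this]
  refine isClosedMap_fst_of_compactSpace _ ?_
  exact (hC.preimage (by fun_prop)).inter (isClosed_eq (by fun_prop) continuous_const)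

theorem le_of_eventually_le_right {f : ℝ → ℝ} {a b : ℝ} (hab : a ≤ b)
    (hf : ContinuousOn f (Set.Icc a b))
    (h : ∀ x ∈ Set.Ico a b, ∀ᶠ z in nhdsWithin x (Set.Ioi x), f x ≤ f z) : f a ≤ f b := by
  have := image_le_of_liminf_slope_right_le_deriv_boundary (f := fun x => -f x) (a := a) (b := b)
    (B := fun _ => -f a) (B' := fun _ => 0) hf.neg le_rfl continuousOn_const
    (fun x _ => hasDerivWithinAt_const _ _ _) (fun x hx r hr => ?_) (Set.right_mem_Icc.2 hab)
  · simpa using this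
  · refine Filter.Eventually.frequently ?_
    filter_upwards [h x hx, self_mem_nhdsWithin] with z hz hxz
    refine lt_of_le_of_lt ?_ hr
    rw [slope_def_field]
    exact div_nonpos_of_nonpos_of_nonneg (by linarith) (sub_nonneg.2 (le_of_lt hxz))

/-- The point of the unit circle of `p` in the direction of angle `θ`. -/
noncomputable def unitPoint (p : Seminorm ℝ ℂ) (θ : ℝ) : ℂ :=
  (p (Complex.exp (θ * Complex.I)))⁻¹ • Complex.exp (θ * Complex.I)

/-- The Euclidean distance from the origin to the unit circle of `p` at angle `θ`. -/
noncomputable def unitRadius (p : Seminorm ℝ ℂ) (θ : ℝ) : ℝ :=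
  (p (Complex.exp (θ * Complex.I)))⁻¹

theorem cross_unitPoint (p : Seminorm ℝ ℂ) (a b : ℝ) :
    cross (unitPoint p a) (unitPoint p b) =
      unitRadius p a * unitRadius p b * Real.sin (b - a) := by
  simp only [cross, unitPoint, unitRadius, Complex.smul_re, Complex.smul_im,
    Complex.exp_ofReal_mul_I_re, Complex.exp_ofReal_mul_I_im, smul_eq_mul, Real.sin_sub]
  ring

theorem exp_add_pi_mul_I (θ : ℝ) :
    Complex.exp (((θ + Real.pi : ℝ) : ℂ) * Complex.I) = -Complex.exp (θ * Complex.I) := by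
  rw [Complex.ofReal_add, add_mul, Complex.exp_add, Complex.exp_pi_mul_I]; ring

theorem unitPoint_add_pi (p : Seminorm ℝ ℂ) (θ : ℝ) :
    unitPoint p (θ + Real.pi) = -unitPoint p θ := by
  simp only [unitPoint, exp_add_pi_mul_I, map_neg_eq_map, smul_neg]

theorem unitRadius_add_pi (p : Seminorm ℝ ℂ) (θ : ℝ) :
    unitRadius p (θ + Real.pi) = unitRadius p θ := by
  simp only [unitRadius, exp_add_pi_mul_I, map_neg_eq_map]

namespace IsStrictNorm

variable {p : Seminorm ℝ ℂ}

theorem unitRadius_pos (hp : IsStrictNorm p) (θ : ℝ) : 0 < unitRadius p θ :=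
  inv_pos.2 (hp.pos _ (Complex.exp_ne_zero _))

theorem map_unitPoint (hp : IsStrictNorm p) (θ : ℝ) : p (unitPoint p θ) = 1 := by
  have h := hp.pos _ (Complex.exp_ne_zero (θ * Complex.I))
  rw [unitPoint, map_smul_eq_mul, norm_inv, Real.norm_of_nonneg h.le, inv_mul_cancel₀ h.ne']

theorem continuous_unitRadius (hp : IsStrictNorm p) : Continuous (unitRadius p) :=
  (hp.continuous.comp (by fun_prop)).inv₀ fun θ => (hp.pos _ (Complex.exp_ne_zero _)).ne'

theorem continuous_unitPoint (hp : IsStrictNorm p) : Continuous (unitPoint p) :=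
  hp.continuous_unitRadius.smul (f := unitRadius p)
    (g := fun θ : ℝ => Complex.exp (θ * Complex.I)) (by fun_prop)

theorem smul_exp_eq (hp : IsStrictNorm p) {r : ℝ} (hr : 0 < r) (θ : ℝ) :
    r • Complex.exp (θ * Complex.I) =
      p (r • Complex.exp (θ * Complex.I)) • unitPoint p θ := by
  have h := hp.pos _ (Complex.exp_ne_zero (θ * Complex.I))
  rw [unitPoint, map_smul_eq_mul, Real.norm_of_nonneg hr.le, smul_smul, mul_assoc,
    mul_inv_cancel₀ h.ne', mul_one]

theorem cross_unitPoint_pos (hp : IsStrictNorm p) {a b : ℝ} (h₁ : a < b)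
    (h₂ : b < a + Real.pi) : 0 < cross (unitPoint p a) (unitPoint p b) := by
  rw [cross_unitPoint]
  exact mul_pos (mul_pos (hp.unitRadius_pos a) (hp.unitRadius_pos b))
    (Real.sin_pos_of_pos_of_lt_pi (by linarith) (by linarith))

theorem le_of_cross_unitPoint_nonneg (hp : IsStrictNorm p) {a b : ℝ} (h : a < b + Real.pi)
    (hc : 0 ≤ cross (unitPoint p a) (unitPoint p b)) : a ≤ b := by
  by_contra! hba
  have := hp.cross_unitPoint_pos hba h
  simp only [cross] at this hc
  linarith

theorem exists_apex_angle (hp : IsStrictNorm p) (θ : ℝ) :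
    ∃ φ ∈ Set.Icc 0 Real.pi, p (unitPoint p (θ + φ) - unitPoint p θ) = 1 := by
  have hc : Continuous fun φ => p (unitPoint p (θ + φ) - unitPoint p θ) :=
    hp.continuous.comp ((hp.continuous_unitPoint.comp (by fun_prop)).sub continuous_const)
  have := intermediate_value_Icc Real.pi_pos.le hc.continuousOn
  refine this ⟨?_, ?_⟩
  · simp
  · have e : -unitPoint p θ - unitPoint p θ = (-2 : ℝ) • unitPoint p θ := by module
    simp only [unitPoint_add_pi, e, map_smul_eq_mul, hp.map_unitPoint]
    norm_num

theorem mem_Ioo_of_apex_angle (hp : IsStrictNorm p) {θ φ : ℝ} (hφ : φ ∈ Set.Icc 0 Real.pi)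
    (h : p (unitPoint p (θ + φ) - unitPoint p θ) = 1) : φ ∈ Set.Ioo 0 Real.pi := by
  refine ⟨hφ.1.lt_of_ne ?_, hφ.2.lt_of_ne ?_⟩
  · rintro rfl
    simp at h
  · rintro rfl
    have e : -unitPoint p θ - unitPoint p θ = (-2 : ℝ) • unitPoint p θ := by module
    rw [unitPoint_add_pi, e, map_smul_eq_mul, hp.map_unitPoint] at h
    norm_num at h

theorem eq_of_unitPoint_eq (hp : IsStrictNorm p) {a b : ℝ} (h₁ : a < b + Real.pi)
    (h₂ : b < a + Real.pi) (h : unitPoint p a = unitPoint p b) : a = b := by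
  have hc : cross (unitPoint p a) (unitPoint p b) = 0 := by rw [h]; simp only [cross]; ring
  have hc' : cross (unitPoint p b) (unitPoint p a) = 0 := by rw [h]; simp only [cross]; ring
  exact le_antisymm (hp.le_of_cross_unitPoint_nonneg h₁ hc.ge)
    (hp.le_of_cross_unitPoint_nonneg h₂ hc'.ge)

/-- The apex of the unit equilateral triangle on the left of the base from `0` to
`unitPoint p θ` has an angle which depends continuously and monotonically on `θ`. -/
theorem exists_apex_lift (hp : IsStrictNorm p) :
    ∃ τ : ℝ → ℝ, Continuous τ ∧ StrictMono τ ∧ (∀ θ, τ (θ + Real.pi) = τ θ + Real.pi) ∧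
      (∀ θ, θ < τ θ) ∧ (∀ θ, τ θ < θ + Real.pi) ∧
      ∀ θ, unitPoint p (τ (τ θ)) = unitPoint p (τ θ) - unitPoint p θ := by
  choose φ hφ hφ1 using hp.exists_apex_angle
  have hIoo θ := hp.mem_Ioo_of_apex_angle (hφ θ) (hφ1 θ)
  have huniq : ∀ θ s, s ∈ Set.Icc 0 Real.pi → p (unitPoint p (θ + s) - unitPoint p θ) = 1 →
      s = φ θ := by
    intro θ s hs hs1
    have hs' := hp.mem_Ioo_of_apex_angle hs hs1
    have hθ := hIoo θ
    have := hp.apex_unique (hp.map_unitPoint θ) (hp.map_unitPoint (θ + s)) hs1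
      (hp.cross_unitPoint_pos (by linarith [hs'.1]) (by linarith [hs'.2]))
      (hp.map_unitPoint (θ + φ θ)) (hφ1 θ)
      (hp.cross_unitPoint_pos (by linarith [hθ.1]) (by linarith [hθ.2]))
    have := hp.eq_of_unitPoint_eq (by linarith [hs'.2, hθ.1]) (by linarith [hs'.1, hθ.2]) this
    linarith
  have hcφ : Continuous φ := by
    refine continuous_of_unique_root (a := 0) (b := Real.pi) (c := 1)
      (h := fun q : ℝ × ℝ => p (unitPoint p (q.1 + q.2) - unitPoint p q.1)) ?_
      (fun t => ⟨hφ t, hφ1 t⟩) huniq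
    exact hp.continuous.comp ((hp.continuous_unitPoint.comp (by fun_prop)).sub
      (hp.continuous_unitPoint.comp (by fun_prop)))
  have hper : ∀ θ, φ (θ + Real.pi) = φ θ := by
    intro θ
    refine (huniq _ _ (hφ θ) ?_).symm
    rw [add_right_comm, unitPoint_add_pi, unitPoint_add_pi, ← neg_sub', map_neg_eq_map, hφ1]
  have hapex : ∀ θ, unitPoint p (θ + φ θ + φ (θ + φ θ)) =
      unitPoint p (θ + φ θ) - unitPoint p θ := by
    intro θ
    have h1 := hIoo θ
    have h2 := hIoo (θ + φ θ)
    refine hp.apex_unique (hp.map_unitPoint (θ + φ θ)) (hp.map_unitPoint _) (hφ1 _)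
      (hp.cross_unitPoint_pos (by linarith [h2.1]) (by linarith [h2.2])) (hφ1 θ) ?_ ?_
    · rw [sub_sub_cancel_left, map_neg_eq_map, hp.map_unitPoint]
    · have := hp.cross_unitPoint_pos (a := θ) (b := θ + φ θ) (by linarith [h1.1])
        (by linarith [h1.2])
      simp only [cross, Complex.sub_re, Complex.sub_im] at this ⊢
      linarith
  have hcτ : Continuous fun θ => θ + φ θ := continuous_id.add hcφ
  have hinj : Function.Injective fun θ => θ + φ θ := by
    intro a b hab
    simp only at hab
    have ha := hapex a
    rw [hab, hapex b] at ha
    have h1 := hIoo a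
    have h2 := hIoo b
    exact hp.eq_of_unitPoint_eq (by linarith [h1.1, h2.2]) (by linarith [h1.2, h2.1])
      (sub_right_injective ha).symm
  refine ⟨fun θ => θ + φ θ, hcτ, ?_, fun θ => ?_, fun θ => ?_, fun θ => ?_, hapex⟩
  · refine (hcτ.strictMono_of_inj hinj).resolve_right fun h => ?_
    have := h Real.pi_pos
    have h0 := hper 0
    simp only [zero_add] at this h0
    linarith [Real.pi_pos]
  · simp only [hper]; ring
  · linarith [(hIoo θ).1]
  · linarith [(hIoo θ).2]

/-- The area swept by the unit circle of `p` deviates from the area of an inscribed triangle to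
higher order only. -/
theorem area_sub_cross_isLittleO (hp : IsStrictNorm p) (a : ℝ) :
    (fun b => (∫ t in (0 : ℝ)..b, unitRadius p t ^ 2) - (∫ t in (0 : ℝ)..a, unitRadius p t ^ 2) -
      cross (unitPoint p a) (unitPoint p b)) =o[nhds a] fun b => b - a := by
  have h1 : HasDerivAt (fun b => ∫ t in (0 : ℝ)..b, unitRadius p t ^ 2) (unitRadius p a ^ 2) a :=
    ((hp.continuous_unitRadius.pow 2).integral_hasStrictDerivAt 0 a).hasDerivAt
  have h2 : HasDerivAt (fun b => cross (unitPoint p a) (unitPoint p b)) (unitRadius p a ^ 2) a := by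
    simp only [cross_unitPoint]
    have hs : HasDerivAt (fun b => Real.sin (b - a)) 1 a := by
      have := ((hasDerivAt_id a).sub_const a).sin
      simpa using this
    rw [hasDerivAt_iff_tendsto_slope] at hs ⊢
    have hr : Filter.Tendsto (fun b => unitRadius p a * unitRadius p b) (nhdsWithin a {a}ᶜ)
        (nhds (unitRadius p a * unitRadius p a)) :=
      ((continuous_const.mul hp.continuous_unitRadius).tendsto a).mono_left nhdsWithin_le_nhds
    have := hr.mul hs
    rw [mul_one, ← sq] at this
    refine this.congr fun b => ?_
    simp only [slope_def_field, sub_self, Real.sin_zero, mul_zero, sub_zero]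
    ring
  have h3 := hasDerivAt_iff_isLittleO.1 (h1.sub h2)
  refine h3.congr (fun b => ?_) fun b => rfl
  have : cross (unitPoint p a) (unitPoint p a) = 0 := by simp only [cross]; ring
  simp [this]
  ring

end IsStrictNorm

namespace IsStrictNorm

variable {p : Seminorm ℝ ℂ}

/-- The direction of the median of the equilateral triangle with base `0`, `unitPoint p θ` and
apex `unitPoint p (τ θ)` depends continuously on `θ`. -/
theorem exists_median_lift (hp : IsStrictNorm p) {τ : ℝ → ℝ} (hτ : Continuous τ)
    (hτπ : ∀ θ, τ (θ + Real.pi) = τ θ + Real.pi) (hτ₁ : ∀ θ, θ < τ θ)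
    (hτ₂ : ∀ θ, τ θ < θ + Real.pi) :
    ∃ ν : ℝ → ℝ, Continuous ν ∧ (∀ θ, ν (θ + Real.pi) = ν θ + Real.pi) ∧
      (∀ θ, θ < ν θ) ∧ (∀ θ, ν θ < θ + Real.pi) ∧
      ∀ θ, unitPoint p θ + unitPoint p (τ θ) =
        p (unitPoint p θ + unitPoint p (τ θ)) • unitPoint p (ν θ) := by
  set M : ℝ → ℂ := fun θ => unitPoint p θ + unitPoint p (τ θ) with hM
  set W : ℝ → ℂ := fun θ => Complex.exp ((-θ : ℝ) * Complex.I) * M θ with hW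
  have hcM : Continuous M := hp.continuous_unitPoint.add (hp.continuous_unitPoint.comp hτ)
  have hcW : Continuous W := by
    have : Continuous fun θ : ℝ => Complex.exp ((-θ : ℝ) * Complex.I) := by fun_prop
    exact this.mul hcM
  have him : ∀ θ, 0 < (W θ).im := by
    intro θ
    have h1 := hp.cross_unitPoint_pos (hτ₁ θ) (hτ₂ θ)
    have h2 : cross (unitPoint p θ) (unitPoint p (τ θ)) = unitRadius p θ * (W θ).im := by
      simp only [hW, hM, cross, Complex.mul_im, Complex.exp_ofReal_mul_I_re,
        Complex.exp_ofReal_mul_I_im, Complex.add_im, Complex.add_re, Real.cos_neg, Real.sin_neg]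
      simp only [unitPoint, unitRadius, Complex.smul_re, Complex.smul_im,
        Complex.exp_ofReal_mul_I_re, Complex.exp_ofReal_mul_I_im, smul_eq_mul]
      ring
    rw [h2] at h1
    exact pos_of_mul_pos_right h1 (hp.unitRadius_pos θ).le
  have harg : Continuous fun θ => Complex.arg (W θ) := continuous_iff_continuousAt.2 fun θ =>
    (Complex.continuousAt_arg (Or.inr (him θ).ne')).comp hcW.continuousAt
  refine ⟨fun θ => θ + Complex.arg (W θ), continuous_id.add harg, fun θ => ?_, fun θ => ?_,
    fun θ => ?_, fun θ => ?_⟩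
  · have : W (θ + Real.pi) = W θ := by
      simp only [hW, hM, hτπ, unitPoint_add_pi, ← neg_add]
      have : (((-(θ + Real.pi) : ℝ) : ℂ)) * Complex.I =
          ((-θ : ℝ) : ℂ) * Complex.I - Real.pi * Complex.I := by push_cast; ring
      rw [this, Complex.exp_sub, Complex.exp_pi_mul_I]
      ring
    simp only [this]; ring
  · have h1 : 0 ≤ Complex.arg (W θ) := Complex.arg_nonneg_iff.2 (him θ).le
    have h2 : Complex.arg (W θ) ≠ 0 := fun h => (him θ).ne' (Complex.arg_eq_zero_iff.1 h).2
    have := h1.lt_of_ne' h2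
    linarith
  · have := Complex.arg_lt_pi_iff.2 (Or.inr (him θ).ne')
    linarith
  · have hW0 : W θ ≠ 0 := fun h => by have := him θ; simp [h] at this
    have e : M θ = ‖W θ‖ • Complex.exp (((θ + Complex.arg (W θ) : ℝ) : ℂ) * Complex.I) := by
      rw [Complex.ofReal_add, add_mul, Complex.exp_add, Complex.real_smul, mul_left_comm,
        Complex.norm_mul_exp_arg_mul_I]
      simp only [hW]
      rw [← mul_assoc, ← Complex.exp_add]
      simp
    have := hp.smul_exp_eq (norm_pos_iff.2 hW0) (θ + Complex.arg (W θ))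
    rwa [← e] at this

/-- The curve of medians `x + y` encloses three times the area of the unit disc, so the lengths
of the medians are neither all greater nor all smaller than `√3`. -/
theorem median_sq_average (hp : IsStrictNorm p) {c κ : ℝ} (hκ : κ = 1 ∨ κ = -1)
    (h : ∀ x y x' y', p x = 1 → p y = 1 → p (x - y) = 1 → p x' = 1 → p y' = 1 → p (x' - y') = 1 →
      0 ≤ κ * (p (x + y) * p (x' + y') - c ^ 2)) : 0 ≤ κ * (3 - c ^ 2) := by
  obtain ⟨τ, hτ, hτm, hτπ, hτ₁, hτ₂, hττ⟩ := hp.exists_apex_lift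
  obtain ⟨ν, hν, hνπ, hν₁, hν₂, hm⟩ := hp.exists_median_lift hτ hτπ hτ₁ hτ₂
  set F : ℝ → ℝ := fun b => ∫ t in (0 : ℝ)..b, unitRadius p t ^ 2 with hF
  have hsq : Continuous fun t => unitRadius p t ^ 2 := hp.continuous_unitRadius.pow 2
  have hFc : Continuous F := intervalIntegral.continuous_primitive
    (fun a b => hsq.intervalIntegrable a b) 0
  have hFπ : ∀ θ, F (θ + Real.pi) = F θ + F Real.pi := by
    intro θ
    have hper : Function.Periodic (fun t => unitRadius p t ^ 2) Real.pi := fun t => by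
      simp only [unitRadius_add_pi]
    have h1 := hper.intervalIntegral_add_eq θ 0
    have h2 := intervalIntegral.integral_add_adjacent_intervals
      (hsq.intervalIntegrable (μ := MeasureTheory.volume) 0 θ)
      (hsq.intervalIntegrable θ (θ + Real.pi))
    rw [h1, zero_add] at h2
    exact h2.symm
  have hFpos : 0 < F Real.pi := intervalIntegral.intervalIntegral_pos_of_pos
    (hsq.intervalIntegrable _ _) (fun t => pow_pos (hp.unitRadius_pos t) 2) Real.pi_pos
  have hlocal : ∀ ψ : ℝ → ℝ, Continuous ψ → ∀ ε > 0, ∀ a, ∀ᶠ b in nhds a,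
      |F (ψ b) - F (ψ a) - cross (unitPoint p (ψ a)) (unitPoint p (ψ b))| ≤
        ε * |ψ b - ψ a| := fun ψ hψ ε hε a =>
    ((hp.area_sub_cross_isLittleO (ψ a)).comp_tendsto hψ.continuousAt).def hε
  set D : ℝ → ℝ := fun θ => κ * (2 * F θ + 2 * F (τ θ) - F (τ (τ θ)) - c ^ 2 * F (ν θ)) with hD
  set g : ℝ → ℝ := fun θ => 2 * θ + 2 * τ θ + τ (τ θ) + c ^ 2 * ν θ with hg
  have hDc : Continuous D := by fun_prop
  have hgc : Continuous g := by fun_prop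
  have hstep : ∀ ε > 0, D 0 + ε * g 0 ≤ D Real.pi + ε * g Real.pi := by
    intro ε hε
    refine le_of_eventually_le_right (f := fun θ => D θ + ε * g θ) Real.pi_pos.le
      (by fun_prop) fun a _ => ?_
    filter_upwards [(hlocal _ continuous_id ε hε a).filter_mono nhdsWithin_le_nhds,
      (hlocal _ hτ ε hε a).filter_mono nhdsWithin_le_nhds,
      (hlocal _ (hτ.comp hτ) ε hε a).filter_mono nhdsWithin_le_nhds,
      (hlocal _ hν ε hε a).filter_mono nhdsWithin_le_nhds,
      Ioo_mem_nhdsGT (hτ₁ a)] with b h1 h2 h3 h4 hb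
    obtain ⟨hab, hba⟩ := hb
    have hτab := hτm hab
    have hττab := hτm hτab
    have hτba := hτm hba
    have hb1 := hτ₁ b
    have ha2 := hτ₂ a
    have hYX : ∀ θ, p (unitPoint p (τ θ) - unitPoint p θ) = 1 := fun θ => by
      rw [← hττ, hp.map_unitPoint]
    have hXY : ∀ θ, p (unitPoint p θ - unitPoint p (τ θ)) = 1 := fun θ => by
      rw [map_sub_rev, hYX]
    have hmm := cross_median_nonneg p (hp.map_unitPoint a) (hp.map_unitPoint (τ a)) (hYX a)
      (hp.cross_unitPoint_pos (hτ₁ a) ha2) (hp.map_unitPoint b) (hp.map_unitPoint (τ b))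
      (hp.cross_unitPoint_pos hab (by linarith)).le
      (hp.cross_unitPoint_pos hba (by linarith)).le
      (hp.cross_unitPoint_pos hτab (by linarith [hτ₂ (τ a)])).le
      (by rw [← hττ]; exact (hp.cross_unitPoint_pos hτba (by linarith [hτ₂ (τ a)])).le)
    have hsum : cross (unitPoint p a + unitPoint p (τ a)) (unitPoint p b + unitPoint p (τ b)) =
        2 * cross (unitPoint p a) (unitPoint p b) +
        2 * cross (unitPoint p (τ a)) (unitPoint p (τ b)) -
        cross (unitPoint p (τ (τ a))) (unitPoint p (τ (τ b))) := by
      rw [hττ, hττ]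
      simp only [cross, Complex.add_re, Complex.add_im, Complex.sub_re, Complex.sub_im]
      ring
    have hκm := h _ _ _ _ (hp.map_unitPoint a) (hp.map_unitPoint (τ a)) (hXY a)
      (hp.map_unitPoint b) (hp.map_unitPoint (τ b)) (hXY b)
    have hpos : ∀ θ, 0 < p (unitPoint p θ + unitPoint p (τ θ)) := fun θ => by
      refine hp.pos _ fun h0 => ?_
      have := hp.cross_unitPoint_pos (hτ₁ θ) (hτ₂ θ)
      rw [eq_neg_of_add_eq_zero_right h0] at this
      simp only [cross, Complex.neg_re, Complex.neg_im] at this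
      linarith
    have hmul : cross (unitPoint p a + unitPoint p (τ a)) (unitPoint p b + unitPoint p (τ b)) =
        p (unitPoint p a + unitPoint p (τ a)) * p (unitPoint p b + unitPoint p (τ b)) *
          cross (unitPoint p (ν a)) (unitPoint p (ν b)) := by
      conv_lhs => rw [hm a, hm b]
      simp only [cross, Complex.smul_re, Complex.smul_im, smul_eq_mul]
      ring
    have hnn : 0 ≤ cross (unitPoint p (ν a)) (unitPoint p (ν b)) := by
      rw [hmul] at hmm
      exact nonneg_of_mul_nonneg_right hmm (mul_pos (hpos a) (hpos b))
    have hνab : ν a ≤ ν b :=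
      hp.le_of_cross_unitPoint_nonneg (by linarith [hν₂ a, hν₁ b]) hnn
    have hmain : 0 ≤ κ * (2 * cross (unitPoint p a) (unitPoint p b) +
        2 * cross (unitPoint p (τ a)) (unitPoint p (τ b)) -
        cross (unitPoint p (τ (τ a))) (unitPoint p (τ (τ b))) -
        c ^ 2 * cross (unitPoint p (ν a)) (unitPoint p (ν b))) := by
      rw [← hsum, hmul, ← sub_mul, ← mul_assoc]
      exact mul_nonneg hκm hnn
    simp only [id, Function.comp] at h1 h2 h3
    rw [abs_of_pos (sub_pos.2 hab), abs_le] at h1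
    rw [abs_of_pos (sub_pos.2 hτab), abs_le] at h2
    rw [abs_of_pos (sub_pos.2 hττab), abs_le] at h3
    rw [abs_of_nonneg (sub_nonneg.2 hνab), abs_le] at h4
    have h5 := mul_le_mul_of_nonneg_left h4.1 (sq_nonneg c)
    have h6 := mul_le_mul_of_nonneg_left h4.2 (sq_nonneg c)
    simp only [hD, hg]
    rcases hκ with rfl | rfl <;> linarith
  have hDπ : D Real.pi - D 0 = κ * (3 - c ^ 2) * F Real.pi := by
    have h1 := hτπ 0
    have h2 := hτπ (τ 0)
    have h3 := hνπ 0
    have h4 : F 0 = 0 := intervalIntegral.integral_same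
    rw [zero_add] at h1 h3
    simp only [hD, h1, h2, h3, hFπ, h4]
    ring
  have hlim : D 0 ≤ D Real.pi := by
    refine le_of_forall_pos_le_add fun ε hε => ?_
    have h1 := hstep (ε / (|g Real.pi - g 0| + 1)) (by positivity)
    have h2 : ε / (|g Real.pi - g 0| + 1) * (g Real.pi - g 0) ≤ ε := by
      rw [div_mul_eq_mul_div, div_le_iff₀ (by positivity)]
      have := le_abs_self (g Real.pi - g 0)
      gcongr
      linarith
    linarith
  have : 0 ≤ κ * (3 - c ^ 2) * F Real.pi := by linarith
  exact nonneg_of_mul_nonneg_left this hFpos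

theorem exists_median_lt (hp : IsStrictNorm p) {c : ℝ} (hc : Real.sqrt 3 < c) :
    ∃ x y, p x = 1 ∧ p y = 1 ∧ p (x - y) = 1 ∧ p (x + y) < c := by
  by_contra! hall
  have hc0 : 0 ≤ c := (Real.sqrt_nonneg 3).trans hc.le
  have := hp.median_sq_average (c := c) (κ := 1) (Or.inl rfl)
    fun x y x' y' h1 h2 h3 h4 h5 h6 => by
      have := mul_le_mul (hall x y h1 h2 h3) (hall x' y' h4 h5 h6) hc0 (apply_nonneg p _)
      linarith
  have := (Real.sqrt_lt' (hc.trans_le' (Real.sqrt_nonneg 3))).1 hc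
  linarith

theorem exists_lt_median (hp : IsStrictNorm p) {c : ℝ} (hc : c < Real.sqrt 3) :
    ∃ x y, p x = 1 ∧ p y = 1 ∧ p (x - y) = 1 ∧ c < p (x + y) := by
  by_contra! hall
  wlog hc0 : 0 ≤ c generalizing c
  · exact this (c := 0) (by positivity)
      (fun x y h1 h2 h3 => (hall x y h1 h2 h3).trans (not_le.1 hc0).le) le_rfl
  have := hp.median_sq_average (c := c) (κ := -1) (Or.inr rfl)
    fun x y x' y' h1 h2 h3 h4 h5 h6 => by
      have := mul_le_mul (hall x y h1 h2 h3) (hall x' y' h4 h5 h6) (apply_nonneg p _) hc0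
      linarith
  have := (Real.lt_sqrt hc0).1 hc
  linarith

end IsStrictNorm

/-- The strictly convex norm on `ℂ` obtained from the norm of `E` by adding a multiple of the
Euclidean norm. -/
noncomputable def perturbedNorm {E : Type*} [NormedAddCommGroup E] [NormedSpace ℝ E]
    (e : ℂ ≃ₗ[ℝ] E) (ε : NNReal) : Seminorm ℝ ℂ :=
  (normSeminorm ℝ E).comp (e : ℂ →ₗ[ℝ] E) + ε • normSeminorm ℝ ℂ

section

variable {E : Type*} [NormedAddCommGroup E] [NormedSpace ℝ E]

theorem perturbedNorm_apply (e : ℂ ≃ₗ[ℝ] E) (ε : NNReal) (v : ℂ) :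
    perturbedNorm e ε v = ‖e v‖ + ε * ‖v‖ := rfl

theorem isStrictNorm_perturbedNorm (e : ℂ ≃ₗ[ℝ] E) {ε : NNReal} (hε : 0 < ε) :
    IsStrictNorm (perturbedNorm e ε) := by
  have hε' : (0 : ℝ) < ε := hε
  refine ⟨?_, fun v hv => ?_, fun u v hu hv huv s t hs ht hst => ?_⟩
  · have he : Continuous e := (e : ℂ →ₗ[ℝ] E).continuous_of_finiteDimensional
    exact he.norm.add (continuous_const.mul continuous_norm)
  · have := norm_pos_iff.2 hv
    rw [perturbedNorm_apply]
    positivity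
  · by_contra! hge
    rw [perturbedNorm_apply] at hu hv hge
    have h1 : ‖e (s • u + t • v)‖ ≤ s * ‖e u‖ + t * ‖e v‖ := by
      rw [map_add, map_smul, map_smul]
      refine (norm_add_le _ _).trans_eq ?_
      rw [norm_smul, norm_smul, Real.norm_of_nonneg hs.le, Real.norm_of_nonneg ht.le]
    have h2 : ‖s • u‖ + ‖t • v‖ = s * ‖u‖ + t * ‖v‖ := by
      rw [norm_smul, norm_smul, Real.norm_of_nonneg hs.le, Real.norm_of_nonneg ht.le]
    have h3 : ‖s • u + t • v‖ ≤ s * ‖u‖ + t * ‖v‖ := h2 ▸ norm_add_le _ _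
    have h4 := mul_le_mul_of_nonneg_left hu hs.le
    have h5 := mul_le_mul_of_nonneg_left hv ht.le
    have h6 : ‖s • u + t • v‖ = ‖s • u‖ + ‖t • v‖ := by
      rw [h2]
      refine le_antisymm h3 (le_of_mul_le_mul_left ?_ hε')
      linarith
    have hu1 : perturbedNorm e ε u = 1 := by
      rw [perturbedNorm_apply]
      refine le_antisymm hu (le_of_mul_le_mul_left ?_ hs)
      have := mul_le_mul_of_nonneg_left h3 hε'.le
      linarith
    have hv1 : perturbedNorm e ε v = 1 := by
      rw [perturbedNorm_apply]
      refine le_antisymm hv (le_of_mul_le_mul_left ?_ ht)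
      have := mul_le_mul_of_nonneg_left h3 hε'.le
      linarith
    have hray : SameRay ℝ u v := by
      have := ((sameRay_iff_norm_add.2 h6).pos_smul_left (inv_pos.2 hs)).pos_smul_right
        (inv_pos.2 ht)
      rwa [inv_smul_smul₀ hs.ne', inv_smul_smul₀ ht.ne'] at this
    obtain ⟨w, a, b, ha, hb, -, rfl, rfl⟩ := hray.exists_eq_smul
    rw [map_smul_eq_mul, Real.norm_of_nonneg ha] at hu1
    rw [map_smul_eq_mul, Real.norm_of_nonneg hb] at hv1
    have hw : perturbedNorm e ε w ≠ 0 := fun h => by simp [h] at hu1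
    exact huv (by rw [mul_right_cancel₀ hw (hu1.trans hv1.symm)])

theorem exists_of_forall_approx [FiniteDimensional ℝ E] {f : E → E → ℝ}
    (hf : Continuous fun q : E × E => f q.1 q.2)
    (h : ∀ δ > 0, ∃ u v : E, |‖u‖ - 1| ≤ δ ∧ |‖v‖ - 1| ≤ δ ∧ |‖u - v‖ - 1| ≤ δ ∧ f u v ≤ δ) :
    ∃ x y : E, ‖x‖ = 1 ∧ ‖y‖ = 1 ∧ ‖x - y‖ = 1 ∧ f x y ≤ 0 := by
  have := FiniteDimensional.proper ℝ E
  set G : E × E → ℝ := fun q =>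
    |‖q.1‖ - 1| + |‖q.2‖ - 1| + |‖q.1 - q.2‖ - 1| + max (f q.1 q.2) 0 with hG
  have hGc : Continuous G := by fun_prop
  obtain ⟨q, -, hq⟩ := ((isCompact_closedBall (0 : E) 2).prod
    (isCompact_closedBall (0 : E) 2)).exists_isMinOn ⟨(0, 0), by simp⟩ hGc.continuousOn
  have hq0 : G q ≤ 0 := by
    refine le_of_forall_pos_le_add fun δ hδ => ?_
    obtain ⟨u, v, h1, h2, h3, h4⟩ := h (min (δ / 4) 1) (by positivity)
    have hu := (abs_le.1 h1).2
    have hv := (abs_le.1 h2).2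
    have hδ4 := min_le_left (δ / 4) 1
    have hδ1 := min_le_right (δ / 4) 1
    have h5 : G q ≤ G (u, v) := hq ⟨by simp; linarith, by simp; linarith⟩
    have h6 : max (f u v) 0 ≤ δ / 4 := max_le (h4.trans hδ4) (by positivity)
    simp only [hG] at h5 ⊢
    linarith
  have h1 := abs_nonneg (‖q.1‖ - 1)
  have h2 := abs_nonneg (‖q.2‖ - 1)
  have h3 := abs_nonneg (‖q.1 - q.2‖ - 1)
  have h4 := le_max_right (f q.1 q.2) 0
  have h5 := le_max_left (f q.1 q.2) 0
  simp only [hG] at hq0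
  refine ⟨q.1, q.2, ?_, ?_, ?_, by linarith⟩ <;> refine sub_eq_zero.1 (abs_eq_zero.1 ?_) <;>
    linarith

/-- Unit vectors of a perturbed norm are almost unit vectors of `E`. -/
theorem exists_perturbedNorm_approx (e : ℂ ≃ₗ[ℝ] E) {δ : ℝ} (hδ : 0 < δ) :
    ∃ ε : NNReal, 0 < ε ∧ ∀ v, perturbedNorm e ε v ≤ 2 →
      ‖e v‖ ≤ perturbedNorm e ε v ∧ perturbedNorm e ε v ≤ ‖e v‖ + δ := by
  have : FiniteDimensional ℝ E := e.finiteDimensional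
  set S := LinearMap.toContinuousLinearMap (e.symm : E →ₗ[ℝ] ℂ) with hS
  have hε : 0 < δ / (2 * (‖S‖ + 1)) := by positivity
  refine ⟨Real.toNNReal (δ / (2 * (‖S‖ + 1))), Real.toNNReal_pos.2 hε, fun v hv => ?_⟩
  simp only [perturbedNorm_apply, Real.coe_toNNReal _ hε.le] at hv ⊢
  have h0 : 0 ≤ δ / (2 * (‖S‖ + 1)) * ‖v‖ := by positivity
  have h1 : ‖v‖ ≤ ‖S‖ * ‖e v‖ := by simpa [hS] using S.le_opNorm (e v)
  have h2 : ‖v‖ ≤ 2 * (‖S‖ + 1) := by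
    have := mul_le_mul_of_nonneg_left (show ‖e v‖ ≤ 2 by linarith) (norm_nonneg S)
    linarith
  have h3 : δ / (2 * (‖S‖ + 1)) * ‖v‖ ≤ δ := by
    rw [div_mul_eq_mul_div, div_le_iff₀ (by positivity)]
    exact mul_le_mul_of_nonneg_left h2 hδ.le
  exact ⟨by linarith, by linarith⟩

end

theorem equilateral_triangle_median_sqrt_three
    {E : Type*} [NormedAddCommGroup E] [NormedSpace ℝ E]
    (hdim : Module.finrank ℝ E = 2) :
    (∃ x y : E, ‖x‖ = 1 ∧ ‖y‖ = 1 ∧ ‖x - y‖ = 1 ∧ ‖x + y‖ ≤ Real.sqrt 3) ∧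
      (∃ x y : E, ‖x‖ = 1 ∧ ‖y‖ = 1 ∧ ‖x - y‖ = 1 ∧ Real.sqrt 3 ≤ ‖x + y‖) := by
  have hfin : FiniteDimensional ℝ E := FiniteDimensional.of_finrank_pos (by omega)
  have e : ℂ ≃ₗ[ℝ] E := LinearEquiv.ofFinrankEq ℂ E (by rw [hdim, Complex.finrank_real_complex])
  have hunit : ∀ {δ : ℝ} {ε : NNReal}, (∀ v, perturbedNorm e ε v ≤ 2 →
      ‖e v‖ ≤ perturbedNorm e ε v ∧ perturbedNorm e ε v ≤ ‖e v‖ + δ) →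
      ∀ v, perturbedNorm e ε v = 1 → |‖e v‖ - 1| ≤ δ := by
    intro δ ε h v hv
    obtain ⟨h1, h2⟩ := h v (by rw [hv]; norm_num)
    rw [hv] at h1 h2
    rw [abs_le]
    constructor <;> linarith
  have hadd : ∀ {ε : NNReal} {x y : ℂ}, perturbedNorm e ε x = 1 → perturbedNorm e ε y = 1 →
      perturbedNorm e ε (x + y) ≤ 2 := by
    intro ε x y hx hy
    have := map_add_le_add (perturbedNorm e ε) x y
    linarith
  constructor
  · have := exists_of_forall_approx (f := fun u v : E => ‖u + v‖ - Real.sqrt 3) (by fun_prop)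
      fun δ hδ => by
        obtain ⟨ε, hε, hεδ⟩ := exists_perturbedNorm_approx e hδ
        obtain ⟨x, y, hx, hy, hxy, hc⟩ := (isStrictNorm_perturbedNorm e hε).exists_median_lt
          (c := Real.sqrt 3 + δ) (by linarith)
        refine ⟨e x, e y, hunit hεδ x hx, hunit hεδ y hy, ?_, ?_⟩
        · rw [← map_sub]; exact hunit hεδ _ hxy
        · rw [← map_add]
          linarith [(hεδ _ (hadd hx hy)).1]
    simpa only [sub_nonpos] using this
  · have := exists_of_forall_approx (f := fun u v : E => Real.sqrt 3 - ‖u + v‖) (by fun_prop)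
      fun δ hδ => by
        obtain ⟨ε, hε, hεδ⟩ := exists_perturbedNorm_approx e (half_pos hδ)
        obtain ⟨x, y, hx, hy, hxy, hc⟩ := (isStrictNorm_perturbedNorm e hε).exists_lt_median
          (c := Real.sqrt 3 - δ / 2) (by linarith)
        refine ⟨e x, e y, (hunit hεδ x hx).trans (by linarith),
          (hunit hεδ y hy).trans (by linarith), ?_, ?_⟩
        · rw [← map_sub]; exact (hunit hεδ _ hxy).trans (by linarith)
        · rw [← map_add]
          linarith [(hεδ _ (hadd hx hy)).2]
    simpa only [sub_nonpos] using this
end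

section
/- Let E be a two-dimensional real normed vector space and let d > 0. Then there do not exist five pairwise distinct points p₁, p₂, p₃, p₄, p₅ ∈ E with ‖pᵢ − pⱼ‖ = d for all i ≠ j; that is, every equilateral set in a Minkowski plane has at most 4 points. -/
open MeasureTheory AffineMap Module

/-- Three points at equal positive distances from each other are not collinear. -/
theorem not_collinear_of_dist_eq {E : Type*} [NormedAddCommGroup E] [NormedSpace ℝ E]
    {d : ℝ} (hd : 0 < d) {a b c : E} (hab : dist a b = d) (hbc : dist b c = d)
    (hca : dist c a = d) : ¬ Collinear ℝ {a, b, c} := by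
  intro h
  have hba := dist_comm a b
  have hcb := dist_comm b c
  have hac := dist_comm c a
  rcases h.wbtw_or_wbtw_or_wbtw with h | h | h <;>
  · have := h.dist_add_dist
    linarith

/-- A point of a convex hull and an interior point of it are at distance less than any positive
bound for the distances between the generating points. -/
theorem dist_lt_of_mem_interior_convexHull {E : Type*} [NormedAddCommGroup E] [NormedSpace ℝ E]
    {s : Set E} {d : ℝ} (hd : 0 < d) (hs : ∀ a ∈ s, ∀ b ∈ s, dist a b ≤ d) {x y : E}
    (hx : x ∈ interior (convexHull ℝ s)) (hy : y ∈ convexHull ℝ s) : dist x y < d := by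
  have hsub : convexHull ℝ s ⊆ Metric.closedBall y d := by
    intro z hz
    obtain ⟨a, ha, b, hb, hab⟩ := convexHull_exists_dist_ge2 hz hy
    exact hab.trans (hs a ha b hb)
  have := interior_mono hsub hx
  rwa [interior_closedBall _ hd.ne'] at this

/-- In a finite-dimensional normed space, an equilateral family whose convex hull has nonempty
interior has at most `2 ^ finrank ℝ E` members. -/
theorem card_le_two_pow_finrank_of_equilateral {E ι : Type*} [NormedAddCommGroup E]
    [NormedSpace ℝ E] [FiniteDimensional ℝ E] [Fintype ι] {d : ℝ} (hd : 0 < d) {p : ι → E}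
    (hp : ∀ i j, i ≠ j → dist (p i) (p j) = d)
    (hne : (interior (convexHull ℝ (Set.range p))).Nonempty) :
    Fintype.card ι ≤ 2 ^ finrank ℝ E := by
  borelize E
  let μ : Measure E := Measure.addHaar
  set P := convexHull ℝ (Set.range p)
  set U := interior P
  have hdist : ∀ a ∈ Set.range p, ∀ b ∈ Set.range p, dist a b ≤ d := by
    rintro _ ⟨i, rfl⟩ _ ⟨j, rfl⟩
    by_cases hij : i = j
    · simpa [hij] using hd.le
    · exact (hp i j hij).le
  have hform : ∀ i x, homothety (p i) (1 / 2 : ℝ) x = (1 / 2 : ℝ) • x + (1 / 2 : ℝ) • p i := by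
    intro i x
    rw [homothety_apply, vsub_eq_sub, vadd_eq_add]
    module
  have hsub : ∀ i, homothety (p i) (1 / 2 : ℝ) '' U ⊆ U := by
    rintro i _ ⟨x, hx, rfl⟩
    rw [hform]
    exact (convex_convexHull ℝ _).combo_interior_self_mem_interior hx
      (subset_convexHull ℝ _ ⟨i, rfl⟩) (by norm_num) (by norm_num) (by norm_num)
  have hdisj : Pairwise (Function.onFun Disjoint fun i => homothety (p i) (1 / 2 : ℝ) '' U) := by
    intro i j hij
    refine Set.disjoint_left.2 ?_
    rintro _ ⟨x, hx, rfl⟩ ⟨y, hy, hxy⟩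
    rw [hform, hform] at hxy
    have hdiff : x - y = p j - p i := by
      have := congrArg (fun z => (2 : ℝ) • z) hxy
      simp only [smul_add, smul_smul] at this
      norm_num at this
      rw [sub_eq_sub_iff_add_eq_add, ← this, add_comm]
    have hlt := dist_lt_of_mem_interior_convexHull hd hdist hx (interior_subset hy)
    rw [dist_eq_norm, hdiff, ← dist_eq_norm, hp j i hij.symm] at hlt
    exact hlt.false
  have hmeas : ∀ i, MeasurableSet (homothety (p i) (1 / 2 : ℝ) '' U) := fun i =>
    (homothety_isOpenMap (p i) (1 / 2 : ℝ) (by norm_num) U isOpen_interior).measurableSet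
  have hpos : 0 < μ.real U := by
    refine ENNReal.toReal_pos (isOpen_interior.measure_pos μ hne).ne' ?_
    exact ((measure_mono interior_subset).trans_lt
      ((Set.finite_range p).isCompact_convexHull ℝ).measure_lt_top).ne
  have hfin : μ U ≠ ⊤ := fun h => by simp [Measure.real, h] at hpos
  have hle : ∑ i, μ.real (homothety (p i) (1 / 2 : ℝ) '' U) ≤ μ.real U := by
    rw [← measureReal_iUnion_fintype hdisj hmeas
      (fun i => measure_ne_top_of_subset (hsub i) hfin)]
    exact measureReal_mono (Set.iUnion_subset hsub) hfin
  have hscale : ∀ i, μ.real (homothety (p i) (1 / 2 : ℝ) '' U)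
      = (1 / 2) ^ finrank ℝ E * μ.real U := by
    intro i
    rw [Measure.real, Measure.addHaar_image_homothety, ENNReal.toReal_mul,
      ENNReal.toReal_ofReal (abs_nonneg _), abs_of_nonneg (by positivity), Measure.real]
  simp only [hscale, Finset.sum_const, Finset.card_univ, nsmul_eq_mul] at hle
  rw [← mul_assoc] at hle
  have h1 := le_of_mul_le_mul_right (hle.trans_eq (one_mul _).symm) hpos
  rw [one_div, inv_pow, ← div_eq_mul_inv, div_le_one (by positivity)] at h1
  exact_mod_cast h1

theorem no_five_point_equilateral_set
    {E : Type*} [NormedAddCommGroup E] [NormedSpace ℝ E]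
    (hdim : Module.finrank ℝ E = 2)
    (d : ℝ) (hd : 0 < d) :
    ¬ ∃ p : Fin 5 → E, Function.Injective p ∧
        ∀ i j : Fin 5, i ≠ j → ‖p i - p j‖ = d := by
  rintro ⟨p, -, hp⟩
  simp only [← dist_eq_norm] at hp
  have : FiniteDimensional ℝ E := FiniteDimensional.of_finrank_pos (by omega)
  have hind : AffineIndependent ℝ ![p 0, p 1, p 2] := by
    rw [affineIndependent_iff_not_collinear_set]
    exact not_collinear_of_dist_eq hd (hp _ _ (by decide)) (hp _ _ (by decide))
      (hp _ _ (by decide))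
  have hspan : affineSpan ℝ (Set.range ![p 0, p 1, p 2]) = ⊤ := by
    rw [hind.affineSpan_eq_top_iff_card_eq_finrank_add_one, hdim, Fintype.card_fin]
  have hsub : Set.range ![p 0, p 1, p 2] ⊆ Set.range p := by
    rintro _ ⟨i, rfl⟩
    fin_cases i <;> simp
  have hcard := card_le_two_pow_finrank_of_equilateral hd hp
    (interior_convexHull_nonempty_iff_affineSpan_eq_top.2
      (top_le_iff.1 (hspan.ge.trans (affineSpan_mono ℝ hsub))))
  rw [hdim, Fintype.card_fin] at hcard
  norm_num at hcard
end

section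
/- Let E be a two-dimensional real normed vector space and suppose there exist four pairwise distinct points a, b, c, d ∈ E and a real number r > 0 with all six pairwise distances equal to r. Then the closed unit ball of E is a parallelogram: there exist linearly independent vectors u, v ∈ E such that the closed unit ball equals the convex hull of {u, v, −u, −v}. -/
section EquilateralSets

variable {E : Type*} [NormedAddCommGroup E] [NormedSpace ℝ E]

/-- If two unit vectors have sum and difference of norm `2`, the norm of their span is `ℓ¹`. -/
lemma norm_smul_add_smul_eq_abs_add_abs {u v : E} (hu : ‖u‖ = 1) (hv : ‖v‖ = 1)
    (hadd : ‖u + v‖ = 2) (hsub : ‖u - v‖ = 2) (s t : ℝ) :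
    ‖s • u + t • v‖ = |s| + |t| := by
  apply le_antisymm
  · simpa [norm_smul, hu, hv] using norm_add_le (s • u) (t • v)
  have h₁ : ‖s • (u + v)‖ ≤ ‖s • u + t • v‖ + ‖(s - t) • v‖ := by
    rw [show s • (u + v) = (s • u + t • v) + (s - t) • v by module]
    exact norm_add_le _ _
  have h₂ : ‖t • (u + v)‖ ≤ ‖s • u + t • v‖ + ‖(t - s) • u‖ := by
    rw [show t • (u + v) = (s • u + t • v) + (t - s) • u by module]
    exact norm_add_le _ _
  have h₃ : ‖s • (u - v)‖ ≤ ‖s • u + t • v‖ + ‖(-s - t) • v‖ := by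
    rw [show s • (u - v) = (s • u + t • v) + (-s - t) • v by module]
    exact norm_add_le _ _
  have h₄ : ‖(-t) • (u - v)‖ ≤ ‖s • u + t • v‖ + ‖(-t - s) • u‖ := by
    rw [show (-t) • (u - v) = (s • u + t • v) + (-t - s) • u by module]
    exact norm_add_le _ _
  simp only [norm_smul, hu, hv, hadd, hsub, Real.norm_eq_abs] at h₁ h₂ h₃ h₄
  grind

/-- In a plane, two unit vectors with sum and difference of norm `2` span the unit ball. -/
lemma closedBall_eq_convexHull_of_norm_add_of_norm_sub (hdim : Module.finrank ℝ E = 2)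
    {u v : E} (hu : ‖u‖ = 1) (hv : ‖v‖ = 1) (hadd : ‖u + v‖ = 2) (hsub : ‖u - v‖ = 2) :
    LinearIndependent ℝ ![u, v] ∧
      Metric.closedBall (0 : E) 1 = convexHull ℝ {u, v, -u, -v} := by
  have hnorm := norm_smul_add_smul_eq_abs_add_abs hu hv hadd hsub
  have : Module.Finite ℝ E := Module.finite_of_finrank_pos (by omega)
  have hli : LinearIndependent ℝ ![u, v] := by
    refine LinearIndependent.pair_iff.2 fun s t h => ?_
    have := hnorm s t
    rw [h, norm_zero] at this
    constructor <;> grind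
  refine ⟨hli, Set.Subset.antisymm (fun x hx => ?_) (convexHull_min ?_ (convex_closedBall 0 1))⟩
  · have hspan : x ∈ Submodule.span ℝ {u, v} := by
      have := hli.span_eq_top_of_card_eq_finrank' (by simp [hdim])
      rw [Matrix.range_cons_cons_empty] at this
      simp [this]
    obtain ⟨s, t, rfl⟩ := Submodule.mem_span_pair.1 hspan
    rw [mem_closedBall_zero_iff, hnorm] at hx
    have key := (convex_convexHull ℝ ({u, v, -u, -v} : Set E)).sum_mem (t := Finset.univ)
      (w := ![(1 + s - |t|) / 2, (|t| + t) / 2, (1 - s - |t|) / 2, (|t| - t) / 2])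
      (z := ![u, v, -u, -v])
      (by intro i _; fin_cases i <;> simp <;> grind)
      (by simp [Fin.sum_univ_four]; ring)
      (by intro i _; apply subset_convexHull; fin_cases i <;> simp)
    convert key using 1
    simp [Fin.sum_univ_four]
    module
  · rintro x (rfl | rfl | rfl | rfl) <;> simp [hu, hv]

/-- Bounds on the weights of an affine dependence of four points with some distances equal. -/
lemma abs_weight_le_and_abs_add_le {a b c d : E} {r : ℝ} (hr : 0 < r)
    (hab : ‖a - b‖ = r) (hac : ‖a - c‖ = r) (hbc : ‖b - c‖ = r) (hbd : ‖b - d‖ = r)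
    {α β γ δ : ℝ} (hsum : α + β + γ + δ = 0)
    (hrel : α • a + β • b + γ • c + δ • d = 0) :
    |α| ≤ |γ| + |δ| ∧ α + γ ≤ |γ| + |δ| ∧ -(α + γ) ≤ |γ| + |δ| := by
  obtain rfl : β = -(α + γ + δ) := by linarith
  have h₁ : α • (a - b) = γ • (b - c) + δ • (b - d) := by
    rw [← sub_eq_zero, ← hrel]
    module
  have h₂ : (α + γ) • (a - b) = γ • (a - c) + δ • (b - d) := by
    rw [← sub_eq_zero, ← hrel]
    module
  rw [← abs_le']
  constructor
  · have := norm_add_le (γ • (b - c)) (δ • (b - d))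
    rw [← h₁] at this
    simp only [norm_smul, Real.norm_eq_abs, hab, hbc, hbd] at this
    nlinarith
  · have := norm_add_le (γ • (a - c)) (δ • (b - d))
    rw [← h₂] at this
    simp only [norm_smul, Real.norm_eq_abs, hab, hac, hbd] at this
    nlinarith

/-- If two diagonals of an equilateral quadruple bisect each other, the unit ball is a
parallelogram. -/
lemma exists_closedBall_eq_convexHull_of_add_eq_add (hdim : Module.finrank ℝ E = 2)
    {a b c d : E} {r : ℝ} (hr : 0 < r) (hab : ‖a - b‖ = r) (hac : ‖a - c‖ = r)
    (had : ‖a - d‖ = r) (hbd : ‖b - d‖ = r) (h : a + c = b + d) :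
    ∃ u v : E, LinearIndependent ℝ ![u, v] ∧
      Metric.closedBall (0 : E) 1 = convexHull ℝ {u, v, -u, -v} := by
  obtain rfl : c = b + d - a := by rw [← h]; abel
  refine ⟨r⁻¹ • (a - (b + d - a)), r⁻¹ • (b - d),
    closedBall_eq_convexHull_of_norm_add_of_norm_sub hdim ?_ ?_ ?_ ?_⟩
  · simp only [norm_smul, hac, norm_inv, Real.norm_eq_abs, abs_of_pos hr]; field_simp
  · simp only [norm_smul, hbd, norm_inv, Real.norm_eq_abs, abs_of_pos hr]; field_simp
  · rw [show r⁻¹ • (a - (b + d - a)) + r⁻¹ • (b - d) = (2 * r⁻¹) • (a - d) by module]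
    simp only [norm_smul, had, norm_mul, norm_inv, Real.norm_eq_abs, abs_of_pos hr, abs_two]
    field_simp
  · rw [show r⁻¹ • (a - (b + d - a)) - r⁻¹ • (b - d) = (2 * r⁻¹) • (a - b) by module]
    simp only [norm_smul, hab, norm_mul, norm_inv, Real.norm_eq_abs, abs_of_pos hr, abs_two]
    field_simp

/-- Four points in a plane are affinely dependent. -/
lemma exists_affine_relation_of_finrank_eq_two (hdim : Module.finrank ℝ E = 2) (a b c d : E) :
    ∃ α β γ δ : ℝ, α + β + γ + δ = 0 ∧ α • a + β • b + γ • c + δ • d = 0 ∧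
      ¬(α = 0 ∧ β = 0 ∧ γ = 0) := by
  have : Module.Finite ℝ E := Module.finite_of_finrank_pos (by omega)
  have hdep : ¬LinearIndependent ℝ ![a - d, b - d, c - d] := fun h => by
    have := h.fintype_card_le_finrank
    simp [hdim] at this
  obtain ⟨g, hg, i, hi⟩ := Fintype.not_linearIndependent_iff.1 hdep
  simp only [Fin.sum_univ_three, Matrix.cons_val] at hg
  refine ⟨g 0, g 1, g 2, -(g 0 + g 1 + g 2), by ring, ?_, ?_⟩
  · rw [← hg]; module
  · rintro ⟨h0, h1, h2⟩
    fin_cases i <;> simp_all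

/-- The four weights of an affine dependence of an equilateral quadruple form two pairs of equal
weights of opposite sign. -/
lemma weights_pair_of_equilateral {a b c d : E} {r : ℝ} (hr : 0 < r)
    (hab : ‖a - b‖ = r) (hac : ‖a - c‖ = r) (had : ‖a - d‖ = r)
    (hbc : ‖b - c‖ = r) (hbd : ‖b - d‖ = r) (hcd : ‖c - d‖ = r)
    {α β γ δ : ℝ} (hsum : α + β + γ + δ = 0)
    (hrel : α • a + β • b + γ • c + δ • d = 0) :
    (α = γ ∧ β = -α ∧ δ = -α) ∨ (α = β ∧ γ = -α ∧ δ = -α) ∨ (α = δ ∧ β = -α ∧ γ = -α) := by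
  have hba : ‖b - a‖ = r := norm_sub_rev a b ▸ hab
  have hca : ‖c - a‖ = r := norm_sub_rev a c ▸ hac
  have hda : ‖d - a‖ = r := norm_sub_rev a d ▸ had
  have hcb : ‖c - b‖ = r := norm_sub_rev b c ▸ hbc
  have hdb : ‖d - b‖ = r := norm_sub_rev b d ▸ hbd
  have hdc : ‖d - c‖ = r := norm_sub_rev c d ▸ hcd
  obtain ⟨p1, q1, r1⟩ := abs_weight_le_and_abs_add_le (α := γ) (β := δ) (γ := α) (δ := β)
    hr hcd hca hda hdb (by linarith) (by rw [← hrel]; abel)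
  obtain ⟨p2, q2, r2⟩ := abs_weight_le_and_abs_add_le (α := δ) (β := γ) (γ := α) (δ := β)
    hr hdc hda hca hcb (by linarith) (by rw [← hrel]; abel)
  obtain ⟨p3, q3, r3⟩ := abs_weight_le_and_abs_add_le (α := β) (β := δ) (γ := α) (δ := γ)
    hr hbd hba hda hdc (by linarith) (by rw [← hrel]; abel)
  obtain ⟨p4, q4, r4⟩ := abs_weight_le_and_abs_add_le (α := δ) (β := β) (γ := α) (δ := γ)
    hr hdb hda hba hbc (by linarith) (by rw [← hrel]; abel)
  obtain ⟨p5, q5, r5⟩ := abs_weight_le_and_abs_add_le (α := β) (β := γ) (γ := α) (δ := δ)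
    hr hbc hba hca hcd (by linarith) (by rw [← hrel]; abel)
  obtain ⟨p6, q6, r6⟩ := abs_weight_le_and_abs_add_le (α := γ) (β := β) (γ := α) (δ := δ)
    hr hcb hca hba hbd (by linarith) (by rw [← hrel]; abel)
  obtain ⟨p7, q7, r7⟩ := abs_weight_le_and_abs_add_le (α := α) (β := δ) (γ := β) (δ := γ)
    hr had hab hdb hdc (by linarith) (by rw [← hrel]; abel)
  obtain ⟨p8, q8, r8⟩ := abs_weight_le_and_abs_add_le (α := δ) (β := α) (γ := β) (δ := γ)
    hr hda hdb hab hac (by linarith) (by rw [← hrel]; abel)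
  obtain ⟨p9, q9, r9⟩ := abs_weight_le_and_abs_add_le (α := α) (β := γ) (γ := β) (δ := δ)
    hr hac hab hcb hcd (by linarith) (by rw [← hrel]; abel)
  obtain ⟨p10, q10, r10⟩ := abs_weight_le_and_abs_add_le (α := γ) (β := α) (γ := β) (δ := δ)
    hr hca hcb hab had (by linarith) (by rw [← hrel]; abel)
  obtain ⟨p11, q11, r11⟩ := abs_weight_le_and_abs_add_le (α := α) (β := β) (γ := γ) (δ := δ)
    hr hab hac hbc hbd (by linarith) hrel
  obtain ⟨p12, q12, r12⟩ := abs_weight_le_and_abs_add_le (α := β) (β := α) (γ := γ) (δ := δ)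
    hr hba hbc hac had (by linarith) (by rw [← hrel]; abel)
  clear hrel
  obtain ⟨e₁, s₁⟩ | ⟨e₁, s₁⟩ := abs_cases α <;> obtain ⟨e₂, s₂⟩ | ⟨e₂, s₂⟩ := abs_cases β <;>
    obtain ⟨e₃, s₃⟩ | ⟨e₃, s₃⟩ := abs_cases γ <;> obtain ⟨e₄, s₄⟩ | ⟨e₄, s₄⟩ := abs_cases δ <;>
    first
    | exact Or.inl ⟨by linarith, by linarith, by linarith⟩
    | exact Or.inr (Or.inl ⟨by linarith, by linarith, by linarith⟩)
    | exact Or.inr (Or.inr ⟨by linarith, by linarith, by linarith⟩)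

end EquilateralSets

theorem four_point_equilateral_set_implies_rectilinear
    {E : Type*} [NormedAddCommGroup E] [NormedSpace ℝ E]
    (hdim : Module.finrank ℝ E = 2)
    (a b c d : E) (r : ℝ) (hr : 0 < r)
    (hab : a ≠ b) (hac : a ≠ c) (had : a ≠ d) (hbc : b ≠ c) (hbd : b ≠ d) (hcd : c ≠ d)
    (h1 : ‖a - b‖ = r) (h2 : ‖a - c‖ = r) (h3 : ‖a - d‖ = r)
    (h4 : ‖b - c‖ = r) (h5 : ‖b - d‖ = r) (h6 : ‖c - d‖ = r) :
    ∃ u v : E, LinearIndependent ℝ ![u, v] ∧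
      Metric.closedBall (0 : E) 1 = convexHull ℝ {u, v, -u, -v} := by
  obtain ⟨α, β, γ, δ, hsum, hrel, hne⟩ := exists_affine_relation_of_finrank_eq_two hdim a b c d
  have hα : α ≠ 0 := by
    rintro rfl
    have := weights_pair_of_equilateral hr h1 h2 h3 h4 h5 h6 hsum hrel
    grind
  have cancel {x y : E} (h : α • x - α • y = 0) : x = y :=
    smul_right_injective E hα (sub_eq_zero.1 h)
  rcases weights_pair_of_equilateral hr h1 h2 h3 h4 h5 h6 hsum hrel with
    ⟨rfl, rfl, rfl⟩ | ⟨rfl, rfl, rfl⟩ | ⟨rfl, rfl, rfl⟩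
  · exact exists_closedBall_eq_convexHull_of_add_eq_add hdim hr h1 h2 h3 h5
      (cancel (by rw [← hrel]; module))
  · exact exists_closedBall_eq_convexHull_of_add_eq_add hdim hr h2 h1 h3 h6
      (cancel (by rw [← hrel]; module))
  · exact exists_closedBall_eq_convexHull_of_add_eq_add hdim hr h1 h3 h2 h4
      (cancel (by rw [← hrel]; module))
end

section
/- Let E be a two-dimensional real normed vector space. Then the unit circle of E has a pair of conjugate diameters whose endpoints are extreme points of the unit ball: there exist x, y ∈ E with ‖x‖ = ‖y‖ = 1 such that x and y are extreme points of the closed unit ball, x is normal to y (‖x‖ ≤ ‖x + t•y‖ for all t ∈ ℝ), and y is normal to x (‖y‖ ≤ ‖y + t•x‖ for all t ∈ ℝ). -/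
/-- A continuous linear functional attains its maximum over a nonempty compact set at an extreme
point of that set. -/
theorem IsCompact.exists_extremePoint_forall_le {E : Type*} [NormedAddCommGroup E]
    [NormedSpace ℝ E] {K : Set E} (hK : IsCompact K) (hne : K.Nonempty) (l : E →L[ℝ] ℝ) :
    ∃ x ∈ K.extremePoints ℝ, ∀ z ∈ K, l z ≤ l x := by
  obtain ⟨x₀, hx₀, hmax⟩ := hK.exists_isMaxOn hne l.continuous.continuousOn
  have hexp : IsExposed ℝ K (l.toExposed K) := ContinuousLinearMap.toExposed.isExposed
  obtain ⟨x, hx⟩ := (hexp.isCompact hK).extremePoints_nonempty ⟨x₀, hx₀, fun z hz => hmax hz⟩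
  exact ⟨x, hexp.isExtreme.extremePoints_subset_extremePoints hx, hx.1.2⟩

/-- A linear functional bounded above by `M` on the closed unit ball is bounded by `M * ‖z‖`. -/
theorem ContinuousLinearMap.le_mul_norm_of_forall_closedBall {E : Type*} [NormedAddCommGroup E]
    [NormedSpace ℝ E] (l : E →L[ℝ] ℝ) {M : ℝ}
    (h : ∀ z ∈ Metric.closedBall (0 : E) 1, l z ≤ M) (z : E) : l z ≤ M * ‖z‖ := by
  rcases eq_or_ne z 0 with rfl | hz
  · simp
  have hpos : 0 < ‖z‖ := norm_pos_iff.2 hz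
  have hb := h (‖z‖⁻¹ • z) (by simp [norm_smul, hpos.ne'])
  rw [map_smul, smul_eq_mul, inv_mul_le_iff₀ hpos] at hb
  linarith

theorem exists_conjugate_diameters_with_extreme_endpoints
    {E : Type*} [NormedAddCommGroup E] [NormedSpace ℝ E]
    (hdim : Module.finrank ℝ E = 2) :
    ∃ x y : E, ‖x‖ = 1 ∧ ‖y‖ = 1 ∧
      x ∈ Set.extremePoints ℝ (Metric.closedBall (0 : E) 1) ∧
      y ∈ Set.extremePoints ℝ (Metric.closedBall (0 : E) 1) ∧
      (∀ t : ℝ, ‖x‖ ≤ ‖x + t • y‖) ∧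
      (∀ t : ℝ, ‖y‖ ≤ ‖y + t • x‖) := by
  have hfin : FiniteDimensional ℝ E := Module.finite_of_finrank_eq_succ hdim
  have hproper : ProperSpace E := FiniteDimensional.proper ℝ E
  let b := Module.finBasisOfFinrankEq ℝ E hdim
  obtain ⟨f, hf⟩ : ∃ f : E →L[ℝ] ℝ, ∀ z, f z = b.coord 0 z :=
    ⟨(b.coord 0).toContinuousLinearMap, fun _ => rfl⟩
  obtain ⟨g, hg⟩ : ∃ g : E →L[ℝ] ℝ, ∀ z, g z = b.coord 1 z :=
    ⟨(b.coord 1).toContinuousLinearMap, fun _ => rfl⟩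
  -- the area form, as a functional of its first and of its second argument
  obtain ⟨L, hL⟩ : ∃ L : E → E →L[ℝ] ℝ, ∀ x y, L y x = g y * f x - f y * g x :=
    ⟨fun y => g y • f - f y • g, fun x y => by simp⟩
  obtain ⟨R, hR⟩ : ∃ R : E → E →L[ℝ] ℝ, ∀ x y, R x y = L y x :=
    ⟨fun x => f x • g - g x • f, fun x y => by simp [hL]; ring⟩
  have hK : IsCompact (Metric.closedBall (0 : E) 1) := isCompact_closedBall 0 1
  have hne : (Metric.closedBall (0 : E) 1).Nonempty := ⟨0, by simp⟩
  obtain ⟨p, hp, hmax⟩ := (hK.prod hK).exists_isMaxOn (hne.prod hne)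
    (f := fun p : E × E => L p.2 p.1)
    (by simp only [hL]; fun_prop)
  obtain ⟨x, hx, hxmax⟩ := hK.exists_extremePoint_forall_le hne (L p.2)
  obtain ⟨y, hy, hymax⟩ := hK.exists_extremePoint_forall_le hne (R x)
  have hM : ∀ z ∈ Metric.closedBall (0 : E) 1, ∀ w ∈ Metric.closedBall (0 : E) 1,
      L w z ≤ L y x := fun z hz w hw => by
    have h₁ : L w z ≤ L p.2 p.1 := isMaxOn_iff.1 hmax (z, w) ⟨hz, hw⟩
    have h₂ := hxmax p.1 hp.1
    have h₃ := hymax p.2 hp.2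
    rw [hR, hR] at h₃
    linarith
  have hLx := (L y).le_mul_norm_of_forall_closedBall fun z hz => hM z hz y hy.1
  have hRy := (R x).le_mul_norm_of_forall_closedBall fun w hw => by
    rw [hR]; exact hM x hx.1 w hw
  have hpos : 0 < L y x := by
    by_contra! hle
    have hzero : ∀ w ∈ Metric.closedBall (0 : E) 1, L w (b 0) ≤ 0 := fun w hw => by
      have := (L w).le_mul_norm_of_forall_closedBall (fun z hz => hM z hz w hw) (b 0)
      exact this.trans (mul_nonpos_of_nonpos_of_nonneg hle (norm_nonneg _))
    have h := (R (b 0)).le_mul_norm_of_forall_closedBall (M := 0)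
      (fun w hw => by rw [hR]; exact hzero w hw) (b 1)
    rw [hR, hL] at h
    norm_num [hf, hg] at h
  have hx1 : ‖x‖ = 1 := le_antisymm (by simpa using hx.1)
    ((le_mul_iff_one_le_right hpos).1 (hLx x))
  have hy1 : ‖y‖ = 1 := le_antisymm (by simpa using hy.1)
    ((le_mul_iff_one_le_right hpos).1 (by simpa only [hR] using hRy y))
  refine ⟨x, y, hx1, hy1, hx, hy, fun t => ?_, fun t => ?_⟩
  · rw [hx1, ← le_mul_iff_one_le_right hpos]
    have h : L y (x + t • y) = L y x := by simp [hL]; ring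
    exact h ▸ hLx (x + t • y)
  · rw [hy1, ← le_mul_iff_one_le_right hpos]
    have h : R x (y + t • x) = L y x := by simp [hR, hL]; ring
    exact h ▸ hRy (y + t • x)
end

section
/- Let E be a two-dimensional real normed vector space, and suppose [a₁,b₁], [a₂,b₂], [a₃,b₃], [a₄,b₄] are four closed segments, each contained in the unit sphere of E and each of length ‖bᵢ − aᵢ‖ ≥ 1. Then some two of the four direction vectors b₁ − a₁, b₂ − a₂, b₃ − a₃, b₄ − a₄ are linearly dependent (parallel). Equivalently, the unit circle of a Minkowski plane carries at most three pairs of segments of length at least 1. -/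
open MeasureTheory in
/-- Pairwise disjoint open intervals inside `[-1, 1]` have total length at most `2`. -/
theorem sum_length_le_two_of_pairwise_disjoint {ι : Type*} [Fintype ι] (l r : ι → ℝ)
    (hlr : ∀ i, l i ≤ r i) (hl : ∀ i, -1 ≤ l i) (hr : ∀ i, r i ≤ 1)
    (hdisj : Pairwise fun i j => Disjoint (Set.Ioo (l i) (r i)) (Set.Ioo (l j) (r j))) :
    ∑ i, (r i - l i) ≤ 2 := by
  have hsum : ∑ i, volume (Set.Ioo (l i) (r i)) ≤ volume (Set.Icc (-1 : ℝ) 1) := by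
    rw [← tsum_fintype (L := SummationFilter.unconditional ι),
      ← measure_iUnion hdisj fun _ => measurableSet_Ioo]
    exact measure_mono (Set.iUnion_subset fun i x hx =>
      ⟨(hl i).trans hx.1.le, hx.2.le.trans (hr i)⟩)
  simp only [Real.volume_Ioo, Real.volume_Icc] at hsum
  rw [← ENNReal.ofReal_sum_of_nonneg fun i _ => sub_nonneg.2 (hlr i),
    ENNReal.ofReal_le_ofReal_iff (by norm_num)] at hsum
  linarith

section LinearAlgebra

variable {E : Type*} [AddCommGroup E] [Module ℝ E]

theorem exists_eq_smul_add_smul_of_finrank_eq_two (hdim : Module.finrank ℝ E = 2) {u v : E}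
    (huv : LinearIndependent ℝ ![u, v]) (x : E) : ∃ s t : ℝ, x = s • u + t • v := by
  let B := basisOfLinearIndependentOfCardEqFinrank huv (by simp [hdim])
  have h := B.sum_repr x
  simp only [B, Fin.sum_univ_two, coe_basisOfLinearIndependentOfCardEqFinrank] at h
  exact ⟨_, _, h.symm⟩

/-- A functional taking the value `1` at `p` on a plane is the first of two coordinates, along `p`
and along a vector of its kernel. -/
theorem exists_dual_coordinate (hdim : Module.finrank ℝ E = 2) (h : Module.Dual ℝ E) {p : E}
    (hp : h p = 1) :
    ∃ k : Module.Dual ℝ E, k p = 0 ∧ ∀ x, h x = 0 → k x = 0 → x = 0 := by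
  have : FiniteDimensional ℝ E := .of_finrank_pos (by omega)
  obtain ⟨d, hd, hd0⟩ : ∃ d ∈ LinearMap.ker h, d ≠ 0 := by
    refine Submodule.exists_mem_ne_zero_of_ne_bot fun hbot => ?_
    have := LinearMap.finrank_le_finrank_of_injective (LinearMap.ker_eq_bot.1 hbot)
    simp [hdim] at this
  rw [LinearMap.mem_ker] at hd
  have hpd : LinearIndependent ℝ ![p, d] := by
    rw [LinearIndependent.pair_iff]
    intro s t hst
    have hs : s = 0 := by simpa [hp, hd] using congrArg h hst
    subst hs
    simpa [hd0] using hst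
  let B := basisOfLinearIndependentOfCardEqFinrank hpd (by simp [hdim])
  have hB0 : B 0 = p := by simp [B]
  have hB1 : B 1 = d := by simp [B]
  refine ⟨B.coord 1, by simp [← hB0], fun x hx hkx => ?_⟩
  have hrepr := B.sum_repr x
  rw [Module.Basis.coord_apply] at hkx
  rw [Fin.sum_univ_two, hB0, hB1, hkx, zero_smul, add_zero] at hrepr
  have : B.repr x 0 = 0 := by simpa [hp, hx] using congrArg h hrepr
  rw [← hrepr, this, zero_smul]

theorem dual_eq_zero_of_linearIndependent_pair (hdim : Module.finrank ℝ E = 2) {u v : E}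
    (huv : LinearIndependent ℝ ![u, v]) (f : Module.Dual ℝ E) (hu : f u = 0) (hv : f v = 0) :
    f = 0 := by
  ext x
  obtain ⟨s, t, rfl⟩ := exists_eq_smul_add_smul_of_finrank_eq_two hdim huv x
  simp [hu, hv]

/-- If each vector of a family has a functional at which it dominates the sum of all the others,
then a linear relation omitting one vector has coefficients of equal absolute value. -/
theorem exists_abs_eq_of_sum_smul_eq_zero (hdim : Module.finrank ℝ E = 2) {ι : Type*} [Fintype ι]
    (w : ι → E) (hw : ∀ i j, i ≠ j → LinearIndependent ℝ ![w i, w j])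
    (hdom : ∀ i, ∃ h : Module.Dual ℝ E, 0 < h (w i) ∧ ∑ j, |h (w j)| ≤ 2 * h (w i))
    (x : ι → ℝ) (hx : ∑ j, x j • w j = 0) {m : ι} (hm : x m = 0) :
    ∃ c, ∀ j, j ≠ m → |x j| = c := by
  classical
  have : Nonempty ι := ⟨m⟩
  obtain ⟨i, hi⟩ := Finite.exists_max fun j => |x j|
  obtain ⟨h, hpos, hsum⟩ := hdom i
  refine ⟨|x i|, fun j hj => ?_⟩
  rcases (abs_nonneg (x i)).eq_or_lt with hxi | hxi
  · exact le_antisymm (hi j) (hxi ▸ abs_nonneg _)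
  have hrel : ∑ j, x j * h (w j) = 0 := by simpa using congrArg h hx
  rw [← Finset.add_sum_erase _ _ (Finset.mem_univ i)] at hrel hsum
  have hle : |x i| * h (w i) ≤ ∑ j ∈ Finset.univ.erase i, |x j| * |h (w j)| := by
    calc |x i| * h (w i) = |x i * h (w i)| := by rw [abs_mul, abs_of_pos hpos]
      _ = |∑ j ∈ Finset.univ.erase i, x j * h (w j)| := by
        rw [eq_neg_of_add_eq_zero_left hrel, abs_neg]
      _ ≤ _ := by simpa only [abs_mul] using Finset.abs_sum_le_sum_abs (fun j => x j * h (w j)) _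
  have hnonneg : ∀ j ∈ Finset.univ.erase i, 0 ≤ (|x i| - |x j|) * |h (w j)| := fun j _ =>
    mul_nonneg (sub_nonneg.2 (hi j)) (abs_nonneg _)
  have hzero : ∑ j ∈ Finset.univ.erase i, (|x i| - |x j|) * |h (w j)| = 0 := by
    refine le_antisymm ?_ (Finset.sum_nonneg hnonneg)
    simp only [sub_mul, Finset.sum_sub_distrib, ← Finset.mul_sum]
    rw [abs_of_pos hpos] at hsum
    nlinarith
  rw [Finset.sum_eq_zero_iff_of_nonneg hnonneg] at hzero
  rcases eq_or_ne j i with rfl | hji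
  · rfl
  have hmi : m ≠ i := by
    rintro rfl
    simp [hm] at hxi
  have hwm : h (w m) = 0 := by
    simpa [hm, abs_pos.1 hxi] using hzero m (by simp [hmi])
  have hwj : h (w j) ≠ 0 := fun hwj => by
    have := dual_eq_zero_of_linearIndependent_pair hdim (hw j m hj) h hwj hwm
    simp [this] at hpos
  have := hzero j (by simp [hji])
  simp only [mul_eq_zero, abs_eq_zero, hwj, or_false] at this
  linarith

/-- At most three pairwise independent vectors of a plane can dominate each other in this way. -/
theorem not_forall_exists_dual_dominant (hdim : Module.finrank ℝ E = 2)
    (w : Fin 4 → E) (hw : ∀ i j, i ≠ j → LinearIndependent ℝ ![w i, w j]) :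
    ¬ ∀ i, ∃ h : Module.Dual ℝ E, 0 < h (w i) ∧ ∑ j, |h (w j)| ≤ 2 * h (w i) := by
  intro hdom
  obtain ⟨α, β, h2⟩ := exists_eq_smul_add_smul_of_finrank_eq_two hdim (hw 0 1 (by decide)) (w 2)
  obtain ⟨γ, δ, h3⟩ := exists_eq_smul_add_smul_of_finrank_eq_two hdim (hw 0 1 (by decide)) (w 3)
  obtain ⟨c, hc⟩ := exists_abs_eq_of_sum_smul_eq_zero hdim w hw hdom ![α, β, -1, 0] (m := 3)
    (by simp [Fin.sum_univ_four, h2]; abel) (by simp)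
  obtain ⟨c', hc'⟩ := exists_abs_eq_of_sum_smul_eq_zero hdim w hw hdom ![γ, δ, 0, -1] (m := 2)
    (by simp [Fin.sum_univ_four, h3]; abel) (by simp)
  have hα := hc 0 (by decide)
  have hβ := hc 1 (by decide)
  have hc1 := hc 2 (by decide)
  have hγ := hc' 0 (by decide)
  have hδ := hc' 1 (by decide)
  have hc1' := hc' 3 (by decide)
  simp at hα hβ hc1 hγ hδ hc1'
  subst hc1 hc1'
  have hα2 : α * α = 1 := by rw [← abs_mul_abs_self, hα, one_mul]
  have hβ2 : β * β = 1 := by rw [← abs_mul_abs_self, hβ, one_mul]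
  have hγ2 : γ * γ = 1 := by rw [← abs_mul_abs_self, hγ, one_mul]
  have hδ2 : δ * δ = 1 := by rw [← abs_mul_abs_self, hδ, one_mul]
  have hdet : α * δ ≠ β * γ := fun hdet => by
    have hpar : γ • w 2 + (-α) • w 3 = 0 := by
      rw [h2, h3]
      linear_combination (norm := module) (-hdet) • w 1
    have := (LinearIndependent.pair_iff.1 (hw 2 3 (by decide)) _ _ hpar).1
    simp [this] at hγ
  have hneg : α * δ = -(β * γ) := by
    have : (α * δ - β * γ) * (α * δ + β * γ) = 0 := by
      linear_combination δ * δ * hα2 + hδ2 - γ * γ * hβ2 - hγ2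
    rcases mul_eq_zero.1 this with h | h
    · exact absurd (sub_eq_zero.1 h) hdet
    · linarith
  have hcoef : β + α * γ * δ = 0 := by linear_combination γ * hneg - β * hγ2
  have hrel : (2 * α) • w 0 + -w 2 + -((α * γ) • w 3) = 0 := by
    rw [h2, h3]
    linear_combination (norm := module) (-hcoef) • w 1 - (α • hγ2) • w 0
  obtain ⟨c, hc⟩ := exists_abs_eq_of_sum_smul_eq_zero hdim w hw hdom ![2 * α, 0, -1, -(α * γ)]
    (m := 1) (by simpa [Fin.sum_univ_four] using hrel) (by simp)
  have h0 := hc 0 (by decide)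
  rw [← hc 2 (by decide)] at h0
  simp [hα, abs_mul] at h0

end LinearAlgebra

section Normed

variable {E : Type*} [NormedAddCommGroup E] [NormedSpace ℝ E]

/-- Two segments on the unit sphere of a plane whose interiors meet are parallel. -/
theorem not_linearIndependent_of_mem_openSegment (hdim : Module.finrank ℝ E = 2)
    {a b c d x : E} (hab : segment ℝ a b ⊆ {v : E | ‖v‖ = 1})
    (hcd : segment ℝ c d ⊆ {v : E | ‖v‖ = 1})
    (hxab : x ∈ openSegment ℝ a b) (hxcd : x ∈ openSegment ℝ c d) :
    ¬ LinearIndependent ℝ ![b - a, d - c] := by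
  intro hli
  have hx : ‖x‖ = 1 := hab (openSegment_subset_segment _ _ _ hxab)
  obtain ⟨f, hf, hfx⟩ := exists_dual_vector ℝ x (by simp [hx])
  rw [hx] at hfx
  have key : ∀ {u v : E}, segment ℝ u v ⊆ {v : E | ‖v‖ = 1} → x ∈ openSegment ℝ u v →
      f (v - u) = 0 := by
    rintro u v huv ⟨s, t, hs, ht, hst, rfl⟩
    have hu : f u ≤ 1 := by
      simpa [hf, show ‖u‖ = 1 from huv (left_mem_segment _ _ _)] using
        (le_abs_self _).trans (f.le_opNorm u)
    have hv : f v ≤ 1 := by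
      simpa [hf, show ‖v‖ = 1 from huv (right_mem_segment _ _ _)] using
        (le_abs_self _).trans (f.le_opNorm v)
    simp only [map_add, map_smul, smul_eq_mul, RCLike.ofReal_one] at hfx
    have : f u = 1 := by nlinarith
    have : f v = 1 := by nlinarith
    rw [map_sub]
    linarith
  have h0 := dual_eq_zero_of_linearIndependent_pair hdim hli f.toLinearMap (key hab hxab)
    (key hcd hxcd)
  have : f x = 0 := LinearMap.congr_fun h0 x
  rw [this] at hfx
  simp at hfx

/-- On either side of a diameter through `p`, a unit vector is determined by its value under a
functional that attains its norm at `p`. -/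
theorem eq_of_dual_eq_of_pos {h k : Module.Dual ℝ E} {p : E} (hp : ‖p‖ = 1) (hhp : h p = 1)
    (hkp : k p = 0) (hhk : ∀ x, h x = 0 → k x = 0 → x = 0) {x y : E} (hx : ‖x‖ = 1)
    (hy : ‖y‖ = 1) (hxy : h x = h y) (hlt : |h x| < 1) (hkx : 0 < k x) (hky : 0 < k y) :
    x = y := by
  wlog hle : k y ≤ k x generalizing x y
  · exact (this hy hx hxy.symm (hxy ▸ hlt) hky hkx (le_of_not_ge hle)).symm
  rcases hle.eq_or_lt with heq | hlt'
  · exact sub_eq_zero.1 (hhk _ (by simp [hxy]) (by simp [heq]))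
  exfalso
  set r := k y / k x with hr
  have hr0 : 0 < r := div_pos hky hkx
  have hr1 : r < 1 := (div_lt_one hkx).2 hlt'
  have hyc : y = ((1 - r) * h x) • p + r • x := by
    refine sub_eq_zero.1 (hhk _ ?_ ?_)
    · simp [hhp, ← hxy]
      ring
    · simp only [map_sub, map_add, map_smul, hkp, smul_eq_mul, hr]
      field_simp
      ring
  have : ‖y‖ ≤ (1 - r) * |h x| + r := by
    rw [hyc]
    refine (norm_add_le _ _).trans_eq ?_
    rw [norm_smul, norm_smul, hp, hx, Real.norm_eq_abs, Real.norm_eq_abs, abs_mul,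
      abs_of_pos hr0, abs_of_pos (sub_pos.2 hr1), mul_one, mul_one]
  nlinarith

/-- Up to reversing and negating it, a segment on the unit sphere along which `h` is not constant
lies on the positive side of `k`, with `h` increasing. -/
theorem exists_oriented_segment {h k : Module.Dual ℝ E} {p : E} (hp : ‖p‖ = 1) (hhp : h p = 1)
    (hkp : k p = 0) (hhk : ∀ x, h x = 0 → k x = 0 → x = 0) (hle : ∀ x, |h x| ≤ ‖x‖) {a b : E}
    (hab : segment ℝ a b ⊆ {v : E | ‖v‖ = 1}) :
    ∃ a' b' : E, segment ℝ a' b' ⊆ {v : E | ‖v‖ = 1} ∧ (b' - a' = b - a ∨ b' - a' = -(b - a)) ∧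
      h a' ≤ h b' ∧ (h a' < h b' → ∀ x ∈ openSegment ℝ a' b', 0 < k x) := by
  wlog hmono : h a ≤ h b generalizing a b
  · obtain ⟨a', b', hseg, hdir, h1, h2⟩ :=
      this (segment_symm ℝ a b ▸ hab) (le_of_not_ge hmono)
    refine ⟨a', b', hseg, ?_, h1, h2⟩
    rw [or_comm]
    simpa only [neg_sub] using hdir
  rcases hmono.eq_or_lt with heq | hlt
  · exact ⟨a, b, hab, .inl rfl, hmono, fun hlt => absurd heq hlt.ne⟩
  have ha : ‖a‖ = 1 := hab (left_mem_segment _ _ _)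
  have hb : ‖b‖ = 1 := hab (right_mem_segment _ _ _)
  have hne : ∀ x ∈ openSegment ℝ a b, k x ≠ 0 := by
    intro x hx hkx
    have hxn : ‖x‖ = 1 := hab (openSegment_subset_segment _ _ _ hx)
    have hxp : x = h x • p := sub_eq_zero.1 (hhk _ (by simp [hhp]) (by simp [hkx, hkp]))
    have habs : |h x| = 1 := by
      rw [hxp, norm_smul, hp, mul_one] at hxn
      exact hxn
    have hmem : h x ∈ Set.Ioo (h a) (h b) := by
      rw [← openSegment_eq_Ioo hlt]
      exact image_openSegment ℝ h.toAffineMap a b ▸ Set.mem_image_of_mem h hx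
    have h1 := abs_le.1 ((hle a).trans_eq ha)
    have h2 := abs_le.1 ((hle b).trans_eq hb)
    have : |h x| < 1 := abs_lt.2 ⟨by linarith [hmem.1], by linarith [hmem.2]⟩
    linarith
  have hside : (∀ x ∈ openSegment ℝ a b, 0 < k x) ∨ ∀ x ∈ openSegment ℝ a b, k x < 0 := by
    by_contra! ⟨⟨x, hx, hkx⟩, y, hy, hky⟩
    obtain ⟨z, hz, hkz⟩ := ((convex_openSegment a b).linear_image k).ordConnected.out
      (Set.mem_image_of_mem k hx) (Set.mem_image_of_mem k hy) ⟨hkx, hky⟩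
    exact hne z hz hkz
  rcases hside with hside | hside
  · exact ⟨a, b, hab, .inl rfl, hmono, fun _ => hside⟩
  refine ⟨-b, -a, ?_, .inl (by abel), by simpa using hmono, fun _ x hx => ?_⟩
  · rintro x ⟨s, t, hs, ht, hst, rfl⟩
    have hn : ‖t • a + s • b‖ = 1 := hab ⟨t, s, ht, hs, by linarith, rfl⟩
    change ‖s • -b + t • -a‖ = 1
    rw [← hn, ← norm_neg]
    congr 1
    module
  · obtain ⟨s, t, hs, ht, hst, rfl⟩ := hx
    have := hside _ ⟨t, s, ht, hs, by linarith, rfl⟩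
    simp only [map_add, map_smul, map_neg, smul_eq_mul] at this ⊢
    linarith

/-- The variation of a norm-one functional along pairwise non-parallel segments on the unit sphere
of a plane is at most `2`. -/
theorem sum_abs_dual_le_two (hdim : Module.finrank ℝ E = 2) {ι : Type*} [Fintype ι]
    (a b : ι → E) (hseg : ∀ i, segment ℝ (a i) (b i) ⊆ {v : E | ‖v‖ = 1})
    (hli : ∀ i j, i ≠ j → LinearIndependent ℝ ![b i - a i, b j - a j])
    {h : Module.Dual ℝ E} {p : E} (hp : ‖p‖ = 1) (hhp : h p = 1) (hle : ∀ x, |h x| ≤ ‖x‖) :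
    ∑ i, |h (b i - a i)| ≤ 2 := by
  obtain ⟨k, hkp, hhk⟩ := exists_dual_coordinate hdim h hhp
  choose a' b' hseg' hdir hmono hpos using fun i =>
    exists_oriented_segment hp hhp hkp hhk hle (hseg i)
  have ha' : ∀ i, |h (a' i)| ≤ 1 := fun i => (hle _).trans_eq (hseg' i (left_mem_segment _ _ _))
  have hb' : ∀ i, |h (b' i)| ≤ 1 := fun i => (hle _).trans_eq (hseg' i (right_mem_segment _ _ _))
  have hli' : ∀ i j, i ≠ j → LinearIndependent ℝ ![b' i - a' i, b' j - a' j] := by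
    intro i j hij
    have := hli i j hij
    rcases hdir i with hi | hi <;> rcases hdir j with hj | hj <;> rw [hi, hj] <;>
      simpa only [LinearIndependent.pair_neg_left_iff, LinearIndependent.pair_neg_right_iff]
  have hpre : ∀ i, ∀ t ∈ Set.Ioo (h (a' i)) (h (b' i)),
      ∃ x ∈ openSegment ℝ (a' i) (b' i), h x = t := by
    intro i t ht
    rw [← openSegment_eq_Ioo (ht.1.trans ht.2)] at ht
    change t ∈ openSegment ℝ (h.toAffineMap (a' i)) (h.toAffineMap (b' i)) at ht
    rwa [← image_openSegment] at ht
  have hsum := sum_length_le_two_of_pairwise_disjoint (fun i => h (a' i)) (fun i => h (b' i)) hmono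
    (fun i => (abs_le.1 (ha' i)).1) (fun i => (abs_le.1 (hb' i)).2) fun i j hij => by
      refine Set.disjoint_left.2 fun t hti htj => ?_
      obtain ⟨x, hx, hxt⟩ := hpre i t hti
      obtain ⟨y, hy, hyt⟩ := hpre j t htj
      have hlt : |h x| < 1 := by
        rw [hxt, abs_lt]
        exact ⟨(abs_le.1 (ha' i)).1.trans_lt hti.1, hti.2.trans_le (abs_le.1 (hb' i)).2⟩
      have hxy : x = y := eq_of_dual_eq_of_pos hp hhp hkp hhk
        (hseg' i (openSegment_subset_segment _ _ _ hx))
        (hseg' j (openSegment_subset_segment _ _ _ hy)) (hxt.trans hyt.symm) hlt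
        (hpos i (hti.1.trans hti.2) x hx) (hpos j (htj.1.trans htj.2) y hy)
      exact not_linearIndependent_of_mem_openSegment hdim (hseg' i) (hseg' j) hx (hxy ▸ hy)
        (hli' i j hij)
  refine (Finset.sum_le_sum fun i _ => ?_).trans hsum
  have habs : |h (b i - a i)| = |h (b' i - a' i)| := by
    rcases hdir i with hi | hi <;> simp only [hi, map_neg, abs_neg]
  rw [habs, map_sub, abs_of_nonneg (sub_nonneg.2 (hmono i))]

end Normed

theorem at_most_three_pairs_of_long_segments_on_unit_circle
    {E : Type*} [NormedAddCommGroup E] [NormedSpace ℝ E]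
    (hdim : Module.finrank ℝ E = 2)
    (a b : Fin 4 → E)
    (hseg : ∀ i, segment ℝ (a i) (b i) ⊆ {v : E | ‖v‖ = 1})
    (hlen : ∀ i, 1 ≤ ‖b i - a i‖) :
    ∃ i j : Fin 4, i ≠ j ∧ ¬ LinearIndependent ℝ ![b i - a i, b j - a j] := by
  by_contra! hli
  refine not_forall_exists_dual_dominant hdim (fun i => b i - a i) hli fun i => ?_
  have hpos : 0 < ‖b i - a i‖ := one_pos.trans_le (hlen i)
  obtain ⟨h, hh, hhi⟩ := exists_dual_vector ℝ (b i - a i) hpos.ne'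
  replace hhi : h (b i - a i) = ‖b i - a i‖ := hhi
  refine ⟨h.toLinearMap, hhi.symm ▸ hpos, ?_⟩
  have hsum := sum_abs_dual_le_two hdim a b hseg hli (h := h.toLinearMap)
    (p := ‖b i - a i‖⁻¹ • (b i - a i))
    (by rw [norm_smul, norm_inv, norm_norm, inv_mul_cancel₀ hpos.ne'])
    (by
      change h _ = 1
      rw [map_smul, smul_eq_mul, hhi, inv_mul_cancel₀ hpos.ne'])
    (fun x => by simpa [hh] using h.le_opNorm x)
  refine hsum.trans ?_
  change 2 ≤ 2 * h (b i - a i)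
  rw [hhi]
  linarith [hlen i]
end

section
/- Let E be a two-dimensional real normed vector space and suppose the unit sphere of E contains a closed segment [a, b] with ‖a − b‖ = 2. Then the closed unit ball of E is a parallelogram: there exist linearly independent vectors u, v ∈ E such that the closed unit ball equals the convex hull of {u, v, −u, −v}. -/
/-- If the segment joining `a` and `b` lies in the unit sphere and `‖a - b‖ = 2`, then the norm is
the `ℓ¹` norm in the coordinates given by `a` and `b`. -/
theorem norm_smul_add_smul_of_segment_subset_sphere
    {E : Type*} [NormedAddCommGroup E] [NormedSpace ℝ E] {a b : E}
    (hseg : segment ℝ a b ⊆ {v : E | ‖v‖ = 1}) (hlen : ‖a - b‖ = 2) (s t : ℝ) :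
    ‖s • a + t • b‖ = |s| + |t| := by
  have ha : ‖a‖ = 1 := hseg (left_mem_segment ℝ a b)
  have hb : ‖b‖ = 1 := hseg (right_mem_segment ℝ a b)
  have same_sign : ∀ s t : ℝ, 0 ≤ s → 0 ≤ t → ‖s • a + t • b‖ = s + t := by
    intro s t hs ht
    rcases (add_nonneg hs ht).eq_or_lt with h | h
    · obtain rfl : s = 0 := by linarith
      obtain rfl : t = 0 := by linarith
      simp
    · have hmem : (s / (s + t)) • a + (t / (s + t)) • b ∈ segment ℝ a b :=
        ⟨_, _, by positivity, by positivity, by field_simp, rfl⟩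
      have hnorm : ‖(s / (s + t)) • a + (t / (s + t)) • b‖ = 1 := hseg hmem
      have heq : s • a + t • b = (s + t) • ((s / (s + t)) • a + (t / (s + t)) • b) := by
        rw [smul_add, smul_smul, smul_smul, mul_div_cancel₀ _ h.ne', mul_div_cancel₀ _ h.ne']
      rw [heq, norm_smul, hnorm, mul_one, Real.norm_of_nonneg h.le]
  have opposite_sign : ∀ s t : ℝ, 0 ≤ s → 0 ≤ t → ‖s • a - t • b‖ = s + t := by
    intro s t hs ht
    apply le_antisymm
    · simpa [norm_smul, ha, hb, abs_of_nonneg hs, abs_of_nonneg ht] using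
        norm_sub_le (s • a) (t • b)
    · rcases le_total t s with h | h
      · have htri := norm_sub_le (s • a - t • b) ((s - t) • b)
        rw [show s • a - t • b - (s - t) • b = s • (a - b) by module, norm_smul, norm_smul,
          hlen, hb, Real.norm_of_nonneg hs, Real.norm_of_nonneg (sub_nonneg.2 h)] at htri
        linarith
      · have htri := norm_add_le (s • a - t • b) ((t - s) • a)
        rw [show s • a - t • b + (t - s) • a = t • (a - b) by module, norm_smul, norm_smul,
          hlen, ha, Real.norm_of_nonneg ht, Real.norm_of_nonneg (sub_nonneg.2 h)] at htri
        linarith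
  rcases le_total 0 s with hs | hs <;> rcases le_total 0 t with ht | ht
  · rw [same_sign s t hs ht, abs_of_nonneg hs, abs_of_nonneg ht]
  · rw [show s • a + t • b = s • a - (-t) • b by module,
      opposite_sign s (-t) hs (neg_nonneg.2 ht), abs_of_nonneg hs, abs_of_nonpos ht]
  · rw [show s • a + t • b = -((-s) • a - t • b) by module, norm_neg,
      opposite_sign (-s) t (neg_nonneg.2 hs) ht, abs_of_nonpos hs, abs_of_nonneg ht]
  · rw [show s • a + t • b = -((-s) • a + (-t) • b) by module, norm_neg,
      same_sign (-s) (-t) (neg_nonneg.2 hs) (neg_nonneg.2 ht), abs_of_nonpos hs,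
      abs_of_nonpos ht]

/-- A point whose coordinates satisfy `|s| + |t| ≤ 1` lies in the parallelogram with vertices
`±u` and `±v`. -/
theorem smul_add_smul_mem_convexHull_of_abs_add_abs_le_one
    {E : Type*} [AddCommGroup E] [Module ℝ E] (u v : E) {s t : ℝ} (h : |s| + |t| ≤ 1) :
    s • u + t • v ∈ convexHull ℝ {u, v, -u, -v} := by
  have hconv : Convex ℝ (convexHull ℝ {u, v, -u, -v}) := convex_convexHull ℝ _
  have hu : u ∈ convexHull ℝ {u, v, -u, -v} := subset_convexHull ℝ _ (by simp)
  have hv : v ∈ convexHull ℝ {u, v, -u, -v} := subset_convexHull ℝ _ (by simp)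
  have hu' : -u ∈ convexHull ℝ {u, v, -u, -v} := subset_convexHull ℝ _ (by simp)
  have hv' : -v ∈ convexHull ℝ {u, v, -u, -v} := subset_convexHull ℝ _ (by simp)
  have hzero : (0 : E) ∈ convexHull ℝ {u, v, -u, -v} := by
    have := hconv hu hu' (a := 1 / 2) (b := 1 / 2) (by norm_num) (by norm_num) (by norm_num)
    simpa using this
  have comb : ∀ p ∈ convexHull ℝ {u, v, -u, -v}, ∀ q ∈ convexHull ℝ {u, v, -u, -v},
      |s| • p + |t| • q ∈ convexHull ℝ {u, v, -u, -v} := by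
    intro p hp q hq
    have hsum := hconv.sum_mem (t := Finset.univ) (w := ![|s|, |t|, 1 - |s| - |t|])
      (z := ![p, q, 0])
      (by
        intro i _
        fin_cases i
        · exact abs_nonneg s
        · exact abs_nonneg t
        · change 0 ≤ 1 - |s| - |t|
          linarith)
      (by simp [Fin.sum_univ_three])
      (by
        intro i _
        fin_cases i
        · exact hp
        · exact hq
        · exact hzero)
    simpa [Fin.sum_univ_three] using hsum
  rcases abs_choice s with hs | hs <;> rcases abs_choice t with ht | ht <;>
    rw [hs, ht] at comb
  · exact comb u hu v hv
  · simpa using comb u hu (-v) hv'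
  · simpa using comb (-u) hu' v hv
  · simpa using comb (-u) hu' (-v) hv'

theorem segment_of_length_two_implies_rectilinear
    {E : Type*} [NormedAddCommGroup E] [NormedSpace ℝ E]
    (hdim : Module.finrank ℝ E = 2)
    (a b : E) (hseg : segment ℝ a b ⊆ {v : E | ‖v‖ = 1}) (hlen : ‖a - b‖ = 2) :
    ∃ u v : E, LinearIndependent ℝ ![u, v] ∧
      Metric.closedBall (0 : E) 1 = convexHull ℝ {u, v, -u, -v} := by
  have hnorm := norm_smul_add_smul_of_segment_subset_sphere hseg hlen
  have hli : LinearIndependent ℝ ![a, b] := by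
    rw [LinearIndependent.pair_iff]
    intro s t hst
    have h := hnorm s t
    rw [hst, norm_zero] at h
    exact ⟨abs_eq_zero.1 (by linarith [abs_nonneg s, abs_nonneg t]),
      abs_eq_zero.1 (by linarith [abs_nonneg s, abs_nonneg t])⟩
  refine ⟨a, b, hli, Set.Subset.antisymm ?_ ?_⟩
  · intro x hx
    have hspan : Submodule.span ℝ (Set.range ![a, b]) = ⊤ :=
      hli.span_eq_top_of_card_eq_finrank (by simp [hdim])
    have hmem : x ∈ Submodule.span ℝ {a, b} := by
      rw [Matrix.range_cons_cons_empty] at hspan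
      exact hspan ▸ Submodule.mem_top
    obtain ⟨s, t, rfl⟩ := Submodule.mem_span_pair.1 hmem
    rw [mem_closedBall_zero_iff, hnorm] at hx
    exact smul_add_smul_mem_convexHull_of_abs_add_abs_le_one a b hx
  · have ha : ‖a‖ = 1 := hseg (left_mem_segment ℝ a b)
    have hb : ‖b‖ = 1 := hseg (right_mem_segment ℝ a b)
    apply convexHull_min _ (convex_closedBall 0 1)
    rintro x (rfl | rfl | rfl | rfl) <;> simp [ha, hb]
end

section
/- Let E be a two-dimensional real normed vector space, and let R : E → E be the radial projection onto the closed unit ball, defined by R(x) = x if ‖x‖ ≤ 1 and R(x) = ‖x‖⁻¹ • x if ‖x‖ > 1. Then the following are equivalent: (1) E is a Radon plane, i.e., normality is symmetric: for all nonzero x, y ∈ E, if ‖x‖ ≤ ‖x + t•y‖ for all t ∈ ℝ, then ‖y‖ ≤ ‖y + t•x‖ for all t ∈ ℝ; (2) R is non-expansive: ‖R(x) − R(y)‖ ≤ ‖x − y‖ for all x, y ∈ E. -/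
/-- If normality is symmetric and `b + d` lies in the ball of radius `‖b‖`, then moving from `d`
in the direction `-b` does not decrease the norm. -/
theorem norm_le_norm_sub_smul_of_symmetric_normality
    {E : Type*} [NormedAddCommGroup E] [NormedSpace ℝ E]
    (hsymm : ∀ x y : E, x ≠ 0 → y ≠ 0 →
      (∀ t : ℝ, ‖x‖ ≤ ‖x + t • y‖) → (∀ t : ℝ, ‖y‖ ≤ ‖y + t • x‖))
    {b d : E} (hbd : ‖b + d‖ ≤ ‖b‖) {s : ℝ} (hs : 0 ≤ s) : ‖d‖ ≤ ‖d - s • b‖ := by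
  rcases eq_or_ne d 0 with rfl | hd
  · simp
  rcases eq_or_ne b 0 with rfl | hb
  · simp
  have hd' : 0 < ‖d‖ := norm_pos_iff.2 hd
  obtain ⟨g, hg, hgd⟩ := exists_dual_vector ℝ d hd'.ne'
  have hgd : g d = ‖d‖ := by simpa using hgd
  have hle : ∀ z, g z ≤ ‖z‖ := fun z => by
    have h := g.le_opNorm z
    rw [hg, one_mul] at h
    exact (le_abs_self _).trans h
  rcases le_or_gt (g b) 0 with hgb | hgb
  · have h := hle (d - s • b)
    rw [map_sub, map_smul, hgd, smul_eq_mul] at h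
    nlinarith
  obtain ⟨β, hβ⟩ : ∃ β, β = g b / ‖d‖ := ⟨_, rfl⟩
  have hβ_pos : 0 < β := hβ ▸ div_pos hgb hd'
  obtain ⟨x, hx⟩ : ∃ x, x = b - β • d := ⟨_, rfl⟩
  have hgx : g x = 0 := by
    rw [hx, map_sub, map_smul, hgd, hβ, smul_eq_mul, div_mul_cancel₀ _ hd'.ne', sub_self]
  have hx_normal : ∀ t : ℝ, ‖x‖ ≤ ‖x + t • d‖ := by
    rcases eq_or_ne x 0 with hx0 | hx0
    · simp [hx0]
    · refine hsymm d x hd hx0 fun t => ?_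
      simpa [hgx, hgd] using hle (d + t • x)
  have hconvex : (β + 1) * ‖b‖ ≤ ‖x‖ + β * ‖b + d‖ := by
    calc (β + 1) * ‖b‖ = ‖(β + 1) • b‖ := by
          rw [norm_smul, Real.norm_of_nonneg (by positivity)]
      _ = ‖x + β • (b + d)‖ := by
          rw [hx]
          congr 1
          module
      _ ≤ ‖x‖ + ‖β • (b + d)‖ := norm_add_le _ _
      _ = ‖x‖ + β * ‖b + d‖ := by rw [norm_smul, Real.norm_of_nonneg hβ_pos.le]
  have hbx : ‖b‖ ≤ ‖x‖ := by nlinarith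
  have h := hsymm b d hb hd (fun t => by
    have h := hx_normal (t + β)
    rw [show x + (t + β) • d = b + t • d by rw [hx]; module] at h
    exact hbx.trans h) (-s)
  rwa [neg_smul, ← sub_eq_add_neg] at h

/-- If normality is symmetric, then pulling `v` radially back to the sphere of radius `r` does not
increase its distance to a point of the ball of radius `r`. -/
theorem norm_sub_radial_le_of_symmetric_normality
    {E : Type*} [NormedAddCommGroup E] [NormedSpace ℝ E]
    (hsymm : ∀ x y : E, x ≠ 0 → y ≠ 0 →
      (∀ t : ℝ, ‖x‖ ≤ ‖x + t • y‖) → (∀ t : ℝ, ‖y‖ ≤ ‖y + t • x‖))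
    {u v : E} {r : ℝ} (hr : 0 < r) (hu : ‖u‖ ≤ r) (hv : r ≤ ‖v‖) :
    ‖u - (r * ‖v‖⁻¹) • v‖ ≤ ‖u - v‖ := by
  have hv_pos : 0 < ‖v‖ := hr.trans_le hv
  have hnorm : ‖(r * ‖v‖⁻¹) • v‖ = r := by
    rw [norm_smul, Real.norm_of_nonneg (by positivity), inv_mul_cancel_right₀ hv_pos.ne']
  have h := norm_le_norm_sub_smul_of_symmetric_normality hsymm
    (b := (r * ‖v‖⁻¹) • v) (d := u - (r * ‖v‖⁻¹) • v) (s := ‖v‖ / r - 1)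
    (by rwa [add_sub_cancel, hnorm]) (sub_nonneg.2 ((one_le_div hr).2 hv))
  have hscale : (‖v‖ / r) * (r * ‖v‖⁻¹) = 1 := by field_simp
  rwa [sub_smul, one_smul, smul_smul, hscale, one_smul, sub_sub, add_sub_cancel] at h

/-- If the radial projection onto the unit ball is non-expansive and `‖b + d‖ ≤ ‖b‖`, then moving
from `d` in the direction `-b` does not decrease the norm. -/
theorem norm_le_norm_sub_smul_of_radial_projection_nonexpansive
    {E : Type*} [NormedAddCommGroup E] [NormedSpace ℝ E]
    {R : E → E} (hR : ∀ x : E, R x = if ‖x‖ ≤ 1 then x else ‖x‖⁻¹ • x)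
    (hnonexp : ∀ x y : E, ‖R x - R y‖ ≤ ‖x - y‖)
    {b d : E} (hb : b ≠ 0) (hbd : ‖b + d‖ ≤ ‖b‖) {s : ℝ} (hs : 0 ≤ s) :
    ‖d‖ ≤ ‖d - s • b‖ := by
  rcases hs.eq_or_lt with rfl | hs
  · simp
  have hb_pos : 0 < ‖b‖ := norm_pos_iff.2 hb
  have hinv : ‖‖b‖⁻¹‖ = ‖b‖⁻¹ := Real.norm_of_nonneg (by positivity)
  have hRu : R (‖b‖⁻¹ • (b + d)) = ‖b‖⁻¹ • (b + d) := by
    rw [hR, if_pos]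
    rw [norm_smul, hinv]
    exact (inv_mul_le_one₀ hb_pos).2 hbd
  have hnorm : ‖(1 + s) • ‖b‖⁻¹ • b‖ = 1 + s := by
    rw [norm_smul, norm_smul, hinv, inv_mul_cancel₀ hb_pos.ne', mul_one,
      Real.norm_of_nonneg (by positivity)]
  have hRv : R ((1 + s) • ‖b‖⁻¹ • b) = ‖b‖⁻¹ • b := by
    rw [hR, hnorm, if_neg (by linarith), inv_smul_smul₀ (by positivity)]
  have h := hnonexp (‖b‖⁻¹ • (b + d)) ((1 + s) • ‖b‖⁻¹ • b)
  rw [hRu, hRv, ← smul_sub, add_sub_cancel_left,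
    show ‖b‖⁻¹ • (b + d) - (1 + s) • ‖b‖⁻¹ • b = ‖b‖⁻¹ • (d - s • b) by module,
    norm_smul, norm_smul] at h
  exact le_of_mul_le_mul_left h (by rw [hinv]; positivity)

theorem radon_plane_iff_radial_projection_nonexpansive
    {E : Type*} [NormedAddCommGroup E] [NormedSpace ℝ E]
    (hdim : Module.finrank ℝ E = 2)
    (R : E → E) (hR : ∀ x : E, R x = if ‖x‖ ≤ 1 then x else ‖x‖⁻¹ • x) :
    ((∀ x y : E, x ≠ 0 → y ≠ 0 →
        (∀ t : ℝ, ‖x‖ ≤ ‖x + t • y‖) → (∀ t : ℝ, ‖y‖ ≤ ‖y + t • x‖)) ↔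
      (∀ x y : E, ‖R x - R y‖ ≤ ‖x - y‖)) := by
  constructor
  · intro hsymm u v
    wlog huv : ‖u‖ ≤ ‖v‖ generalizing u v
    · rw [norm_sub_rev, norm_sub_rev u]
      exact this v u (le_of_not_ge huv)
    rw [hR u, hR v]
    split_ifs with hu hv hv
    · rfl
    · simpa using norm_sub_radial_le_of_symmetric_normality hsymm one_pos hu (le_of_not_ge hv)
    · exact absurd (huv.trans hv) hu
    · have hu_gt : 1 < ‖u‖ := not_le.1 hu
      have hu_pos : 0 < ‖u‖ := one_pos.trans hu_gt
      refine le_trans ?_ (norm_sub_radial_le_of_symmetric_normality hsymm hu_pos le_rfl huv)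
      have hfactor : ‖u‖⁻¹ • u - ‖v‖⁻¹ • v = ‖u‖⁻¹ • (u - (‖u‖ * ‖v‖⁻¹) • v) := by
        rw [smul_sub, smul_smul ‖u‖⁻¹ (‖u‖ * ‖v‖⁻¹), inv_mul_cancel_left₀ hu_pos.ne']
      rw [hfactor, norm_smul, norm_inv, norm_norm]
      exact mul_le_of_le_one_left (norm_nonneg _) (inv_le_one_of_one_le₀ hu_gt.le)
  · intro hnonexp x y hx _ hxy σ
    have hpos : ∀ z : E, (∀ t : ℝ, ‖x‖ ≤ ‖x + t • z‖) → ∀ τ : ℝ, 0 ≤ τ → ‖z‖ ≤ ‖z + τ • x‖ := by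
      intro z hz τ hτ
      have hbound : ∀ t : ℝ, 0 < t → ‖z‖ ≤ ‖z + τ • (x + t • z)‖ := by
        intro t ht
        have hb : x + t • z ≠ 0 :=
          norm_pos_iff.1 ((norm_pos_iff.2 hx).trans_le (hz t))
        have h := norm_le_norm_sub_smul_of_radial_projection_nonexpansive hR hnonexp
          (b := x + t • z) (d := -(t • z)) hb (by simpa using hz t) (mul_nonneg ht.le hτ)
        rw [show -(t • z) - (t * τ) • (x + t • z) = -(t • (z + τ • (x + t • z))) by module,
          norm_neg, norm_neg, norm_smul, norm_smul] at h
        exact le_of_mul_le_mul_left h (norm_pos_iff.2 ht.ne')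
      have hcont : Continuous fun t : ℝ => ‖z + τ • (x + t • z)‖ := by fun_prop
      have hlim := (hcont.tendsto 0).mono_left (nhdsWithin_le_nhds (s := Set.Ioi 0))
      simpa using ge_of_tendsto hlim (Filter.eventually_of_mem self_mem_nhdsWithin hbound)
    rcases le_total 0 σ with hσ | hσ
    · exact hpos y hxy σ hσ
    · have h := hpos (-y) (fun t => by simpa using hxy (-t)) (-σ) (neg_nonneg.2 hσ)
      rwa [neg_smul, ← neg_add, norm_neg, norm_neg] at h
end

section
/- Let E be a two-dimensional real normed vector space. Then E is smooth — i.e., for every x ∈ E with ‖x‖ = 1 there is a unique continuous linear functional f : E → ℝ with ‖f‖ = 1 and f(x) = 1 — if and only if through any three non-collinear points there is at least one circumscribed circle; that is, if and only if for all p₁, p₂, p₃ ∈ E with {p₁, p₂, p₃} not collinear, there exist c ∈ E and r ∈ ℝ with ‖p₁ − c‖ = ‖p₂ − c‖ = ‖p₃ − c‖ = r. -/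
open Filter Topology

section Smoothness

variable {E : Type*} [NormedAddCommGroup E] [NormedSpace ℝ E]

lemma norm_eq_one_of_norm_le_one_of_apply_eq_one {f : E →L[ℝ] ℝ} {u : E} (hf : ‖f‖ ≤ 1)
    (hu : ‖u‖ = 1) (h : f u = 1) : ‖f‖ = 1 := by
  refine le_antisymm hf ?_
  have := f.le_opNorm u
  rw [h, hu] at this
  simpa using this

/-- If the points `c n` escape to infinity in the direction of a smooth point `u` of the unit
sphere and are never farther from `q` than from `p`, then the functional norming `u` is
nonnegative on `q - p`. -/
lemma norming_functional_nonneg_of_tendsto_direction [FiniteDimensional ℝ E]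
    {u : E} (hu : ‖u‖ = 1) {f : E →L[ℝ] ℝ}
    (hf : ∀ g : E →L[ℝ] ℝ, ‖g‖ = 1 ∧ g u = 1 → g = f) {c : ℕ → E}
    (hc : Tendsto (fun n => ‖c n‖) atTop atTop)
    (hcu : Tendsto (fun n => ‖c n‖⁻¹ • c n) atTop (𝓝 u)) {p q : E}
    (h : ∀ n, ‖c n - q‖ ≤ ‖c n - p‖) : 0 ≤ f (q - p) := by
  have hex : ∀ n, ∃ g : E →L[ℝ] ℝ, ‖g‖ ≤ 1 ∧ g (c n - p) = ‖c n - p‖ := fun n => by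
    obtain ⟨g, hg, hgc⟩ := exists_dual_vector'' ℝ (c n - p)
    exact ⟨g, hg, by simpa using hgc⟩
  choose g hg hgc using hex
  have : ProperSpace (E →L[ℝ] ℝ) := FiniteDimensional.proper ℝ _
  obtain ⟨F, hF, k, hk, hkF⟩ := (isCompact_closedBall (0 : E →L[ℝ] ℝ) 1).tendsto_subseq
    (x := g) (fun n => by simpa using hg n)
  have happly {v : ℕ → E} {w : E} (hv : Tendsto v atTop (𝓝 w)) :
      Tendsto (fun n => g (k n) (v n)) atTop (𝓝 (F w)) :=
    (isBoundedBilinearMap_apply.continuous.tendsto (F, w)).comp (hkF.prodMk_nhds hv)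
  have hF1 : ‖F‖ ≤ 1 := by simpa using hF
  have hinv : Tendsto (fun n => ‖c n‖⁻¹) atTop (𝓝 0) := tendsto_inv_atTop_zero.comp hc
  have hdir : Tendsto (fun n => ‖c n‖⁻¹ • (c n - p)) atTop (𝓝 u) := by
    simpa [smul_sub] using hcu.sub (hinv.smul_const p)
  have hFu : F u = 1 := by
    have h1 : Tendsto (fun n => g (k n) (‖c (k n)‖⁻¹ • (c (k n) - p))) atTop (𝓝 (F u)) :=
      happly (hdir.comp hk.tendsto_atTop)
    have h2 : Tendsto (fun n => ‖‖c (k n)‖⁻¹ • (c (k n) - p)‖) atTop (𝓝 ‖u‖) :=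
      (hdir.comp hk.tendsto_atTop).norm
    rw [← hu]
    refine tendsto_nhds_unique h1 (h2.congr fun n => ?_)
    rw [map_smul, hgc, norm_smul, norm_inv, norm_norm, smul_eq_mul]
  have hFf : F = f := hf F ⟨norm_eq_one_of_norm_le_one_of_apply_eq_one hF1 hu hFu, hFu⟩
  rw [← hFf]
  refine ge_of_tendsto' (happly (tendsto_const_nhds (x := q - p))) fun n => ?_
  have h1 : g (k n) (c (k n) - q) ≤ ‖c (k n) - q‖ :=
    (le_abs_self _).trans ((g (k n)).le_of_opNorm_le (hg _) _ |>.trans (by simp))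
  have h2 : g (k n) (q - p) = g (k n) (c (k n) - p) - g (k n) (c (k n) - q) := by
    rw [← map_sub]; congr 1; abel
  have h3 := hgc (k n)
  have h4 := h (k n)
  linarith

/-- The difference of the distances from `x • d + s • e` to `0` and to `d`. -/
def bisectorDefect (d e : E) (s x : ℝ) : ℝ := ‖x • d + s • e‖ - ‖(x - 1) • d + s • e‖

lemma continuous_bisectorDefect (d e : E) :
    Continuous fun z : ℝ × ℝ => bisectorDefect d e z.2 z.1 := by
  unfold bisectorDefect
  fun_prop

lemma monotone_bisectorDefect (d e : E) (s : ℝ) : Monotone (bisectorDefect d e s) := by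
  intro x y hxy
  have hT : 0 < y - x + 1 := by linarith
  have key : ∀ a b c : E, ∀ α β : ℝ, 0 ≤ α → 0 ≤ β → (y - x + 1) • a = α • b + β • c →
      (y - x + 1) * ‖a‖ ≤ α * ‖b‖ + β * ‖c‖ := by
    intro a b c α β hα hβ h
    calc (y - x + 1) * ‖a‖ = ‖(y - x + 1) • a‖ := by
          rw [norm_smul, Real.norm_of_nonneg hT.le]
      _ ≤ ‖α • b‖ + ‖β • c‖ := h ▸ norm_add_le _ _
      _ = α * ‖b‖ + β * ‖c‖ := by
          rw [norm_smul, norm_smul, Real.norm_of_nonneg hα, Real.norm_of_nonneg hβ]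
  have h1 := key (x • d + s • e) ((x - 1) • d + s • e) (y • d + s • e) (y - x) 1
    (by linarith) zero_le_one (by module)
  have h2 := key ((y - 1) • d + s • e) ((x - 1) • d + s • e) (y • d + s • e) 1 (y - x)
    zero_le_one (by linarith) (by module)
  unfold bisectorDefect
  refine le_of_mul_le_mul_left ?_ hT
  linarith

lemma bisectorDefect_one_sub_neg (d e : E) (s x : ℝ) :
    bisectorDefect d e (-s) (1 - x) = -bisectorDefect d e s x := by
  unfold bisectorDefect
  rw [← norm_neg (x • d + s • e), ← norm_neg ((x - 1) • d + s • e), neg_sub]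
  congr 2 <;> module

lemma bisectorDefect_pos {d : E} (hd : d ≠ 0) (e : E) {s x : ℝ}
    (hx : 1 + 2 * (|s| * ‖e‖) / ‖d‖ < x) : 0 < bisectorDefect d e s x := by
  have hd' : 0 < ‖d‖ := norm_pos_iff.2 hd
  have hx1 : 1 < x := lt_of_le_of_lt (by simp; positivity) hx
  have hx2 : 2 * (|s| * ‖e‖) < x * ‖d‖ := by
    rw [← div_lt_iff₀ hd']; linarith
  have h1 : x * ‖(x - 1) • d + s • e‖ ≤ (x - 1) * ‖x • d + s • e‖ + |s| * ‖e‖ := by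
    calc x * ‖(x - 1) • d + s • e‖ = ‖x • ((x - 1) • d + s • e)‖ := by
          rw [norm_smul, Real.norm_of_nonneg (by linarith)]
      _ = ‖(x - 1) • (x • d + s • e) + s • e‖ := by congr 1; module
      _ ≤ ‖(x - 1) • (x • d + s • e)‖ + ‖s • e‖ := norm_add_le _ _
      _ = _ := by
          rw [norm_smul, norm_smul, Real.norm_of_nonneg (by linarith : 0 ≤ x - 1),
            Real.norm_eq_abs]
  have h2 : x * ‖d‖ ≤ ‖x • d + s • e‖ + |s| * ‖e‖ := by
    calc x * ‖d‖ = ‖(x • d + s • e) - s • e‖ := by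
          rw [add_sub_cancel_right, norm_smul, Real.norm_of_nonneg (by linarith)]
      _ ≤ _ := (norm_sub_le _ _).trans_eq (by rw [norm_smul s, Real.norm_eq_abs])
  unfold bisectorDefect
  by_contra! h
  nlinarith

lemma bisectorDefect_neg {d : E} (hd : d ≠ 0) (e : E) {s x : ℝ}
    (hx : x < -(2 * (|s| * ‖e‖) / ‖d‖)) : bisectorDefect d e s x < 0 := by
  have := bisectorDefect_pos hd e (s := -s) (x := 1 - x) (by rw [abs_neg]; linarith)
  rw [bisectorDefect_one_sub_neg] at this
  linarith

lemma exists_bisectorDefect_eq_zero {d : E} (hd : d ≠ 0) (e : E) (s : ℝ) :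
    ∃ x, bisectorDefect d e s x = 0 := by
  have hcont : Continuous (bisectorDefect d e s) :=
    (continuous_bisectorDefect d e).comp (Continuous.prodMk_left s)
  exact mem_range_of_exists_le_of_exists_ge hcont
    ⟨_, (bisectorDefect_neg hd e (sub_one_lt _)).le⟩
    ⟨_, (bisectorDefect_pos hd e (lt_add_one _)).le⟩

lemma isPreconnected_bisector {d : E} (hd : d ≠ 0) (e : E) :
    IsPreconnected {z : ℝ × ℝ | bisectorDefect d e z.2 z.1 = 0} := by
  set Z : Set (ℝ × ℝ) := {z | bisectorDefect d e z.2 z.1 = 0} with hZ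
  have hZc : IsClosed Z := isClosed_eq (continuous_bisectorDefect d e) continuous_const
  let π : Z → ℝ := fun z => z.1.2
  have hπ : Continuous π := by fun_prop
  have hfib : ∀ s, IsConnected (π ⁻¹' {s}) := by
    intro s
    have hord : Set.OrdConnected (bisectorDefect d e s ⁻¹' {0}) :=
      Set.ordConnected_singleton.preimage_mono (monotone_bisectorDefect d e s)
    refine ⟨?_, ?_⟩
    · obtain ⟨x, hx⟩ := exists_bisectorDefect_eq_zero hd e s
      exact ⟨⟨(x, s), hx⟩, rfl⟩
    · rw [← Topology.IsInducing.subtypeVal.isPreconnected_image]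
      have himg : Subtype.val '' (π ⁻¹' {s}) =
          (fun x : ℝ => (x, s)) '' (bisectorDefect d e s ⁻¹' {0}) := by
        ext ⟨x, t⟩
        constructor
        · rintro ⟨⟨⟨x', t'⟩, h⟩, rfl : t' = s, h'⟩
          obtain ⟨rfl, rfl⟩ := Prod.mk.inj h'
          exact ⟨x', h, rfl⟩
        · rintro ⟨x', h, h'⟩
          obtain ⟨rfl, rfl⟩ := Prod.mk.inj h'
          exact ⟨⟨(x', s), h⟩, rfl, rfl⟩
      rw [himg]
      exact hord.isPreconnected.image _ (by fun_prop)
  have hsurj : Function.Surjective π := fun s => (hfib s).nonempty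
  have hprop : IsProperMap π := by
    refine isProperMap_iff_isCompact_preimage.2 ⟨hπ, fun K hK => ?_⟩
    rw [Subtype.isCompact_iff]
    obtain ⟨R, hR⟩ := hK.isBounded.exists_norm_le
    have hR' : ∀ s ∈ K, 2 * (|s| * ‖e‖) / ‖d‖ ≤ 2 * (R * ‖e‖) / ‖d‖ := fun s hs => by
      gcongr
      exact hR s hs
    refine IsCompact.of_isClosed_subset
      ((isCompact_Icc (a := -(2 * (R * ‖e‖) / ‖d‖)) (b := 1 + 2 * (R * ‖e‖) / ‖d‖)).prod hK)
      (hZc.isClosedMap_subtype_val _ (hK.isClosed.preimage hπ)) ?_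
    rintro _ ⟨⟨⟨x, s⟩, hz⟩, hs, rfl⟩
    have hs : s ∈ K := hs
    have hz : bisectorDefect d e s x = 0 := hz
    have := hR' s hs
    refine ⟨⟨?_, ?_⟩, hs⟩
    · by_contra! h
      exact (bisectorDefect_neg hd e (s := s) (x := x) (by simp only at h; linarith)).ne hz
    · by_contra! h
      exact (bisectorDefect_pos hd e (s := s) (x := x) (by simp only at h; linarith)).ne' hz
  have := (hprop.isClosedMap.isQuotientMap hπ hsurj).isCoinducing.isConnected_preimage_of_isClosed
    hfib isClosed_univ isConnected_univ
  rw [Set.preimage_univ] at this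
  exact isPreconnected_iff_preconnectedSpace.2 ⟨this.isPreconnected⟩

/-- In a smooth plane, the bisector of `0` and `d` contains, far out on the side of `e`, points not
farther from `e` than from `0`, and, far out on the other side, points not closer to `e` than
to `0`; the sign `σ` selects the side. -/
lemma exists_bisector_closer [FiniteDimensional ℝ E]
    (hs : ∀ x : E, ‖x‖ = 1 → ∃! f : E →L[ℝ] ℝ, ‖f‖ = 1 ∧ f x = 1)
    {d e : E} (hd : d ≠ 0) (ψ : E →L[ℝ] ℝ) (hψd : ψ d = 0) (hψe : ψ e = 1)
    (hspan : ∀ u : E, ∃ a : ℝ, u = a • d + ψ u • e) {σ : ℝ} (hσ : |σ| = 1) :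
    ∃ z : ℝ × ℝ, bisectorDefect d e z.2 z.1 = 0 ∧
      σ * (‖z.1 • d + z.2 • e - e‖ - ‖z.1 • d + z.2 • e‖) ≤ 0 := by
  by_contra! H
  choose x hx using fun n : ℕ => exists_bisectorDefect_eq_zero hd e (σ * n)
  set c : ℕ → E := fun n => x n • d + (σ * n) • e with hc_def
  have hψc : ∀ n, ψ (c n) = σ * n := fun n => by simp [hc_def, hψd, hψe]
  have hcd : ∀ n, ‖c n - d‖ = ‖c n‖ := fun n => by
    have h := hx n
    unfold bisectorDefect at h
    have h' : c n - d = (x n - 1) • d + (σ * n) • e := by simp only [hc_def]; module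
    rw [h']
    linarith
  have hce : ∀ n, 0 ≤ σ * (‖c n - e‖ - ‖c n‖) := fun n => (H (x n, σ * n) (hx n)).le
  have hψ0 : 0 < ‖ψ‖ := norm_pos_iff.2 (by rintro rfl; simp at hψe)
  have hc : Tendsto (fun n => ‖c n‖) atTop atTop := by
    refine tendsto_atTop_mono (fun n => ?_)
      (tendsto_natCast_atTop_atTop.const_mul_atTop (inv_pos.2 hψ0))
    rw [inv_mul_le_iff₀ hψ0]
    have := ψ.le_opNorm (c n)
    rwa [hψc, norm_mul, Real.norm_eq_abs, hσ, one_mul, Real.norm_natCast] at this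
  have : ProperSpace E := FiniteDimensional.proper ℝ E
  obtain ⟨u, -, k, hk, hku⟩ := (isCompact_closedBall (0 : E) 1).tendsto_subseq
    (x := fun n => ‖c n‖⁻¹ • c n) (fun n => by
      simpa [norm_smul] using inv_mul_le_one)
  have hck := hc.comp hk.tendsto_atTop
  have hu : ‖u‖ = 1 := by
    refine tendsto_nhds_unique hku.norm (tendsto_const_nhds.congr' ?_)
    filter_upwards [hck.eventually_gt_atTop 0] with n hn
    simp only [Function.comp_apply] at hn ⊢
    rw [norm_smul, norm_inv, norm_norm, inv_mul_cancel₀ hn.ne']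
  obtain ⟨f, ⟨-, hfu⟩, hf⟩ := hs u hu
  have hlim : ∀ p q : E, (∀ n, ‖c n - q‖ ≤ ‖c n - p‖) → 0 ≤ f (q - p) := fun p q h =>
    norming_functional_nonneg_of_tendsto_direction hu hf hck hku (fun n => h (k n))
  have hfd : f d = 0 := by
    have h1 := hlim 0 d (fun n => by simpa using (hcd n).le)
    have h2 := hlim d 0 (fun n => by simpa using (hcd n).ge)
    simp only [sub_zero, zero_sub, map_neg] at h1 h2
    linarith
  have hψu : 0 ≤ σ * ψ u := by
    refine ge_of_tendsto' (((ψ.continuous.tendsto u).comp hku).const_mul σ) fun n => ?_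
    simp only [Function.comp_apply, map_smul, hψc, smul_eq_mul]
    have : σ * (‖c (k n)‖⁻¹ * (σ * (k n : ℕ))) = σ ^ 2 * (‖c (k n)‖⁻¹ * (k n : ℕ)) := by ring
    rw [this]
    positivity
  have hfe : σ * f e ≤ 0 := by
    rcases eq_or_eq_neg_of_abs_eq hσ with rfl | rfl
    · have := hlim e 0 (fun n => by simpa using hce n)
      simp only [zero_sub, map_neg] at this
      linarith
    · have := hlim 0 e (fun n => by have := hce n; simp at this ⊢; linarith)
      simp only [sub_zero] at this
      linarith
  obtain ⟨a, ha⟩ := hspan u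
  have h1 : ψ u * f e = 1 := by
    rw [ha] at hfu
    simpa [hfd, hψd, hψe] using hfu
  have h2 : σ ^ 2 = 1 := by rw [← sq_abs, hσ, one_pow]
  nlinarith

lemma exists_equidistant_of_smooth (hdim : Module.finrank ℝ E = 2)
    (hs : ∀ x : E, ‖x‖ = 1 → ∃! f : E →L[ℝ] ℝ, ‖f‖ = 1 ∧ f x = 1)
    {d e : E} (hli : LinearIndependent ℝ ![d, e]) :
    ∃ c : E, ‖c - d‖ = ‖c‖ ∧ ‖c - e‖ = ‖c‖ := by
  have : FiniteDimensional ℝ E := FiniteDimensional.of_finrank_pos (by omega)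
  let b := basisOfLinearIndependentOfCardEqFinrank hli (by simp [hdim])
  have hb0 : b 0 = d := by simp [b]
  have hb1 : b 1 = e := by simp [b]
  let ψ : E →L[ℝ] ℝ := LinearMap.toContinuousLinearMap (b.coord 1)
  have hψd : ψ d = 0 := by simp [ψ, ← hb0]
  have hψe : ψ e = 1 := by simp [ψ, ← hb1]
  have hspan : ∀ u : E, ∃ a : ℝ, u = a • d + ψ u • e := fun u => ⟨b.repr u 0, by
    conv_lhs => rw [← b.sum_repr u]
    rw [Fin.sum_univ_two, hb0, hb1]
    rfl⟩
  have hd : d ≠ 0 := hli.ne_zero 0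
  obtain ⟨z, hz, hz'⟩ := exists_bisector_closer hs hd ψ hψd hψe hspan (σ := 1) (by simp)
  obtain ⟨w, hw, hw'⟩ := exists_bisector_closer hs hd ψ hψd hψe hspan (σ := -1) (by simp)
  obtain ⟨y, hy, hy'⟩ := (isPreconnected_bisector hd e).intermediate_value
    (f := fun z : ℝ × ℝ => ‖z.1 • d + z.2 • e - e‖ - ‖z.1 • d + z.2 • e‖)
    hz hw (by fun_prop) (show (0 : ℝ) ∈ Set.Icc _ _ from ⟨by linarith, by linarith⟩)
  refine ⟨y.1 • d + y.2 • e, ?_, sub_eq_zero.1 hy'⟩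
  have h : y.1 • d + y.2 • e - d = (y.1 - 1) • d + y.2 • e := by module
  rw [h]
  exact (sub_eq_zero.1 hy).symm

lemma linearIndependent_sub_of_not_collinear {p₁ p₂ p₃ : E}
    (h : ¬ Collinear ℝ ({p₁, p₂, p₃} : Set E)) :
    LinearIndependent ℝ ![p₂ - p₁, p₃ - p₁] := by
  rw [LinearIndependent.pair_iff]
  intro s t hst
  by_contra hne
  apply h
  rw [collinear_iff_of_mem (p₀ := p₁) (by simp)]
  by_cases hs : s = 0
  · have ht : t ≠ 0 := fun ht => hne ⟨hs, ht⟩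
    have h3 : p₃ = p₁ := by
      subst hs
      simpa [ht, sub_eq_zero] using hst
    refine ⟨p₂ - p₁, ?_⟩
    simp only [Set.mem_insert_iff, Set.mem_singleton_iff, forall_eq_or_imp, forall_eq]
    exact ⟨⟨0, by simp⟩, ⟨1, by simp⟩, ⟨0, by simp [h3]⟩⟩
  · have h2 : p₂ - p₁ = (-(s⁻¹ * t)) • (p₃ - p₁) := by
      have : s • (p₂ - p₁) = -(t • (p₃ - p₁)) := eq_neg_of_add_eq_zero_left hst
      rw [neg_smul, mul_smul, ← smul_neg, ← this, inv_smul_smul₀ hs]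
    refine ⟨p₃ - p₁, ?_⟩
    simp only [Set.mem_insert_iff, Set.mem_singleton_iff, forall_eq_or_imp, forall_eq]
    exact ⟨⟨0, by simp⟩, ⟨-(s⁻¹ * t), by simp [← h2]⟩, ⟨1, by simp⟩⟩

/-- If `f` and `g` norm the unit vector `x`, and `f d = 1`, `g d = -1`, then the flat triangle
with apex `0` and base points `±d - x / 2` has no circumscribed circle. -/
lemma no_circumscribed_circle_of_two_norming (hdim : Module.finrank ℝ E = 2)
    {x d : E} (hx : ‖x‖ = 1) {f g : E →L[ℝ] ℝ} (hf : ‖f‖ = 1) (hg : ‖g‖ = 1)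
    (hfx : f x = 1) (hgx : g x = 1) (hfd : f d = 1) (hgd : g d = -1) (c : E) (r : ℝ)
    (h₁ : ‖d - (1 / 2 : ℝ) • x - c‖ = r) (h₂ : ‖0 - c‖ = r)
    (h₃ : ‖-d - (1 / 2 : ℝ) • x - c‖ = r) : False := by
  have hli : LinearIndependent ℝ ![x, d] := by
    rw [LinearIndependent.pair_iff]
    intro s t hst
    have h1 := congrArg f hst
    have h2 := congrArg g hst
    simp [hfx, hgx, hfd, hgd] at h1 h2
    constructor <;> linarith
  let b := basisOfLinearIndependentOfCardEqFinrank hli (by simp [hdim])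
  obtain ⟨α, β, hc⟩ : ∃ α β : ℝ, 0 - c = α • x + β • d := ⟨b.repr (0 - c) 0, b.repr (0 - c) 1, by
    conv_lhs => rw [← b.sum_repr (0 - c)]
    rw [Fin.sum_univ_two]
    simp only [b, coe_basisOfLinearIndependentOfCardEqFinrank, Matrix.cons_val_zero,
      Matrix.cons_val_one]⟩
  have e₁ : d - (1 / 2 : ℝ) • x - c = (α - 1 / 2) • x + (β + 1) • d := by
    linear_combination (norm := module) hc
  have e₃ : -d - (1 / 2 : ℝ) • x - c = (α - 1 / 2) • x + (β - 1) • d := by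
    linear_combination (norm := module) hc
  rw [hc] at h₂
  rw [e₁] at h₁
  rw [e₃] at h₃
  have bound : ∀ φ : E →L[ℝ] ℝ, ‖φ‖ ≤ 1 → ∀ v : E, |φ v| ≤ ‖v‖ := fun φ hφ v =>
    (φ.le_of_opNorm_le hφ v).trans_eq (one_mul _)
  have hf₁ := bound f hf.le ((α - 1 / 2) • x + (β + 1) • d)
  have hg₃ := bound g hg.le ((α - 1 / 2) • x + (β - 1) • d)
  have hf₂ := bound f hf.le (α • x + β • d)
  have hg₂ := bound g hg.le (α • x + β • d)
  rw [h₁] at hf₁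
  rw [h₃] at hg₃
  rw [h₂] at hf₂ hg₂
  simp only [map_add, map_smul, hfx, hgx, hfd, hgd, smul_eq_mul, abs_le] at hf₁ hg₃ hf₂ hg₂
  obtain ⟨φ, hφ, hφc⟩ := exists_dual_vector'' ℝ (α • x + β • d)
  have hφ₁ := bound φ hφ ((α - 1 / 2) • x + (β + 1) • d)
  have hφ₃ := bound φ hφ ((α - 1 / 2) • x + (β - 1) • d)
  have hφx := bound φ hφ x
  rw [h₁] at hφ₁
  rw [h₃] at hφ₃
  rw [hx] at hφx
  rw [h₂] at hφc
  simp only [map_add, map_smul, smul_eq_mul, abs_le, RCLike.ofReal_real_eq_id, id_eq]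
    at hφ₁ hφ₃ hφx hφc
  have hd₁ : φ d ≤ 1 / 2 * φ x := by linarith
  have hd₂ : -φ d ≤ 1 / 2 * φ x := by linarith
  have hβ : |β| ≤ r := abs_le.2 ⟨by linarith, by linarith⟩
  have hα : α + |β| ≤ r - 1 / 2 := by
    rcases abs_cases β with h | h <;> linarith
  have hβφ : β * φ d ≤ |β| * (1 / 2 * φ x) :=
    (le_abs_self _).trans (by
      rw [abs_mul]
      exact mul_le_mul_of_nonneg_left (abs_le.2 ⟨by linarith, hd₁⟩) (abs_nonneg β))
  have hβ0 := abs_nonneg β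
  have hr : 0 ≤ r := hβ0.trans hβ
  have hφ0 : 0 ≤ φ x := by linarith
  nlinarith [mul_nonneg hβ0 hφ0, mul_nonneg hr (sub_nonneg.2 hφx.2)]

end Smoothness

theorem smooth_iff_circumscribed_circle_exists
    {E : Type*} [NormedAddCommGroup E] [NormedSpace ℝ E]
    (hdim : Module.finrank ℝ E = 2) :
    (∀ x : E, ‖x‖ = 1 → ∃! f : E →L[ℝ] ℝ, ‖f‖ = 1 ∧ f x = 1) ↔
      (∀ p₁ p₂ p₃ : E, ¬ Collinear ℝ ({p₁, p₂, p₃} : Set E) →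
        ∃ (c : E) (r : ℝ), ‖p₁ - c‖ = r ∧ ‖p₂ - c‖ = r ∧ ‖p₃ - c‖ = r) := by
  constructor
  · intro hs p₁ p₂ p₃ h
    obtain ⟨c, h2, h3⟩ :=
      exists_equidistant_of_smooth hdim hs (linearIndependent_sub_of_not_collinear h)
    refine ⟨p₁ + c, ‖c‖, by simp, ?_, ?_⟩
    · rw [← h2, ← norm_neg]
      congr 1
      abel
    · rw [← h3, ← norm_neg]
      congr 1
      abel
  · intro H x hx
    obtain ⟨f, hf, hfx⟩ := exists_dual_vector'' ℝ x
    have hfx : f x = 1 := by simpa [hx] using hfx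
    have hf := norm_eq_one_of_norm_le_one_of_apply_eq_one hf hx hfx
    refine ⟨f, ⟨hf, hfx⟩, ?_⟩
    rintro g ⟨hg, hgx⟩
    by_contra hne
    obtain ⟨v, hv⟩ : ∃ v, f v - g v ≠ 0 := by
      by_contra! hv
      exact hne (ContinuousLinearMap.ext fun v => (sub_eq_zero.1 (hv v)).symm)
    obtain ⟨d, hfd, hgd⟩ : ∃ d : E, f d = 1 ∧ g d = -1 := by
      refine ⟨(2 / (f v - g v)) • v + (1 - 2 / (f v - g v) * f v) • x, ?_, ?_⟩
      · simp [hfx]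
      · simp only [map_add, map_smul, smul_eq_mul, hgx]
        field_simp
        ring
    obtain ⟨c, r, h1, h2, h3⟩ := H (d - (1 / 2 : ℝ) • x) 0 (-d - (1 / 2 : ℝ) • x) (by
      intro hcol
      rw [collinear_iff_of_mem (p₀ := 0) (by simp)] at hcol
      obtain ⟨w, hw⟩ := hcol
      obtain ⟨a, ha⟩ := hw (d - (1 / 2 : ℝ) • x) (by simp)
      obtain ⟨b, hb⟩ := hw (-d - (1 / 2 : ℝ) • x) (by simp)
      have h1 := congrArg f ha
      have h2 := congrArg g ha
      have h3 := congrArg f hb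
      have h4 := congrArg g hb
      simp only [map_sub, map_neg, map_smul, hfx, hgx, hfd, hgd, smul_eq_mul, vadd_eq_add,
        add_zero] at h1 h2 h3 h4
      have h5 : (a * f w) * (b * g w) = (a * g w) * (b * f w) := by ring
      rw [← h1, ← h2, ← h3, ← h4] at h5
      norm_num at h5)
    exact no_circumscribed_circle_of_two_norming hdim hx hf hg hfx hgx hfd hgd c r h1 h2 h3
end
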